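/- Let β ∈ ℂ with |Re β| < 1/2, let κ ∈ ℂ satisfy κ² = 1 − e^{−2πiβ}, and fix t ∈ ℝ. Then there exist an Ablowitz–Segur Painlevé II function u for κ, a constant C > 0 and N ∈ ℕ such that for every n ≥ N: the Hankel determinants H_{n−1}(λ0(n), β), H_n(λ0(n), β), H_{n+1}(λ0(n), β) are nonzero, the monic orthogonal polynomials p_{n−1}, p_n, p_{n+1} with respect to w(·; λ0(n), β) exist, there are unique scalars Q_n, R_n ∈ ℂ with x·p_n(x) = p_{n+1}(x) + Q_n·p_n(x) + R_n·p_{n−1}(x) as polynomials, and |R_n − n/2 + (1/2)·u(t)²·n^{1/3}| ≤ C. -/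

import Mathlib

open MeasureTheory Filter Polynomial

noncomputable section

/-- `A` is the Airy function `Ai` and `A'` its derivative: the unique solution of
`A'' = x·A` with `A 0 = 3^(-2/3)/Γ(2/3)` and `A' 0 = -3^(-1/3)/Γ(1/3)`. -/
def IsAiry (A A' : ℝ → ℝ) : Prop :=
  (∀ x : ℝ, HasDerivAt A (A' x) x) ∧ (∀ x : ℝ, HasDerivAt A' (x * A x) x) ∧
  A 0 = (3 : ℝ) ^ (-(2 : ℝ) / 3) / Real.Gamma (2 / 3) ∧
  A' 0 = -((3 : ℝ) ^ (-(1 : ℝ) / 3)) / Real.Gamma (1 / 3)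

/-- An Ablowitz–Segur Painlevé II function for `κ`: a twice differentiable `u : ℝ → ℂ`
with `u'' τ = τ·u τ + 2·(u τ)^3` for all `τ` and `u τ / Ai τ → κ` as `τ → +∞`. -/
def IsAblowitzSegur (A : ℝ → ℝ) (κ : ℂ) (u : ℝ → ℂ) : Prop :=
  Differentiable ℝ u ∧ Differentiable ℝ (deriv u) ∧
  (∀ τ : ℝ, deriv (deriv u) τ = (τ : ℂ) * u τ + 2 * u τ ^ 3) ∧
  Tendsto (fun τ : ℝ => u τ / (A τ : ℂ)) atTop (nhds κ)

/-- The discontinuous Gaussian weight `w(x; λ0, β)`. -/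
def w (l : ℝ) (β : ℂ) (x : ℝ) : ℂ :=
  (Real.exp (-x ^ 2) : ℝ) *
    (if x < l then Complex.exp (Real.pi * Complex.I * β)
     else Complex.exp (-(Real.pi * Complex.I * β)))

/-- The Hankel determinant `H_n(λ0, β)` of the moments of `w(·; λ0, β)` (with `H_0 = 1`). -/
def H (n : ℕ) (l : ℝ) (β : ℂ) : ℂ :=
  Matrix.det (Matrix.of fun j k : Fin n =>
    ∫ x : ℝ, (x : ℂ) ^ ((j : ℕ) + (k : ℕ)) * w l β x)

/-- The scaled jump location `λ0(n) = √(2n)·(1 + (t/2)·n^(-2/3))`. -/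
def lam0 (t : ℝ) (n : ℕ) : ℝ :=
  Real.sqrt (2 * n) * (1 + t / 2 * (n : ℝ) ^ (-(2 : ℝ) / 3))

/-- `p` is the monic orthogonal polynomial of degree `n` for the weight `w(·; l, β)`. -/
def MonicOrthPoly (n : ℕ) (l : ℝ) (β : ℂ) (p : Polynomial ℂ) : Prop :=
  p.Monic ∧ p.natDegree = n ∧
  ∀ m : ℕ, m < n → ∫ x : ℝ, p.eval (x : ℂ) * (x : ℂ) ^ m * w l β x = 0

namespace EdgeAsymptotics

open Set Topology

/-- The space of square integrable functions on the half line `(0, ∞)`. -/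
abbrev HalfL2 : Type := Lp ℂ 2 (volume.restrict (Ioi (0 : ℝ)))

/-- Continuous functions which are `O(e^{-x})` on every half line `[T, ∞)`. -/
def ExpDecay {F : Type*} [NormedAddCommGroup F] (g : ℝ → F) : Prop :=
  Continuous g ∧ ∀ T : ℝ, ∃ C : ℝ, ∀ x, T ≤ x → ‖g x‖ ≤ C * Real.exp (-x)

lemma ExpDecay.add {f g : ℝ → ℂ} (hf : ExpDecay f) (hg : ExpDecay g) :
    ExpDecay (fun x => f x + g x) := by
  refine ⟨hf.1.add hg.1, fun T => ?_⟩
  obtain ⟨C, hC⟩ := hf.2 T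
  obtain ⟨D, hD⟩ := hg.2 T
  refine ⟨C + D, fun x hx => (norm_add_le _ _).trans ?_⟩
  rw [add_mul]
  exact add_le_add (hC x hx) (hD x hx)

lemma ExpDecay.const_mul {f : ℝ → ℂ} (hf : ExpDecay f) (c : ℂ) :
    ExpDecay (fun x => c * f x) := by
  refine ⟨continuous_const.mul hf.1, fun T => ?_⟩
  obtain ⟨C, hC⟩ := hf.2 T
  refine ⟨‖c‖ * C, fun x hx => ?_⟩
  rw [norm_mul, mul_assoc]
  exact mul_le_mul_of_nonneg_left (hC x hx) (norm_nonneg _)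

lemma ExpDecay.sub {f g : ℝ → ℂ} (hf : ExpDecay f) (hg : ExpDecay g) :
    ExpDecay (fun x => f x - g x) := by
  simpa [sub_eq_add_neg] using hf.add (hg.const_mul (-1))

lemma ExpDecay.shift {f : ℝ → ℂ} (hf : ExpDecay f) (h : ℝ) : ExpDecay (fun x => f (x + h)) := by
  refine ⟨hf.1.comp (continuous_id.add continuous_const), fun T => ?_⟩
  obtain ⟨C, hC⟩ := hf.2 (T + h)
  refine ⟨C * Real.exp (-h), fun x hx => (hC (x + h) (by linarith)).trans (le_of_eq ?_)⟩
  rw [mul_assoc, ← Real.exp_add]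
  congr 2
  ring

lemma ExpDecay.memLp {g : ℝ → ℂ} (hg : ExpDecay g) (z : ℝ) :
    MemLp (fun x => g (x + z)) 2 (volume.restrict (Ioi (0 : ℝ))) := by
  obtain ⟨C, hC⟩ := (hg.shift z).2 0
  have h_int : IntegrableOn (fun x : ℝ => Real.exp (-x) ^ 2) (Ioi 0) := by
    have := integrableOn_exp_mul_Ioi (a := -2) (by norm_num) 0
    refine this.congr_fun (fun x _ => ?_) measurableSet_Ioi
    simp only
    rw [← Real.exp_nat_mul]
    congr 1
    push_cast
    ring
  have h1 : MemLp (fun x : ℝ => Real.exp (-x)) 2 (volume.restrict (Ioi (0 : ℝ))) := by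
    rw [memLp_two_iff_integrable_sq (by fun_prop)]
    exact h_int
  refine (h1.const_mul C).of_le (hg.shift z).1.aestronglyMeasurable ?_
  filter_upwards [ae_restrict_mem measurableSet_Ioi] with x hx
  exact (hC x (le_of_lt hx)).trans (le_abs_self _)

open Classical in
/-- The translate `x ↦ g (x + z)` as an element of `L²(0, ∞)`. -/
def translate (g : ℝ → ℂ) (z : ℝ) : HalfL2 :=
  if h : MemLp (fun x => g (x + z)) 2 (volume.restrict (Ioi (0 : ℝ))) then h.toLp _ else 0

lemma translate_coeFn {g : ℝ → ℂ} (hg : ExpDecay g) (z : ℝ) :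
    translate g z =ᵐ[volume.restrict (Ioi (0 : ℝ))] fun x => g (x + z) := by
  rw [translate, dif_pos (hg.memLp z)]
  exact MemLp.coeFn_toLp _

lemma translate_add {f g : ℝ → ℂ} (hf : ExpDecay f) (hg : ExpDecay g) (z : ℝ) :
    translate (fun x => f x + g x) z = translate f z + translate g z := by
  refine Lp.ext ?_
  filter_upwards [translate_coeFn hf z, translate_coeFn hg z, translate_coeFn (hf.add hg) z,
    Lp.coeFn_add (translate f z) (translate g z)] with x h1 h2 h3 h4
  rw [h4, h3, Pi.add_apply, h1, h2]

lemma translate_const_mul {f : ℝ → ℂ} (hf : ExpDecay f) (c : ℂ) (z : ℝ) :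
    translate (fun x => c * f x) z = c • translate f z := by
  refine Lp.ext ?_
  filter_upwards [translate_coeFn hf z, translate_coeFn (hf.const_mul c) z,
    Lp.coeFn_smul c (translate f z)] with x h1 h3 h4
  rw [h4, h3, Pi.smul_apply, h1, smul_eq_mul]

lemma translate_sub {f g : ℝ → ℂ} (hf : ExpDecay f) (hg : ExpDecay g) (z : ℝ) :
    translate (fun x => f x - g x) z = translate f z - translate g z := by
  have h := translate_add hf (hg.const_mul (-1)) z
  rw [translate_const_mul hg] at h
  simpa [sub_eq_add_neg] using h

lemma translate_shift (f : ℝ → ℂ) (h z : ℝ) :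
    translate (fun x => f (x + h)) z = translate f (z + h) := by
  have e : (fun x => f (x + z + h)) = fun x => f (x + (z + h)) := by
    funext x
    rw [add_assoc]
  unfold translate
  rw [e]

lemma norm_translate_le {g : ℝ → ℂ} (hg : ExpDecay g) {z C : ℝ}
    (h : ∀ x, z ≤ x → ‖g x‖ ≤ C * Real.exp (-x)) : ‖translate g z‖ ≤ C * Real.exp (-z) := by
  have hC : 0 ≤ C := by
    have := (norm_nonneg _).trans (h z le_rfl)
    exact nonneg_of_mul_nonneg_left this (Real.exp_pos _)
  have hsq : ‖translate g z‖ ^ 2 ≤ (C * Real.exp (-z)) ^ 2 := by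
    have h1 : ‖translate g z‖ ^ 2 = ∫ x in Ioi (0:ℝ), ‖g (x + z)‖ ^ 2 := by
      have := @inner_self_eq_norm_sq ℂ _ _ _ _ (translate g z)
      rw [← this, L2.inner_def, ← integral_re (L2.integrable_inner _ _)]
      refine integral_congr_ae ?_
      filter_upwards [translate_coeFn hg z] with x hx
      rw [hx, inner_self_eq_norm_sq]
    have h2 : ∫ x in Ioi (0:ℝ), (C * Real.exp (-z)) ^ 2 * Real.exp (-2 * x)
        = (C * Real.exp (-z)) ^ 2 * (1 / 2) := by
      rw [integral_const_mul, integral_exp_mul_Ioi (by norm_num)]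
      norm_num
    rw [h1]
    calc _ ≤ ∫ x in Ioi (0:ℝ), (C * Real.exp (-z)) ^ 2 * Real.exp (-2 * x) := by
          refine setIntegral_mono_on ?_ ?_ measurableSet_Ioi (fun x hx => ?_)
          · exact (hg.memLp z).norm.integrable_sq
          · exact (integrableOn_exp_mul_Ioi (by norm_num) 0).const_mul _
          · have := h (x + z) (by linarith [mem_Ioi.1 hx])
            have h3 : C * Real.exp (-(x + z)) = C * Real.exp (-z) * Real.exp (-x) := by
              rw [mul_assoc, ← Real.exp_add]; ring_nf
            have h4 : Real.exp (-2 * x) = Real.exp (-x) ^ 2 := by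
              rw [← Real.exp_nat_mul]; push_cast; ring_nf
            rw [h4, ← mul_pow, ← h3]
            exact pow_le_pow_left₀ (norm_nonneg _) this 2
      _ ≤ _ := by
          rw [h2]
          nlinarith [sq_nonneg (C * Real.exp (-z))]
  exact le_of_sq_le_sq hsq (by positivity)

lemma taylor_two_bound {g g' g'' : ℝ → ℂ} (h1 : ∀ x, HasDerivAt g (g' x) x)
    (h2 : ∀ x, HasDerivAt g' (g'' x) x) {x h M : ℝ}
    (hM : ∀ y, |y - x| ≤ |h| → ‖g'' y‖ ≤ M) :
    ‖g (x + h) - g x - h * g' x‖ ≤ M * |h| ^ 2 := by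
  have hM0 : 0 ≤ M := (norm_nonneg _).trans (hM x (by simp))
  have hconv : Convex ℝ (Metric.closedBall x |h|) := convex_closedBall _ _
  have hx : x ∈ Metric.closedBall x |h| := by simp
  have hmem : ∀ y, y ∈ Metric.closedBall x |h| → |y - x| ≤ |h| := fun y hy => by
    simpa [Real.dist_eq] using hy
  have hg' : ∀ y ∈ Metric.closedBall x |h|, ‖g' y - g' x‖ ≤ M * |h| := fun y hy => by
    have := hconv.norm_image_sub_le_of_norm_hasDerivWithin_le
      (fun z _ => (h2 z).hasDerivWithinAt) (fun z hz => hM z (hmem z hz)) hx hy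
    refine this.trans (mul_le_mul_of_nonneg_left ?_ hM0)
    rw [Real.norm_eq_abs]
    exact hmem y hy
  have hxh : x + h ∈ Metric.closedBall x |h| := by simp
  have key := hconv.norm_image_sub_le_of_norm_hasDerivWithin_le
    (f := fun y : ℝ => g y - (y : ℂ) * g' x) (f' := fun y => g' y - g' x) (C := M * |h|)
    (fun z _ => by
      have := (h1 z).sub ((Complex.ofRealCLM.hasDerivAt (x := z)).mul_const (g' x))
      rw [Complex.ofRealCLM_apply, Complex.ofReal_one, one_mul] at this
      exact this.hasDerivWithinAt)
    (fun z hz => hg' z hz) hx hxh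
  have e : g (x + h) - ((x + h : ℝ) : ℂ) * g' x - (g x - (x : ℂ) * g' x)
      = g (x + h) - g x - h * g' x := by
    push_cast; ring
  rw [e] at key
  simpa [pow_two, mul_assoc] using key

lemma hasDerivAt_translate {g g' g'' : ℝ → ℂ} (hg : ExpDecay g) (hg' : ExpDecay g')
    (hg'' : ExpDecay g'') (h1 : ∀ x, HasDerivAt g (g' x) x) (h2 : ∀ x, HasDerivAt g' (g'' x) x)
    (z : ℝ) : HasDerivAt (translate g) (translate g' z) z := by
  obtain ⟨C, hC⟩ := hg''.2 (z - 1)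
  have hC0 : 0 ≤ C :=
    nonneg_of_mul_nonneg_left ((norm_nonneg _).trans (hC z (by linarith))) (Real.exp_pos _)
  rw [hasDerivAt_iff_isLittleO_nhds_zero]
  have hO : (fun h : ℝ => translate g (z + h) - translate g z - h • translate g' z)
      =O[𝓝 0] fun h : ℝ => h ^ 2 := by
    refine Asymptotics.IsBigO.of_bound (C * Real.exp 1 * Real.exp (-z)) ?_
    filter_upwards [Metric.ball_mem_nhds (0 : ℝ) one_pos] with h hh
    have hh : |h| < 1 := by simpa using hh
    have hd : ExpDecay (fun x => g (x + h) - g x) := (hg.shift h).sub hg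
    have e : translate g (z + h) - translate g z - h • translate g' z
        = translate (fun x => g (x + h) - g x - h * g' x) z := by
      rw [translate_sub hd (hg'.const_mul h), translate_sub (hg.shift h) hg, translate_shift,
        translate_const_mul hg']
      rfl
    rw [e]
    have := norm_translate_le (z := z) (C := C * Real.exp 1 * |h| ^ 2)
      (hd.sub (hg'.const_mul h)) (fun x hx => by
        have := taylor_two_bound h1 h2 (x := x) (h := h) (M := C * Real.exp 1 * Real.exp (-x))
          (fun y hy => by
            have hy := (abs_le.1 (hy.trans hh.le)).1
            refine (hC y (by linarith)).trans ?_
            rw [mul_assoc, ← Real.exp_add]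
            exact mul_le_mul_of_nonneg_left (Real.exp_le_exp.2 (by linarith)) hC0)
        refine this.trans (le_of_eq ?_)
        ring)
    refine this.trans (le_of_eq ?_)
    rw [norm_pow, Real.norm_eq_abs]
    ring
  refine hO.trans_isLittleO ?_
  simpa using Asymptotics.isLittleO_pow_pow (𝕜 := ℝ) (m := 1) (n := 2) (by norm_num)

/-- The bilinear pairing `∫ f g` on `L²(0, ∞)`. -/
def pairing : HalfL2 →L[ℂ] HalfL2 →L[ℂ] ℂ :=
  (ContinuousLinearMap.mul ℂ ℂ).lpPairing (volume.restrict (Ioi (0 : ℝ))) 2 2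

lemma pairing_eq (f g : HalfL2) : pairing f g = ∫ x in Ioi (0 : ℝ), f x * g x :=
  ContinuousLinearMap.lpPairing_eq_integral _ _ _

lemma pairing_comm (f g : HalfL2) : pairing f g = pairing g f := by
  simp only [pairing_eq, mul_comm]

lemma pairing_translate {f g : ℝ → ℂ} (hf : ExpDecay f) (hg : ExpDecay g) (y z : ℝ) :
    pairing (translate f y) (translate g z) = ∫ x in Ioi (0 : ℝ), f (x + y) * g (x + z) := by
  rw [pairing_eq]
  refine integral_congr_ae ?_
  filter_upwards [translate_coeFn hf y, translate_coeFn hg z] with x h1 h2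
  rw [h1, h2]

set_option linter.unusedSectionVars false

section Decay

variable {F G H' : Type*} [NormedAddCommGroup F] [NormedSpace ℂ F] [NormedAddCommGroup G]
  [NormedSpace ℂ G] [NormedAddCommGroup H'] [NormedSpace ℂ H']

lemma ExpDecay.bilin {f : ℝ → F} {g : ℝ → G} (hf : ExpDecay f) (hg : ExpDecay g)
    (β : F →L[ℂ] G →L[ℂ] H') : ExpDecay (fun z => β (f z) (g z)) := by
  refine ⟨(β.continuous.comp hf.1).clm_apply hg.1, fun T => ?_⟩
  obtain ⟨C, hC⟩ := hf.2 T
  obtain ⟨D, hD⟩ := hg.2 T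
  have hC0 : 0 ≤ C :=
    nonneg_of_mul_nonneg_left ((norm_nonneg _).trans (hC T le_rfl)) (Real.exp_pos _)
  have hD0 : 0 ≤ D :=
    nonneg_of_mul_nonneg_left ((norm_nonneg _).trans (hD T le_rfl)) (Real.exp_pos _)
  refine ⟨‖β‖ * C * D * Real.exp (-T), fun x hx => ?_⟩
  calc ‖β (f x) (g x)‖ ≤ ‖β‖ * ‖f x‖ * ‖g x‖ := β.le_opNorm₂ _ _
    _ ≤ ‖β‖ * (C * Real.exp (-x)) * (D * Real.exp (-T)) := by
        have h1 := hC x hx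
        have h2 : ‖g x‖ ≤ D * Real.exp (-T) := (hD x hx).trans
          (mul_le_mul_of_nonneg_left (Real.exp_le_exp.2 (by linarith)) hD0)
        gcongr
    _ = _ := by ring

lemma ExpDecay.clm {f : ℝ → F} (hf : ExpDecay f) (L : F →L[ℂ] G) :
    ExpDecay (fun z => L (f z)) := by
  refine ⟨L.continuous.comp hf.1, fun T => ?_⟩
  obtain ⟨C, hC⟩ := hf.2 T
  refine ⟨‖L‖ * C, fun x hx => (L.le_opNorm _).trans ?_⟩
  rw [mul_assoc]
  exact mul_le_mul_of_nonneg_left (hC x hx) (norm_nonneg _)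

lemma ExpDecay.vadd {f g : ℝ → F} (hf : ExpDecay f) (hg : ExpDecay g) :
    ExpDecay (fun x => f x + g x) := by
  refine ⟨hf.1.add hg.1, fun T => ?_⟩
  obtain ⟨C, hC⟩ := hf.2 T
  obtain ⟨D, hD⟩ := hg.2 T
  refine ⟨C + D, fun x hx => (norm_add_le _ _).trans ?_⟩
  rw [add_mul]
  exact add_le_add (hC x hx) (hD x hx)

lemma ExpDecay.vsub {f g : ℝ → F} (hf : ExpDecay f) (hg : ExpDecay g) :
    ExpDecay (fun x => f x - g x) := by
  simpa [sub_eq_add_neg] using hf.vadd (hg.clm (-ContinuousLinearMap.id ℂ F))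

lemma ExpDecay.congr {f g : ℝ → F} (hf : ExpDecay f) (h : ∀ z, g z = f z) : ExpDecay g := by
  rwa [funext h]

lemma ExpDecay.integrableOn {f : ℝ → F} (hf : ExpDecay f) (t : ℝ) : IntegrableOn f (Ioi t) := by
  obtain ⟨C, hC⟩ := hf.2 t
  have h : IntegrableOn (fun x : ℝ => C * Real.exp (-x)) (Ioi t) := by
    have := (integrableOn_exp_mul_Ioi (a := -1) (by norm_num) t).const_mul C
    simp only [neg_mul, one_mul] at this
    exact this
  refine Integrable.mono' h hf.1.aestronglyMeasurable ?_
  filter_upwards [ae_restrict_mem measurableSet_Ioi] with x hx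
  exact hC x (le_of_lt hx)

lemma ExpDecay.tendsto {f : ℝ → F} (hf : ExpDecay f) : Tendsto f atTop (𝓝 0) := by
  obtain ⟨C, hC⟩ := hf.2 0
  have h : Tendsto (fun x : ℝ => C * Real.exp (-x)) atTop (𝓝 0) := by
    simpa using (Real.tendsto_exp_neg_atTop_nhds_zero).const_mul C
  exact squeeze_zero_norm' ((eventually_ge_atTop 0).mono fun x hx => hC x hx) h

variable [CompleteSpace F]

lemma ExpDecay.hasDerivAt_integral_Ioi {f : ℝ → F} (hf : ExpDecay f) (t : ℝ) :
    HasDerivAt (fun t => ∫ z in Ioi t, f z) (-f t) t := by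
  have e : (fun s => ∫ z in Ioi s, f z) = fun s => (∫ z in Ioi t, f z) - ∫ z in t..s, f z := by
    funext s
    rw [← intervalIntegral.integral_Ioi_sub_Ioi' (hf.integrableOn t) (hf.integrableOn s)]
    abel
  rw [e]
  exact (intervalIntegral.integral_hasDerivAt_right (hf.1.intervalIntegrable _ _)
    (hf.1.stronglyMeasurableAtFilter _ _) hf.1.continuousAt).const_sub _

lemma ExpDecay.integral_Ioi_deriv {f f' : ℝ → F} (hf : ExpDecay f) (hf' : ExpDecay f')
    (h : ∀ z, HasDerivAt f (f' z) z) (t : ℝ) : ∫ z in Ioi t, f' z = -f t := by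
  rw [integral_Ioi_of_hasDerivAt_of_tendsto' (fun x _ => h x) (hf'.integrableOn t) hf.tendsto,
    zero_sub]

end Decay

section System

variable {E : Type*} [NormedAddCommGroup E] [NormedSpace ℂ E]

/-- The rank one operator `f ↦ B x f • y` attached to a bilinear form `B`, as a bilinear map. -/
def rankOne (B : E →L[ℂ] E →L[ℂ] ℂ) : E →L[ℂ] E →L[ℂ] (E →L[ℂ] E) :=
  (ContinuousLinearMap.smulRightL ℂ E E).comp B

@[simp] lemma rankOne_apply (B : E →L[ℂ] E →L[ℂ] ℂ) (x y f : E) :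
    rankOne B x y f = B x f • y := rfl

/-- Curves `a`, `b = a'`, `d = a''` of translates of the Airy function `A0` (with `A1 = A0'`) in
an abstract space with a symmetric bilinear form `B`. -/
structure AirySystem (B : E →L[ℂ] E →L[ℂ] ℂ) (A0 A1 : ℝ → ℂ) (a b d : ℝ → E) : Prop where
  symm : ∀ f g, B f g = B g f
  deriv_A0 : ∀ z, HasDerivAt A0 (A1 z) z
  deriv_A1 : ∀ z : ℝ, HasDerivAt A1 (z * A0 z) z
  deriv_a : ∀ z, HasDerivAt a (b z) z
  deriv_b : ∀ z, HasDerivAt b (d z) z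
  decay_A0 : ExpDecay A0
  decay_A1 : ExpDecay A1
  decay_a : ExpDecay a
  decay_b : ExpDecay b
  decay_d : ExpDecay d
  decay_za : ExpDecay (fun z : ℝ => (z : ℂ) • a z)
  parts : ∀ z y, B (b z) (a y) + B (a z) (b y) = -(A0 z * A0 y)
  mul_symm : ∀ z y : ℝ, B (a z) (d y - (y : ℂ) • a y) = B (d z - (z : ℂ) • a z) (a y)

/-- The Airy kernel operator. -/
def airyOp (B : E →L[ℂ] E →L[ℂ] ℂ) (a : ℝ → E) (t : ℝ) : E →L[ℂ] E :=
  ∫ z in Ioi t, rankOne B (a z) (a z)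

/-- The boundary row of the Airy kernel. -/
def airyRow (A0 : ℝ → ℂ) (a : ℝ → E) (t : ℝ) : E := ∫ z in Ioi t, A0 z • a z

variable [CompleteSpace E] {B : E →L[ℂ] E →L[ℂ] ℂ} {A0 A1 : ℝ → ℂ} {a b d : ℝ → E}

namespace AirySystem

lemma decay_rankOne (h : AirySystem B A0 A1 a b d) :
    ExpDecay (fun z => rankOne B (a z) (a z)) := h.decay_a.bilin h.decay_a _

lemma airyOp_apply (h : AirySystem B A0 A1 a b d) (t : ℝ) (f : E) :
    airyOp B a t f = ∫ z in Ioi t, B (a z) f • a z := by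
  rw [airyOp, ContinuousLinearMap.integral_apply (h.decay_rankOne.integrableOn t)]
  rfl

lemma decay_smul {g h : ℝ → E} (hg : ExpDecay g) (hh : ExpDecay h) (f : E) :
    ExpDecay (fun z => B (g z) f • h z) :=
  (hg.clm (B.flip f)).bilin hh (ContinuousLinearMap.lsmul ℂ ℂ)

lemma apply_integral {g h : ℝ → E} (hg : ExpDecay g) (hh : ExpDecay h) (f x : E) (t : ℝ) :
    B x (∫ z in Ioi t, B (g z) f • h z) = ∫ z in Ioi t, B (g z) f * B x (h z) := by
  rw [← ContinuousLinearMap.integral_comp_comm _ ((decay_smul hg hh f).integrableOn t)]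
  simp

lemma airyOp_symm (h : AirySystem B A0 A1 a b d) (t : ℝ) (f g : E) :
    B f (airyOp B a t g) = B (airyOp B a t f) g := by
  rw [h.symm (airyOp B a t f), h.airyOp_apply, h.airyOp_apply, apply_integral h.decay_a h.decay_a,
    apply_integral h.decay_a h.decay_a]
  refine integral_congr_ae (Eventually.of_forall fun z => ?_)
  simp only
  rw [h.symm f, h.symm g, mul_comm]

lemma decay_row (h : AirySystem B A0 A1 a b d) : ExpDecay (fun z => A0 z • a z) :=
  h.decay_A0.bilin h.decay_a (ContinuousLinearMap.lsmul ℂ ℂ)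

lemma airyRow_apply (h : AirySystem B A0 A1 a b d) (t : ℝ) (f : E) :
    B (airyRow A0 a t) f = ∫ z in Ioi t, A0 z * B (a z) f := by
  rw [airyRow, h.symm, ← ContinuousLinearMap.integral_comp_comm _ (h.decay_row.integrableOn t)]
  refine integral_congr_ae (Eventually.of_forall fun z => ?_)
  simp [h.symm f]

variable {γ : ℂ}

/-- The resolvent `(1 - γ K_t)⁻¹`. -/
def res (B : E →L[ℂ] E →L[ℂ] ℂ) (a : ℝ → E) (γ : ℂ) (t : ℝ) : E →L[ℂ] E :=
  Ring.inverse (1 - γ • airyOp B a t)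

lemma res_right (hu : ∀ t, IsUnit (1 - γ • airyOp B a t)) (t : ℝ) (f : E) :
    res B a γ t f - γ • airyOp B a t (res B a γ t f) = f := by
  have := congrArg (fun T : E →L[ℂ] E => T f) (Ring.mul_inverse_cancel _ (hu t))
  simpa [res] using this

lemma res_left (hu : ∀ t, IsUnit (1 - γ • airyOp B a t)) (t : ℝ) (f : E) :
    res B a γ t (f - γ • airyOp B a t f) = f := by
  have := congrArg (fun T : E →L[ℂ] E => T f) (Ring.inverse_mul_cancel _ (hu t))
  simpa [res] using this

lemma res_symm (h : AirySystem B A0 A1 a b d) (hu : ∀ t, IsUnit (1 - γ • airyOp B a t)) (t : ℝ)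
    (f g : E) : B f (res B a γ t g) = B (res B a γ t f) g := by
  conv_lhs => rw [← res_right hu t f]
  conv_rhs => rw [← res_right hu t g]
  simp [h.airyOp_symm]

lemma hasDerivAt_res (h : AirySystem B A0 A1 a b d) (hu : ∀ t, IsUnit (1 - γ • airyOp B a t))
    (t : ℝ) : HasDerivAt (res B a γ)
      (-(res B a γ t * (γ • rankOne B (a t) (a t)) * res B a γ t)) t := by
  have h1 : HasDerivAt (fun t => 1 - γ • airyOp B a t) (γ • rankOne B (a t) (a t)) t := by
    have := ((h.decay_rankOne.hasDerivAt_integral_Ioi t).const_smul γ).const_sub 1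
    exact this.congr_deriv (by simp)
  obtain ⟨x, hx⟩ := hu t
  have h2 := hasFDerivAt_ringInverse (𝕜 := ℝ) x
  rw [hx] at h2
  have h3 := h2.comp_hasDerivAt t h1
  have e : res B a γ t = (↑x⁻¹ : E →L[ℂ] E) := by
    rw [res, ← hx, Ring.inverse_unit]
  rw [e]
  exact h3.congr_deriv (by simp)

lemma hasDerivAt_res_apply (h : AirySystem B A0 A1 a b d)
    (hu : ∀ t, IsUnit (1 - γ • airyOp B a t)) {f : ℝ → E} {f' : E} {t : ℝ}
    (hf : HasDerivAt f f' t) : HasDerivAt (fun t => res B a γ t (f t))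
      (res B a γ t f' - (γ * B (a t) (res B a γ t (f t))) • res B a γ t (a t)) t := by
  have h1 := h.hasDerivAt_res hu t
  let R : (E →L[ℂ] E) →L[ℝ] (E →L[ℝ] E) :=
    (ContinuousLinearMap.restrictScalarsL ℂ E E ℝ ℝ)
  have h2 := (R.hasFDerivAt.comp_hasDerivAt t h1).clm_apply hf
  have e : (fun t => res B a γ t (f t)) = fun t => (R (res B a γ t)) (f t) := rfl
  rw [e]
  refine h2.congr_deriv ?_
  have e2 : ∀ (T : E →L[ℂ] E) (x : E), R T x = T x := fun _ _ => rfl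
  simp only [Function.comp_apply, e2]
  simp [smul_smul]
  abel

end AirySystem
end System

section Painleve

variable {E : Type*} [NormedAddCommGroup E] [NormedSpace ℂ E]

/-- The Painlevé II transcendent `A₀(t) + γ B(k_t, (1 - γ K_t)⁻¹ a_t)` up to normalisation. -/
def painleveQ (B : E →L[ℂ] E →L[ℂ] ℂ) (A0 : ℝ → ℂ) (a : ℝ → E) (γ : ℂ) (t : ℝ) : ℂ :=
  A0 t + γ * B (airyRow A0 a t) (AirySystem.res B a γ t (a t))

/-- The companion `A₁(t) + γ B(k_t, (1 - γ K_t)⁻¹ b_t)` of `painleveQ`. -/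
def painleveP (B : E →L[ℂ] E →L[ℂ] ℂ) (A0 A1 : ℝ → ℂ) (a b : ℝ → E) (γ : ℂ) (t : ℝ) : ℂ :=
  A1 t + γ * B (airyRow A0 a t) (AirySystem.res B a γ t (b t))

variable [CompleteSpace E] {B : E →L[ℂ] E →L[ℂ] ℂ} {A0 A1 : ℝ → ℂ} {a b d : ℝ → E} {γ : ℂ}

namespace AirySystem

lemma integral_smul_parts {f f' g g' : ℝ → E} (hf : ExpDecay f) (hf' : ExpDecay f')
    (hg : ExpDecay g) (hg' : ExpDecay g') (h1 : ∀ z, HasDerivAt f (f' z) z)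
    (h2 : ∀ z, HasDerivAt g (g' z) z) (x : E) (t : ℝ) :
    (∫ z in Ioi t, B (f' z) x • g z) + ∫ z in Ioi t, B (f z) x • g' z
      = -(B (f t) x • g t) := by
  have i1 := decay_smul (B := B) hf' hg x
  have i2 := decay_smul (B := B) hf hg' x
  rw [← integral_add (i1.integrableOn t) (i2.integrableOn t)]
  refine (decay_smul (B := B) hf hg x).integral_Ioi_deriv (i1.vadd i2) (fun z => ?_) t
  have h3 : HasDerivAt (fun z => B (f z) x) (B (f' z) x) z :=
    ((B.flip x).restrictScalars ℝ).hasFDerivAt.comp_hasDerivAt z (h1 z)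
  exact (h3.smul (h2 z)).congr_deriv (by abel)

lemma res_eq (hu : ∀ t, IsUnit (1 - γ • airyOp B a t)) {t : ℝ} {f g : E}
    (h : f - γ • airyOp B a t f = g) : res B a γ t g = f := by
  rw [← h, res_left hu]

lemma decay_c (h : AirySystem B A0 A1 a b d) : ExpDecay (fun z : ℝ => d z - (z : ℂ) • a z) :=
  h.decay_d.vsub h.decay_za

lemma row_res_eq (h : AirySystem B A0 A1 a b d) (hu : ∀ t, IsUnit (1 - γ • airyOp B a t))
    (t : ℝ) : γ * B (a t) (res B a γ t (airyRow A0 a t)) = painleveQ B A0 a γ t - A0 t := by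
  rw [painleveQ, add_sub_cancel_left, h.res_symm hu, h.symm]

lemma res_expand (h : AirySystem B A0 A1 a b d) (hu : ∀ t, IsUnit (1 - γ • airyOp B a t))
    (t : ℝ) (x : E) : B x (res B a γ t (a t)) = B x (a t)
      + γ * ∫ z in Ioi t, B (a z) (res B a γ t (a t)) * B x (a z) := by
  conv_lhs => rw [← sub_add_cancel (res B a γ t (a t)) (γ • airyOp B a t (res B a γ t (a t))),
    res_right hu t (a t)]
  rw [map_add, map_smul, smul_eq_mul, h.airyOp_apply, apply_integral h.decay_a h.decay_a]

lemma two_mul_v (h : AirySystem B A0 A1 a b d) (hu : ∀ t, IsUnit (1 - γ • airyOp B a t)) (t : ℝ) :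
    2 * B (a t) (res B a γ t (b t)) = γ * B (a t) (res B a γ t (a t)) ^ 2
      - painleveQ B A0 a γ t ^ 2 := by
  set Q := res B a γ t (a t) with hQ
  set D : E := b t + γ • ∫ z in Ioi t, B (a z) Q • b z with hD
  have h1 : ∀ z, B (a z) D + B (b z) Q = -(A0 z * painleveQ B A0 a γ t) := fun z => by
    have i1 : IntegrableOn (fun y => B (a y) Q * B (a z) (b y)) (Ioi t) :=
      (((h.decay_a.clm (B.flip Q)).bilin (h.decay_b.clm (B (a z)))
        (ContinuousLinearMap.mul ℂ ℂ))).integrableOn t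
    have i2 : IntegrableOn (fun y => B (a y) Q * B (b z) (a y)) (Ioi t) :=
      (((h.decay_a.clm (B.flip Q)).bilin (h.decay_a.clm (B (b z)))
        (ContinuousLinearMap.mul ℂ ℂ))).integrableOn t
    have e : (∫ y in Ioi t, B (a y) Q * B (a z) (b y)) + (∫ y in Ioi t, B (a y) Q * B (b z) (a y))
        = -(A0 z * B (airyRow A0 a t) Q) := by
      rw [← integral_add i1 i2, h.airyRow_apply, ← integral_const_mul, ← integral_neg]
      refine integral_congr_ae (Eventually.of_forall fun y => ?_)
      have := h.parts z y
      simp only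
      linear_combination B (a y) Q * this
    rw [hQ, h.res_expand hu, ← hQ, hD, map_add, map_smul, smul_eq_mul,
      apply_integral h.decay_a h.decay_b, painleveQ, ← hQ]
    linear_combination h.parts z t + γ * e
  have h2 : D - γ • airyOp B a t D = b t - (γ * B (a t) Q) • a t
      + (γ * painleveQ B A0 a γ t) • airyRow A0 a t := by
    have i3 : IntegrableOn (fun z => -(painleveQ B A0 a γ t • A0 z • a z)) (Ioi t) :=
      ((h.decay_row.integrableOn t).smul (painleveQ B A0 a γ t)).neg
    have e : airyOp B a t D = -(painleveQ B A0 a γ t • airyRow A0 a t)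
        - ∫ z in Ioi t, B (b z) Q • a z := by
      rw [h.airyOp_apply, airyRow, ← integral_smul, ← integral_neg, ← integral_sub i3
        ((decay_smul h.decay_b h.decay_a Q).integrableOn t)]
      refine integral_congr_ae (Eventually.of_forall fun z => ?_)
      simp only
      rw [eq_sub_of_add_eq (h1 z), sub_smul, smul_smul, neg_smul, mul_comm]
    have e2 := integral_smul_parts (B := B) h.decay_a h.decay_b h.decay_a h.decay_b h.deriv_a
      h.deriv_a Q t
    rw [e, hD]
    have e3 := congrArg (fun x => γ • x) e2
    simp only [smul_add, smul_neg, smul_smul] at e3 ⊢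
    simp only [smul_sub, smul_neg, smul_smul]
    rw [← sub_eq_zero] at e3 ⊢
    rw [← e3]
    abel
  have h3 := res_eq hu h2
  rw [map_add, map_sub, map_smul, map_smul, ← hQ] at h3
  have h4 := h1 t
  rw [← h3] at h4
  simp only [map_add, map_sub, map_smul, smul_eq_mul] at h4
  have h5 := h.row_res_eq hu t
  have h6 : B (b t) Q = B (a t) (res B a γ t (b t)) := by
    rw [hQ, h.res_symm hu, h.symm]
  rw [h6] at h4
  linear_combination h4 - painleveQ B A0 a γ t * h5

lemma res_mul (h : AirySystem B A0 A1 a b d) (hu : ∀ t, IsUnit (1 - γ • airyOp B a t)) (t : ℝ) :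
    B (airyRow A0 a t) (res B a γ t (d t - (t : ℂ) • a t))
      = A1 t * B (a t) (res B a γ t (a t)) - A0 t * B (a t) (res B a γ t (b t))
        + γ * B (a t) (res B a γ t (a t)) * B (airyRow A0 a t) (res B a γ t (b t))
        - γ * B (a t) (res B a γ t (b t)) * B (airyRow A0 a t) (res B a γ t (a t)) := by
  set Q := res B a γ t (a t) with hQ
  set c : ℝ → E := fun z : ℝ => d z - (z : ℂ) • a z with hc
  set M : E := c t + γ • ∫ z in Ioi t, B (a z) Q • c z with hM
  have h6 : B (b t) Q = B (a t) (res B a γ t (b t)) := by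
    rw [hQ, h.res_symm hu, h.symm]
  have h1 : ∀ z, B (a z) M = B (c z) Q := fun z => by
    rw [hM, map_add, map_smul, smul_eq_mul, apply_integral h.decay_a h.decay_c, hQ,
      h.res_expand hu t (c z), h.mul_symm z t, ← hQ]
    congr 2
    refine integral_congr_ae (Eventually.of_forall fun y => ?_)
    simp only [hc]
    rw [h.mul_symm]
  have h2 : M - γ • airyOp B a t M = c t - (γ * B (a t) Q) • b t + (γ * B (b t) Q) • a t := by
    have e2 := integral_smul_parts (B := B) h.decay_a h.decay_b h.decay_b h.decay_d h.deriv_a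
      h.deriv_b Q t
    have e3 := integral_smul_parts (B := B) h.decay_b h.decay_d h.decay_a h.decay_b h.deriv_b
      h.deriv_a Q t
    have e4 : airyOp B a t M = (∫ z in Ioi t, B (d z) Q • a z)
        - ∫ z in Ioi t, B ((z : ℂ) • a z) Q • a z := by
      rw [h.airyOp_apply, ← integral_sub ((decay_smul h.decay_d h.decay_a Q).integrableOn t)
        ((decay_smul h.decay_za h.decay_a Q).integrableOn t)]
      refine integral_congr_ae (Eventually.of_forall fun z => ?_)
      simp only
      rw [h1 z, hc, map_sub, sub_apply, sub_smul]
    have e5 : (∫ z in Ioi t, B (a z) Q • c z) = (∫ z in Ioi t, B (a z) Q • d z)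
        - ∫ z in Ioi t, B ((z : ℂ) • a z) Q • a z := by
      rw [← integral_sub ((decay_smul h.decay_a h.decay_d Q).integrableOn t)
        ((decay_smul h.decay_za h.decay_a Q).integrableOn t)]
      refine integral_congr_ae (Eventually.of_forall fun z => ?_)
      simp only [hc]
      rw [smul_sub, smul_smul, map_smul, smul_apply, smul_eq_mul, mul_comm]
    rw [e4, hM, e5]
    have e7 := congrArg (fun x => γ • x) (congrArg₂ (· - ·) e2 e3)
    simp only [smul_add, smul_sub, smul_neg, smul_smul] at e7 ⊢
    rw [← sub_eq_zero] at e7 ⊢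
    rw [← e7]
    abel
  have h3 := res_eq hu h2
  rw [map_add, map_sub, map_smul, map_smul, ← hQ] at h3
  have h4 : B (airyRow A0 a t) M = A1 t * B (a t) Q - A0 t * B (b t) Q := by
    rw [h.airyRow_apply]
    have j1 : ExpDecay (fun z => A0 z * B (b z) Q - A1 z * B (a z) Q) :=
      ((h.decay_A0.bilin (h.decay_b.clm (B.flip Q)) (ContinuousLinearMap.mul ℂ ℂ))).vsub
      ((h.decay_A1.bilin (h.decay_a.clm (B.flip Q)) (ContinuousLinearMap.mul ℂ ℂ)))
    have j2 : ExpDecay (fun z => A0 z * B (a z) M) :=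
      (h.decay_A0.bilin (h.decay_c.clm (B.flip Q)) (ContinuousLinearMap.mul ℂ ℂ)).congr
        fun z => by rw [h1 z]; rfl
    rw [j1.integral_Ioi_deriv j2 (fun z => ?_) t]
    · ring
    have k1 : HasDerivAt (fun z => B (b z) Q) (B (d z) Q) z :=
      ((B.flip Q).restrictScalars ℝ).hasFDerivAt.comp_hasDerivAt z (h.deriv_b z)
    have k2 : HasDerivAt (fun z => B (a z) Q) (B (b z) Q) z :=
      ((B.flip Q).restrictScalars ℝ).hasFDerivAt.comp_hasDerivAt z (h.deriv_a z)
    refine (((h.deriv_A0 z).mul k1).sub ((h.deriv_A1 z).mul k2)).congr_deriv ?_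
    rw [h1, hc, map_sub, sub_apply, map_smul, smul_apply,
      smul_eq_mul]
    ring
  rw [← h3] at h4
  simp only [map_add, map_sub, map_smul, smul_eq_mul] at h4 ⊢
  simp only [hc, map_sub, map_smul, smul_eq_mul, ← hQ] at h4 ⊢
  rw [h6] at h4
  linear_combination h4

lemma hasDerivAt_row (h : AirySystem B A0 A1 a b d) (t : ℝ) :
    HasDerivAt (airyRow A0 a) (-(A0 t • a t)) t := h.decay_row.hasDerivAt_integral_Ioi t

lemma hasDerivAt_bilin {f g : ℝ → E} {f' g' : E} {t : ℝ} (hf : HasDerivAt f f' t)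
    (hg : HasDerivAt g g' t) : HasDerivAt (fun t => B (f t) (g t)) (B f' (g t) + B (f t) g') t := by
  let R : (E →L[ℂ] ℂ) →L[ℝ] (E →L[ℝ] ℂ) := (ContinuousLinearMap.restrictScalarsL ℂ E ℂ ℝ ℝ)
  exact (R.hasFDerivAt.comp_hasDerivAt t
    ((B.restrictScalars ℝ).hasFDerivAt.comp_hasDerivAt t hf)).clm_apply hg

lemma hasDerivAt_painleveQ (h : AirySystem B A0 A1 a b d)
    (hu : ∀ t, IsUnit (1 - γ • airyOp B a t)) (t : ℝ) :
    HasDerivAt (painleveQ B A0 a γ) (painleveP B A0 A1 a b γ t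
      - γ * B (a t) (res B a γ t (a t)) * painleveQ B A0 a γ t) t := by
  have h1 := hasDerivAt_bilin (B := B) (h.hasDerivAt_row t)
    (h.hasDerivAt_res_apply hu (h.deriv_a t))
  refine ((h.deriv_A0 t).add (h1.const_mul γ)).congr_deriv ?_
  simp only [painleveQ, painleveP, map_neg, map_smul, map_sub, neg_apply,
    smul_apply, smul_eq_mul]
  ring

lemma hasDerivAt_painleveP (h : AirySystem B A0 A1 a b d)
    (hu : ∀ t, IsUnit (1 - γ • airyOp B a t)) (t : ℝ) :
    HasDerivAt (painleveP B A0 A1 a b γ) (t * painleveQ B A0 a γ t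
      + γ * B (a t) (res B a γ t (a t)) * painleveP B A0 A1 a b γ t
      - 2 * γ * B (a t) (res B a γ t (b t)) * painleveQ B A0 a γ t) t := by
  have h1 := hasDerivAt_bilin (B := B) (h.hasDerivAt_row t)
    (h.hasDerivAt_res_apply hu (h.deriv_b t))
  have h2 := h.res_mul hu t
  refine ((h.deriv_A1 t).add (h1.const_mul γ)).congr_deriv ?_
  simp only [painleveQ, painleveP, map_neg, map_smul, map_sub, neg_apply,
    smul_apply, smul_eq_mul] at h2 ⊢
  linear_combination γ * h2

lemma hasDerivAt_u (h : AirySystem B A0 A1 a b d)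
    (hu : ∀ t, IsUnit (1 - γ • airyOp B a t)) (t : ℝ) :
    HasDerivAt (fun t => B (a t) (res B a γ t (a t))) (-painleveQ B A0 a γ t ^ 2) t := by
  refine (hasDerivAt_bilin (B := B) (h.deriv_a t)
    (h.hasDerivAt_res_apply hu (h.deriv_a t))).congr_deriv ?_
  have h6 : B (b t) (res B a γ t (a t)) = B (a t) (res B a γ t (b t)) := by
    rw [h.res_symm hu, h.symm]
  rw [h6]
  simp only [map_smul, map_sub, smul_eq_mul]
  linear_combination h.two_mul_v hu t

/-- The function `painleveQ` solves `q'' = t q + 2 γ q³`. -/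
lemma painleve_ode (h : AirySystem B A0 A1 a b d)
    (hu : ∀ t, IsUnit (1 - γ • airyOp B a t)) (t : ℝ) :
    HasDerivAt (fun t => painleveP B A0 A1 a b γ t
      - γ * B (a t) (res B a γ t (a t)) * painleveQ B A0 a γ t)
      (t * painleveQ B A0 a γ t + 2 * γ * painleveQ B A0 a γ t ^ 3) t := by
  refine ((h.hasDerivAt_painleveP hu t).sub (((h.hasDerivAt_u hu t).const_mul γ).mul
    (h.hasDerivAt_painleveQ hu t))).congr_deriv ?_
  linear_combination -γ * painleveQ B A0 a γ t * h.two_mul_v hu t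

end AirySystem
end Painleve

section Airy

/-- The point `2 + iη` of the integration line. -/
def linePt (η : ℝ) : ℂ := 2 + η * Complex.I

lemma linePt_re (η : ℝ) : (linePt η).re = 2 := by simp [linePt]

lemma linePt_im (η : ℝ) : (linePt η).im = η := by simp [linePt]

@[fun_prop] lemma continuous_linePt : Continuous linePt := by unfold linePt; fun_prop

lemma norm_linePt_sq (η : ℝ) : ‖linePt η‖ ^ 2 = 4 + η ^ 2 := by
  rw [← Complex.normSq_eq_norm_sq, Complex.normSq_apply, linePt_re, linePt_im]; ring

lemma one_le_norm_linePt (η : ℝ) : 1 ≤ ‖linePt η‖ := by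
  nlinarith [norm_linePt_sq η, norm_nonneg (linePt η), sq_nonneg η]

lemma norm_linePt_pow_le (k : ℕ) {δ : ℝ} (hδ : 0 < δ) :
    ∃ C, 0 ≤ C ∧ ∀ η : ℝ, ‖linePt η‖ ^ k ≤ C * Real.exp (δ * η ^ 2) := by
  refine ⟨(δ ^ k)⁻¹ * k.factorial * Real.exp (4 * δ), by positivity, fun η => ?_⟩
  have h1 : ‖linePt η‖ ^ k ≤ (‖linePt η‖ ^ 2) ^ k :=
    pow_le_pow_left₀ (norm_nonneg _) (le_self_pow₀ (one_le_norm_linePt η) (by norm_num)) k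
  have h2 := Real.pow_div_factorial_le_exp (δ * ‖linePt η‖ ^ 2) (by positivity) k
  rw [div_le_iff₀ (by positivity)] at h2
  have h3 : Real.exp (δ * ‖linePt η‖ ^ 2) = Real.exp (4 * δ) * Real.exp (δ * η ^ 2) := by
    rw [← Real.exp_add, norm_linePt_sq]; ring_nf
  rw [h3, mul_pow] at h2
  refine h1.trans ?_
  rw [show (‖linePt η‖ ^ 2) ^ k = (δ ^ k)⁻¹ * (δ ^ k * (‖linePt η‖ ^ 2) ^ k) by field_simp]
  calc _ ≤ (δ ^ k)⁻¹ * (Real.exp (4 * δ) * Real.exp (δ * η ^ 2) * k.factorial) := by gcongr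
    _ = _ := by ring

/-- A continuous amplitude on the line with Gaussian decay. -/
def GaussBound (G : ℝ → ℂ) (δ : ℝ) : Prop :=
  Continuous G ∧ ∃ C, ∀ η, ‖G η‖ ≤ C * Real.exp (-δ * η ^ 2)

lemma GaussBound.integrable {G : ℝ → ℂ} {δ : ℝ} (h : GaussBound G δ) (hδ : 0 < δ) :
    Integrable G := by
  obtain ⟨C, hC⟩ := h.2
  exact ((integrable_exp_neg_mul_sq hδ).const_mul C).mono' h.1.aestronglyMeasurable
    (Eventually.of_forall hC)

lemma GaussBound.linePt_pow {G : ℝ → ℂ} {δ δ' : ℝ} (h : GaussBound G δ) (hδ : δ' < δ) (k : ℕ) :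
    GaussBound (fun η => (-linePt η) ^ k * G η) δ' := by
  obtain ⟨C, hC⟩ := h.2
  obtain ⟨D, hD0, hD⟩ := norm_linePt_pow_le k (sub_pos.2 hδ)
  have hC0 : 0 ≤ C := nonneg_of_mul_nonneg_left ((norm_nonneg _).trans (hC 0)) (Real.exp_pos _)
  refine ⟨by have := h.1; fun_prop, D * C, fun η => ?_⟩
  rw [norm_mul, norm_pow, norm_neg]
  calc _ ≤ (D * Real.exp ((δ - δ') * η ^ 2)) * (C * Real.exp (-δ * η ^ 2)) := by
        gcongr
        · exact hD η
        · exact hC η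
    _ = D * C * (Real.exp ((δ - δ') * η ^ 2) * Real.exp (-δ * η ^ 2)) := by ring
    _ = _ := by rw [← Real.exp_add]; ring_nf

lemma norm_exp_linePt (η s : ℝ) : ‖Complex.exp (-linePt η * s)‖ = Real.exp (-2 * s) := by
  rw [Complex.norm_exp]
  simp [linePt]

lemma GaussBound.mul_exp {G : ℝ → ℂ} {δ : ℝ} (h : GaussBound G δ) (s : ℝ) :
    GaussBound (fun η => G η * Complex.exp (-linePt η * s)) δ := by
  obtain ⟨C, hC⟩ := h.2
  refine ⟨by have := h.1; fun_prop, C * Real.exp (-2 * s), fun η => ?_⟩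
  rw [norm_mul, norm_exp_linePt]
  calc _ ≤ C * Real.exp (-δ * η ^ 2) * Real.exp (-2 * s) := by gcongr; exact hC η
    _ = _ := by ring

lemma hasDerivAt_line_integral {G : ℝ → ℂ} {δ : ℝ} (h : GaussBound G δ) (hδ : 0 < δ) (s : ℝ) :
    HasDerivAt (fun s : ℝ => ∫ η, G η * Complex.exp (-linePt η * s))
      (∫ η, (-linePt η * G η) * Complex.exp (-linePt η * s)) s := by
  have h1 : GaussBound (fun η => -linePt η * G η) (δ / 2) := by
    simpa using h.linePt_pow (half_lt_self hδ) 1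
  have hd := hasDerivAt_integral_of_dominated_loc_of_deriv_le (μ := volume) (𝕜 := ℝ)
    (s := Metric.ball s 1) (x₀ := s)
    (F := fun s η => G η * Complex.exp (-linePt η * (s : ℝ)))
    (F' := fun s η => (-linePt η * G η) * Complex.exp (-linePt η * (s : ℝ)))
    (bound := fun η => ‖-linePt η * G η‖ * Real.exp (-2 * (s - 1)))
    (Metric.ball_mem_nhds s one_pos)
    (Eventually.of_forall fun s => (h.mul_exp s).1.aestronglyMeasurable)
    ((h.mul_exp s).integrable hδ)
    (h1.mul_exp s).1.aestronglyMeasurable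
    (Eventually.of_forall fun η r hr => ?_)
    (((h1.integrable (by positivity)).norm).mul_const _)
    (Eventually.of_forall fun η r hr => ?_)
  · exact hd.2
  · rw [norm_mul, norm_exp_linePt]
    have := (abs_lt.1 (by simpa [Real.dist_eq] using hr : |r - s| < 1)).1
    exact mul_le_mul_of_nonneg_left (Real.exp_le_exp.2 (by linarith)) (norm_nonneg _)
  · have e : HasDerivAt (fun r : ℝ => -linePt η * (r : ℂ)) (-linePt η) r := by
      simpa using (Complex.ofRealCLM.hasDerivAt (x := r)).const_mul (-linePt η)
    exact (e.cexp.const_mul (G η)).congr_deriv (by ring)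

lemma norm_line_integral_le {G : ℝ → ℂ} {δ : ℝ} (hδ : 0 < δ) {C : ℝ}
    (h : ∀ η, ‖G η‖ ≤ C * Real.exp (-δ * η ^ 2)) (s : ℝ) :
    ‖∫ η, G η * Complex.exp (-linePt η * s)‖ ≤ C * √(Real.pi / δ) * Real.exp (-2 * s) := by
  rw [← integral_gaussian δ, ← integral_const_mul, ← integral_mul_const]
  refine norm_integral_le_of_norm_le (((integrable_exp_neg_mul_sq hδ).const_mul C).mul_const _)
    (Eventually.of_forall fun η => ?_)
  rw [norm_mul, norm_exp_linePt]
  gcongr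
  exact h η

/-- The function `e^{w³/3}` on the line. -/
def cubicExp (η : ℝ) : ℂ := Complex.exp (linePt η ^ 3 / 3)

lemma norm_cubicExp (η : ℝ) : ‖cubicExp η‖ = Real.exp (8 / 3 - 2 * η ^ 2) := by
  rw [cubicExp, Complex.norm_exp]
  congr 1
  simp [linePt, pow_succ]
  ring

lemma gaussBound_cubicExp : GaussBound cubicExp 2 := by
  refine ⟨by unfold cubicExp; fun_prop, Real.exp (8 / 3), fun η => ?_⟩
  rw [norm_cubicExp, ← Real.exp_add]
  exact Real.exp_le_exp.2 (by linarith)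

lemma gaussBound_pow_cubicExp (k : ℕ) : GaussBound (fun η => (-linePt η) ^ k * cubicExp η) 1 :=
  gaussBound_cubicExp.linePt_pow (by norm_num) k

/-- The `k`-th derivative of the Airy function as a contour integral. -/
def airyC (k : ℕ) (s : ℝ) : ℂ :=
  (1 / (2 * Real.pi) : ℝ) *
    ∫ η, ((-linePt η) ^ k * cubicExp η) * Complex.exp (-linePt η * s)

lemma hasDerivAt_airyC (k : ℕ) (s : ℝ) : HasDerivAt (airyC k) (airyC (k + 1) s) s := by
  refine ((hasDerivAt_line_integral (gaussBound_pow_cubicExp k) one_pos s).const_mul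
    ((1 / (2 * Real.pi) : ℝ) : ℂ)).congr_deriv ?_
  rw [airyC]
  congr 2
  funext η
  ring

lemma norm_airyC_le (k : ℕ) : ∃ C, ∀ s, ‖airyC k s‖ ≤ C * Real.exp (-2 * s) := by
  obtain ⟨C, hC⟩ := (gaussBound_pow_cubicExp k).2
  refine ⟨‖((1 / (2 * Real.pi) : ℝ) : ℂ)‖ * (C * √(Real.pi / 1)), fun s => ?_⟩
  rw [airyC, norm_mul, mul_assoc]
  gcongr
  exact norm_line_integral_le one_pos hC s

lemma expDecay_of_exp_two {g : ℝ → ℂ} (hc : Continuous g) {C : ℝ}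
    (h : ∀ s, ‖g s‖ ≤ C * Real.exp (-2 * s)) : ExpDecay g := by
  refine ⟨hc, fun T => ⟨C * Real.exp (-T), fun x hx => (h x).trans ?_⟩⟩
  have hC0 : 0 ≤ C := nonneg_of_mul_nonneg_left ((norm_nonneg _).trans (h 0)) (Real.exp_pos _)
  rw [mul_assoc, ← Real.exp_add]
  gcongr
  linarith

lemma expDecay_airyC (k : ℕ) : ExpDecay (airyC k) := by
  obtain ⟨C, hC⟩ := norm_airyC_le k
  exact expDecay_of_exp_two
    (continuous_iff_continuousAt.2 fun s => (hasDerivAt_airyC k s).continuousAt) hC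

lemma airyC_two (s : ℝ) : airyC 2 s = s * airyC 0 s := by
  have key : ∫ η : ℝ, (linePt η ^ 2 - s) * Complex.I *
      (cubicExp η * Complex.exp (-linePt η * s)) = 0 := by
    have e (η : ℝ) : (linePt η ^ 2 - s) * Complex.I * (cubicExp η * Complex.exp (-linePt η * s))
      = Complex.I * ((((-linePt η) ^ 2 * cubicExp η) * Complex.exp (-linePt η * s))
        - s * (((-linePt η) ^ 0 * cubicExp η) * Complex.exp (-linePt η * s))) := by ring
    refine integral_eq_zero_of_hasDerivAt_of_integrable
      (f := fun η => cubicExp η * Complex.exp (-linePt η * s)) (fun η => ?_) ?_ ?_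
    · have h1 : HasDerivAt linePt Complex.I η := by
        have := ((Complex.ofRealCLM.hasDerivAt (x := η)).mul_const Complex.I).const_add 2
        exact HasDerivAt.congr_deriv this (by simp)
      have h2 := ((h1.pow 3).div_const 3).cexp.mul ((h1.neg.mul_const (s : ℂ)).cexp)
      refine h2.congr_deriv ?_
      simp only [cubicExp, Pi.neg_apply, Pi.pow_apply]
      push_cast
      ring
    · simp_rw [e]
      exact ((((gaussBound_pow_cubicExp 2).mul_exp s).integrable one_pos).sub
        ((((gaussBound_pow_cubicExp 0).mul_exp s).integrable one_pos).const_mul _)).const_mul _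
    · exact (gaussBound_cubicExp.mul_exp s).integrable two_pos
  have e (η : ℝ) : (linePt η ^ 2 - s) * Complex.I * (cubicExp η * Complex.exp (-linePt η * s))
      = Complex.I * ((((-linePt η) ^ 2 * cubicExp η) * Complex.exp (-linePt η * s))
        - s * (((-linePt η) ^ 0 * cubicExp η) * Complex.exp (-linePt η * s))) := by ring
  simp_rw [e] at key
  rw [integral_const_mul, integral_sub (((gaussBound_pow_cubicExp 2).mul_exp s).integrable one_pos)
    ((((gaussBound_pow_cubicExp 0).mul_exp s).integrable one_pos).const_mul _),
    integral_const_mul, mul_eq_zero, or_iff_right Complex.I_ne_zero, sub_eq_zero] at key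
  rw [airyC, airyC, key]
  ring

lemma translate_airyC_two (y : ℝ) :
    translate (airyC 2) y - (y : ℂ) • translate (airyC 0) y
      = translate (fun x => airyC 2 x - y * airyC 0 x) y := by
  rw [translate_sub (expDecay_airyC 2) ((expDecay_airyC 0).const_mul _),
    translate_const_mul (expDecay_airyC 0)]

lemma expDecay_translate {g : ℝ → ℂ} (hg : ExpDecay g) (hc : Continuous (translate g)) :
    ExpDecay (translate g) := by
  refine ⟨hc, fun T => ?_⟩
  obtain ⟨C, hC⟩ := hg.2 T
  exact ⟨C, fun x hx => norm_translate_le hg fun y hy => hC y (hx.trans hy)⟩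

lemma hasDerivAt_translate_airyC (k : ℕ) (z : ℝ) :
    HasDerivAt (translate (airyC k)) (translate (airyC (k + 1)) z) z :=
  hasDerivAt_translate (expDecay_airyC k) (expDecay_airyC (k + 1)) (expDecay_airyC (k + 2))
    (hasDerivAt_airyC k) (hasDerivAt_airyC (k + 1)) z

lemma expDecay_translate_airyC (k : ℕ) : ExpDecay (translate (airyC k)) :=
  expDecay_translate (expDecay_airyC k)
    (continuous_iff_continuousAt.2 fun s => (hasDerivAt_translate_airyC k s).continuousAt)

lemma airySystem : AirySystem pairing (airyC 0) (airyC 1) (translate (airyC 0))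
    (translate (airyC 1)) (translate (airyC 2)) where
  symm := pairing_comm
  deriv_A0 := hasDerivAt_airyC 0
  deriv_A1 z := by rw [← airyC_two]; exact hasDerivAt_airyC 1 z
  deriv_a := hasDerivAt_translate_airyC 0
  deriv_b := hasDerivAt_translate_airyC 1
  decay_A0 := expDecay_airyC 0
  decay_A1 := expDecay_airyC 1
  decay_a := expDecay_translate_airyC 0
  decay_b := expDecay_translate_airyC 1
  decay_d := expDecay_translate_airyC 2
  decay_za := by
    obtain ⟨C, hC⟩ := norm_airyC_le 0
    have hC0 : 0 ≤ C := nonneg_of_mul_nonneg_left ((norm_nonneg _).trans (hC 0)) (Real.exp_pos _)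
    refine ⟨Complex.continuous_ofReal.smul (expDecay_translate_airyC 0).1, fun T =>
      ⟨C * (1 + |T| * Real.exp (-T)), fun z hz => ?_⟩⟩
    have h1 : ‖translate (airyC 0) z‖ ≤ C * Real.exp (-z) * Real.exp (-z) := by
      refine norm_translate_le (expDecay_airyC 0) fun x hx => (hC x).trans ?_
      rw [mul_assoc, ← Real.exp_add]
      gcongr
      linarith
    have h2 : |z| * Real.exp (-z) ≤ 1 + |T| * Real.exp (-T) := by
      rcases le_total 0 z with h0 | h0
      · have h3 : z * Real.exp (-z) ≤ 1 := by
          rw [Real.exp_neg, ← div_eq_mul_inv, div_le_one (Real.exp_pos _)]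
          linarith [Real.add_one_le_exp z]
        rw [abs_of_nonneg h0]
        have : 0 ≤ |T| * Real.exp (-T) := by positivity
        linarith
      · have h3 : |z| ≤ |T| := by
          rw [abs_of_nonpos h0, abs_of_nonpos (hz.trans h0)]; linarith
        have h4 : Real.exp (-z) ≤ Real.exp (-T) := Real.exp_le_exp.2 (by linarith)
        have : |z| * Real.exp (-z) ≤ |T| * Real.exp (-T) := by gcongr
        linarith
    rw [norm_smul, Complex.norm_real, Real.norm_eq_abs]
    calc _ ≤ |z| * (C * Real.exp (-z) * Real.exp (-z)) := by gcongr
      _ = C * (|z| * Real.exp (-z)) * Real.exp (-z) := by ring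
      _ ≤ _ := by gcongr
  parts z y := by
    rw [pairing_translate (expDecay_airyC 1) (expDecay_airyC 0),
      pairing_translate (expDecay_airyC 0) (expDecay_airyC 1)]
    have m (i j : ℕ) : ExpDecay fun x => airyC i (x + z) * airyC j (x + y) :=
      ((expDecay_airyC i).shift z).bilin ((expDecay_airyC j).shift y)
        (ContinuousLinearMap.mul ℂ ℂ)
    rw [← integral_add ((m 1 0).integrableOn 0) ((m 0 1).integrableOn 0),
      (m 0 0).integral_Ioi_deriv ((m 1 0).add (m 0 1)) (fun x => ?_)]
    · simp
    · have h1 := (hasDerivAt_airyC 0 (x + z)).comp_add_const x z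
      have h2 := (hasDerivAt_airyC 0 (x + y)).comp_add_const x y
      exact h1.mul h2
  mul_symm z y := by
    have m (c : ℝ) : ExpDecay (fun x => airyC 2 x - c * airyC 0 x) :=
      (expDecay_airyC 2).sub ((expDecay_airyC 0).const_mul _)
    rw [translate_airyC_two, translate_airyC_two, pairing_translate (expDecay_airyC 0) (m y),
      pairing_translate (m z) (expDecay_airyC 0)]
    refine integral_congr_ae (Eventually.of_forall fun x => ?_)
    simp only [airyC_two]
    push_cast
    ring

end Airy

section AiryValues

/-- The sixth root of unity `e^{iπ/3}`. -/
def sixthRoot : ℂ := ⟨1 / 2, √3 / 2⟩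

lemma sqrt_three_sq : √3 * √3 = (3 : ℝ) := Real.mul_self_sqrt (by norm_num)

lemma sixthRoot_pow_three : sixthRoot ^ 3 = -1 := by
  apply Complex.ext
  · simp [sixthRoot, pow_succ]; linear_combination (-3 / 8) * sqrt_three_sq
  · simp [sixthRoot, pow_succ]; linear_combination (-√3 / 8) * sqrt_three_sq

/-- The direction of the rays in the contour rotation. -/
def rayDir (τ : ℝ) : ℂ := (1 - τ) * sixthRoot + τ * Complex.I

/-- The rays of the contour rotation, from the ray at angle `π/3` to the vertical line `Re = 2`. -/
def rayPt (τ r : ℝ) : ℂ := 2 * τ + r * rayDir τ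

lemma rayPt_re (τ r : ℝ) : (rayPt τ r).re = 2 * τ + r * ((1 - τ) / 2) := by
  simp [rayPt, rayDir, sixthRoot, -mul_eq_mul_left_iff]; ring

lemma rayPt_im (τ r : ℝ) : (rayPt τ r).im = r * ((1 - τ) * (√3 / 2) + τ) := by
  simp [rayPt, rayDir, sixthRoot]

lemma sqrt_three_bounds : (17 : ℝ) / 10 < √3 ∧ √3 < 18 / 10 := by
  constructor
  · rw [Real.lt_sqrt (by norm_num)]; norm_num
  · rw [Real.sqrt_lt' (by norm_num)]; norm_num

lemma re_rayPt_cube_le {τ r : ℝ} (h0 : 0 ≤ τ) (h1 : τ ≤ 1) (hr : 0 ≤ r) :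
    (rayPt τ r ^ 3 / 3).re ≤ 136 - r ^ 2 := by
  set X := (rayPt τ r).re with hX
  set Y := (rayPt τ r).im with hY
  have e : (rayPt τ r ^ 3 / 3).re = X * (X ^ 2 / 3 - Y ^ 2) := by
    simp [pow_succ, ← hX, ← hY]; ring
  rw [rayPt_re] at hX
  rw [rayPt_im] at hY
  have hX0 : 0 ≤ X := by rw [hX]; have : 0 ≤ 1 - τ := by linarith
                         positivity
  have hX2 : X ≤ 2 + r / 2 := by rw [hX]; nlinarith
  have hs := sqrt_three_bounds
  have hYr : r * (√3 / 2) ≤ Y := by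
    rw [hY]
    refine mul_le_mul_of_nonneg_left ?_ hr
    nlinarith
  have hY2 : 3 / 4 * r ^ 2 ≤ Y ^ 2 := by
    have : (r * (√3 / 2)) ^ 2 ≤ Y ^ 2 := pow_le_pow_left₀ (by positivity) hYr 2
    have e2 : (r * (√3 / 2)) ^ 2 = 3 / 4 * r ^ 2 := by
      linear_combination (r ^ 2 / 4) * sqrt_three_sq
    linarith
  rw [e]
  rcases le_total r 8 with h8 | h8
  · have hX6 : X ≤ 6 := by linarith
    have h3 : X * (X ^ 2 / 3 - Y ^ 2) ≤ X * 12 := by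
      refine mul_le_mul_of_nonneg_left ?_ hX0
      nlinarith [sq_nonneg Y]
    nlinarith
  · have hX3 : 2 ≤ X := by rw [hX]; nlinarith
    have h4 : X ^ 2 / 3 - Y ^ 2 ≤ -(9 / 16) * r ^ 2 := by nlinarith
    nlinarith [sq_nonneg r]

lemma norm_rayDir_le {τ : ℝ} (h0 : 0 ≤ τ) (h1 : τ ≤ 1) : ‖rayDir τ‖ ≤ 1 := by
  have hs : ‖sixthRoot‖ = 1 := by
    rw [Complex.norm_def, Real.sqrt_eq_one, Complex.normSq_apply]
    simp only [sixthRoot]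
    linear_combination (1 / 4) * sqrt_three_sq
  refine (norm_add_le _ _).trans (le_of_eq ?_)
  rw [norm_mul, norm_mul, hs, Complex.norm_I, Complex.norm_real, ← Complex.ofReal_one,
    ← Complex.ofReal_sub, Complex.norm_real, Real.norm_of_nonneg h0,
    Real.norm_of_nonneg (by linarith)]
  ring

lemma norm_rayPt_le {τ r : ℝ} (h0 : 0 ≤ τ) (h1 : τ ≤ 1) (hr : 0 ≤ r) :
    ‖rayPt τ r‖ ≤ 2 + r := by
  refine (norm_add_le _ _).trans ?_
  rw [norm_mul, norm_mul, Complex.norm_real, Complex.norm_real, Real.norm_of_nonneg h0,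
    Real.norm_of_nonneg hr]
  have := norm_rayDir_le h0 h1
  simp only [Complex.norm_ofNat]
  nlinarith

lemma norm_rayPt_pow_mul_le (j : ℕ) : ∃ C, 0 ≤ C ∧ ∀ τ r : ℝ, 0 ≤ τ → τ ≤ 1 → 0 ≤ r →
    ‖rayPt τ r‖ ^ j * ‖Complex.exp (rayPt τ r ^ 3 / 3)‖ ≤ C * Real.exp (-(2 * r)) := by
  refine ⟨j.factorial * Real.exp 141, by positivity, fun τ r h0 h1 hr => ?_⟩
  have h2 := Real.pow_div_factorial_le_exp (2 + r) (by linarith) j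
  rw [div_le_iff₀ (by positivity)] at h2
  have h3 : ‖rayPt τ r‖ ^ j ≤ Real.exp (2 + r) * j.factorial :=
    (pow_le_pow_left₀ (norm_nonneg _) (norm_rayPt_le h0 h1 hr) j).trans h2
  rw [Complex.norm_exp]
  have h4 := re_rayPt_cube_le h0 h1 hr
  calc _ ≤ (Real.exp (2 + r) * j.factorial) * Real.exp (136 - r ^ 2) := by gcongr
    _ = j.factorial * Real.exp (2 + r + (136 - r ^ 2)) := by
        rw [Real.exp_add (2 + r) (136 - r ^ 2)]; ring
    _ ≤ j.factorial * Real.exp (141 + -(2 * r)) := by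
        refine mul_le_mul_of_nonneg_left (Real.exp_le_exp.2 ?_) (by positivity)
        nlinarith [sq_nonneg (r - 3 / 2)]
    _ = _ := by rw [Real.exp_add]; ring

set_option maxHeartbeats 400000 in
/-- Rotating the contour changes the integral of a function which is real on `ℝ` only by a real
number. -/
lemma im_ray_integral {g g' : ℂ → ℂ} (hg : ∀ z, HasDerivAt g (g' z) z) (hgc' : Continuous g')
    (hreal : ∀ x : ℝ, (g x).im = 0) {C : ℝ} (hC0 : 0 ≤ C)
    (hb : ∀ τ r : ℝ, 0 ≤ τ → τ ≤ 1 → 0 ≤ r → ‖g (rayPt τ r)‖ ≤ C * Real.exp (-(2 * r)))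
    (hb' : ∀ τ r : ℝ, 0 ≤ τ → τ ≤ 1 → 0 ≤ r → ‖g' (rayPt τ r)‖ ≤ C * Real.exp (-(2 * r))) :
    (∫ r in Ioi (0 : ℝ), g (rayPt 1 r) * rayDir 1).im
      = (∫ r in Ioi (0 : ℝ), g (rayPt 0 r) * rayDir 0).im := by
  have hgc : Continuous g := continuous_iff_continuousAt.2 fun z => (hg z).continuousAt
  have t0 (σ : ℝ) : 0 ≤ Real.sin σ ^ 2 := sq_nonneg _
  have t1 (σ : ℝ) : Real.sin σ ^ 2 ≤ 1 := Real.sin_sq_le_one σ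
  let δ : ℂ := Complex.I - sixthRoot
  have hδ : ‖δ‖ ≤ 2 := by
    refine (norm_sub_le _ _).trans ?_
    have := norm_rayDir_le (τ := 0) le_rfl zero_le_one
    simp only [rayDir, Complex.ofReal_zero, sub_zero, one_mul, zero_mul, add_zero] at this
    rw [Complex.norm_I]
    linarith
  have hlin (r : ℝ) (hr : 0 ≤ r) : ‖2 + r * δ‖ ≤ 2 * Real.exp r := by
    refine (norm_add_le _ _).trans ?_
    rw [norm_mul, Complex.norm_real, Real.norm_of_nonneg hr, Complex.norm_ofNat]
    nlinarith [Real.add_one_le_exp r]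
  have hexp (r : ℝ) : Real.exp (-(2 * r)) * Real.exp r = Real.exp (-r) := by
    rw [← Real.exp_add]; ring_nf
  let D : ℝ → ℝ → ℂ := fun τ r => g' (rayPt τ r) * rayDir τ * (2 + r * δ) + g (rayPt τ r) * δ
  have hDb (τ r : ℝ) (h0 : 0 ≤ τ) (h1 : τ ≤ 1) (hr : 0 ≤ r) :
      ‖D τ r‖ ≤ 4 * C * Real.exp (-r) := by
    refine (norm_add_le _ _).trans ?_
    rw [norm_mul, norm_mul, norm_mul]
    have h2 : ‖g' (rayPt τ r)‖ * ‖rayDir τ‖ * ‖2 + r * δ‖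
        ≤ C * Real.exp (-(2 * r)) * 1 * (2 * Real.exp r) :=
      mul_le_mul (mul_le_mul (hb' τ r h0 h1 hr) (norm_rayDir_le h0 h1) (norm_nonneg _)
        (by positivity)) (hlin r hr) (norm_nonneg _) (by positivity)
    have h3 : ‖g (rayPt τ r)‖ * ‖δ‖ ≤ C * Real.exp (-r) * 2 := by
      refine mul_le_mul ((hb τ r h0 h1 hr).trans ?_) hδ (norm_nonneg _) (by positivity)
      gcongr
      linarith
    have h4 := hexp r
    linear_combination h2 + h3 + (2 * C) * h4
  have hwr (τ r : ℝ) : HasDerivAt (fun r : ℝ => rayPt τ r) (rayDir τ) r := by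
    have := ((Complex.ofRealCLM.hasDerivAt (x := r)).mul_const (rayDir τ)).const_add (2 * (τ : ℂ))
    exact HasDerivAt.congr_deriv this (by simp)
  have hvt (τ : ℝ) : HasDerivAt rayDir δ τ := by
    have h1 := Complex.ofRealCLM.hasDerivAt (x := τ)
    have := ((h1.const_sub 1).mul_const sixthRoot).add (h1.mul_const Complex.I)
    exact HasDerivAt.congr_deriv this (by simp [δ]; ring)
  have hwt (τ r : ℝ) : HasDerivAt (fun τ : ℝ => rayPt τ r) (2 + r * δ) τ := by
    have h1 := Complex.ofRealCLM.hasDerivAt (x := τ)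
    have := (h1.const_mul 2).add ((hvt τ).const_mul (r : ℂ))
    exact HasDerivAt.congr_deriv this (by simp)
  have hcw (τ : ℝ) : Continuous fun r : ℝ => rayPt τ r := by unfold rayPt; fun_prop
  have hFc (τ : ℝ) : Continuous fun r : ℝ => g (rayPt τ r) * rayDir τ := by
    have := hcw τ; fun_prop
  have hDc (τ : ℝ) : Continuous fun r : ℝ => D τ r := by
    have := hcw τ; simp only [D]; fun_prop
  have hintexp (c : ℝ) : IntegrableOn (fun r : ℝ => c * Real.exp (-r)) (Ioi 0) := by
    have := (integrableOn_exp_mul_Ioi (a := -1) (by norm_num) 0).const_mul c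
    simp only [neg_mul, one_mul] at this
    exact this
  have hDint (τ : ℝ) (h0 : 0 ≤ τ) (h1 : τ ≤ 1) : IntegrableOn (fun r => D τ r) (Ioi 0) := by
    refine Integrable.mono' (hintexp (4 * C)) (hDc τ).aestronglyMeasurable ?_
    filter_upwards [ae_restrict_mem measurableSet_Ioi] with r hr
    exact hDb τ r h0 h1 (le_of_lt hr)
  have hDval (τ : ℝ) (h0 : 0 ≤ τ) (h1 : τ ≤ 1) :
      ∫ r in Ioi (0 : ℝ), D τ r = -(2 * g ((2 * τ : ℝ) : ℂ)) := by
    have ht : Tendsto (fun r : ℝ => g (rayPt τ r) * (2 + r * δ)) atTop (𝓝 0) := by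
      have h2 : Tendsto (fun x : ℝ => 2 * C * Real.exp (-x)) atTop (𝓝 0) := by
        simpa using (Real.tendsto_exp_neg_atTop_nhds_zero).const_mul (2 * C)
      refine squeeze_zero_norm' ((eventually_ge_atTop 0).mono fun r hr => ?_) h2
      rw [norm_mul]
      refine (mul_le_mul (hb τ r h0 h1 hr) (hlin r hr) (norm_nonneg _) (by positivity)).trans
        (le_of_eq ?_)
      rw [← hexp r]; ring
    rw [integral_Ioi_of_hasDerivAt_of_tendsto' (fun r _ => ?_) (hDint τ h0 h1) ht]
    · simp [rayPt, mul_comm]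
    · have h2 := ((hg (rayPt τ r)).comp r (hwr τ r)).mul
        (((Complex.ofRealCLM.hasDerivAt (x := r)).mul_const δ).const_add 2)
      exact HasDerivAt.congr_deriv h2 (by simp [D])
  let I : ℝ → ℂ := fun σ => ∫ r in Ioi (0 : ℝ), g (rayPt (Real.sin σ ^ 2) r) *
    rayDir (Real.sin σ ^ 2)
  have hI (σ : ℝ) : HasDerivAt I ((2 * Real.sin σ * Real.cos σ : ℝ) *
      -(2 * g ((2 * Real.sin σ ^ 2 : ℝ) : ℂ))) σ := by
    rw [← hDval _ (t0 σ) (t1 σ), ← integral_const_mul]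
    refine (hasDerivAt_integral_of_dominated_loc_of_deriv_le (𝕜 := ℝ) (s := univ)
      (μ := volume.restrict (Ioi (0 : ℝ))) (x₀ := σ)
      (F := fun σ r => g (rayPt (Real.sin σ ^ 2) r) * rayDir (Real.sin σ ^ 2))
      (F' := fun σ r => ((2 * Real.sin σ * Real.cos σ : ℝ) : ℂ) * D (Real.sin σ ^ 2) r)
      (bound := fun r => 2 * (4 * C) * Real.exp (-r)) univ_mem
      (Eventually.of_forall fun σ => (hFc _).aestronglyMeasurable) ?_
      (continuous_const.mul (hDc _)).aestronglyMeasurable ?_ (hintexp (2 * (4 * C))) ?_).2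
    · refine Integrable.mono' (hintexp C) (hFc _).aestronglyMeasurable ?_
      filter_upwards [ae_restrict_mem measurableSet_Ioi] with r hr
      have hr : 0 ≤ r := le_of_lt hr
      rw [norm_mul]
      refine (mul_le_mul (hb _ r (t0 σ) (t1 σ) hr) (norm_rayDir_le (t0 σ) (t1 σ))
        (norm_nonneg _) (by positivity)).trans ?_
      rw [mul_one]
      gcongr
      linarith
    · filter_upwards [ae_restrict_mem measurableSet_Ioi] with r hr σ' _
      rw [norm_mul, Complex.norm_real, mul_assoc 2 (4 * C)]
      refine mul_le_mul ?_ (hDb _ r (t0 σ') (t1 σ') (le_of_lt hr)) (norm_nonneg _) (by norm_num)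
      rw [norm_mul, norm_mul, Real.norm_ofNat, mul_assoc]
      have h2 := mul_le_mul (Real.abs_sin_le_one σ') (Real.abs_cos_le_one σ') (abs_nonneg _)
        zero_le_one
      simp only [Real.norm_eq_abs]
      linarith
    · refine Eventually.of_forall fun r σ' _ => ?_
      have hs : HasDerivAt (fun σ => Real.sin σ ^ 2) (2 * Real.sin σ' * Real.cos σ') σ' := by
        exact ((Real.hasDerivAt_sin σ').pow 2).congr_deriv (by simp)
      have h2 := ((hg _).comp (Real.sin σ' ^ 2) (hwt _ r)).mul (hvt (Real.sin σ' ^ 2))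
      refine (h2.scomp σ' hs).congr_deriv ?_
      simp only [D, Complex.real_smul, Function.comp_apply]
      ring
  have hconst : ∀ σ σ', (I σ).im = (I σ').im := by
    have hd (σ : ℝ) : HasDerivAt (fun σ => (I σ).im) 0 σ := by
      have := Complex.imCLM.hasFDerivAt.comp_hasDerivAt σ (hI σ)
      refine this.congr_deriv ?_
      rw [Complex.imCLM_apply, Complex.im_ofReal_mul, Complex.neg_im,
        show (2 : ℂ) = ((2 : ℝ) : ℂ) by norm_num, Complex.im_ofReal_mul, hreal]
      simp
    exact is_const_of_deriv_eq_zero (fun σ => (hd σ).differentiableAt) fun σ => (hd σ).deriv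
  have := hconst (Real.pi / 2) 0
  simpa [I] using this

lemma im_airy_ray (k : ℕ) (hk : k ≤ 1) :
    (∫ r in Ioi (0 : ℝ), (-rayPt 1 r) ^ k * Complex.exp (rayPt 1 r ^ 3 / 3) * rayDir 1).im
      = (∫ r in Ioi (0 : ℝ), (-rayPt 0 r) ^ k * Complex.exp (rayPt 0 r ^ 3 / 3) * rayDir 0).im := by
  obtain ⟨C0, hC0, h0⟩ := norm_rayPt_pow_mul_le k
  obtain ⟨C1, hC1, h1⟩ := norm_rayPt_pow_mul_le (k + 2)
  obtain ⟨C2, hC2, h2⟩ := norm_rayPt_pow_mul_le (k - 1)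
  refine im_ray_integral (g := fun z => (-z) ^ k * Complex.exp (z ^ 3 / 3))
    (g' := fun z => -(k * (-z) ^ (k - 1)) * Complex.exp (z ^ 3 / 3)
      + (-z) ^ (k + 2) * Complex.exp (z ^ 3 / 3)) (fun z => ?_) (by fun_prop) (fun x => ?_)
    (C := C0 + C1 + C2) (by positivity) (fun τ r ht ht' hr => ?_) (fun τ r ht ht' hr => ?_)
  · have e1 := ((hasDerivAt_id z).neg.pow k)
    have e2 := (((hasDerivAt_id z).pow 3).div_const 3).cexp
    refine (e1.mul e2).congr_deriv ?_
    simp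
    ring
  · have : (-(x : ℂ)) ^ k * Complex.exp ((x : ℂ) ^ 3 / 3)
        = (((-x) ^ k * Real.exp (x ^ 3 / 3) : ℝ) : ℂ) := by push_cast; rfl
    rw [this, Complex.ofReal_im]
  · rw [norm_mul, norm_pow, norm_neg]
    refine (h0 τ r ht ht' hr).trans ?_
    gcongr
    linarith
  · refine (norm_add_le _ _).trans ?_
    rw [norm_mul, norm_mul, norm_pow, norm_neg, norm_neg, norm_mul, norm_pow, norm_neg]
    have hk' : ‖(k : ℂ)‖ ≤ 1 := by
      rw [Complex.norm_natCast]; exact_mod_cast hk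
    have e1 := h1 τ r ht ht' hr
    have e2 := h2 τ r ht ht' hr
    have e3 : ‖(k : ℂ)‖ * ‖rayPt τ r‖ ^ (k - 1) * ‖Complex.exp (rayPt τ r ^ 3 / 3)‖
        ≤ C2 * Real.exp (-(2 * r)) := by
      rw [mul_assoc]
      refine (mul_le_mul hk' e2 (by positivity) (by positivity)).trans (by rw [one_mul])
    have : 0 ≤ C0 * Real.exp (-(2 * r)) := by positivity
    linarith

lemma airyC_zero_eq (k : ℕ) (hk : k ≤ 1) : airyC k 0
    = ((1 / Real.pi * ((-1) ^ k * (sixthRoot ^ (k + 1)).im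
      * ∫ r in Ioi (0 : ℝ), r ^ (k : ℝ) * Real.exp (-(1 / 3) * r ^ (3 : ℝ))) : ℝ) : ℂ) := by
  set f : ℝ → ℂ := fun η => (-linePt η) ^ k * cubicExp η with hf
  have hfi : Integrable f := (gaussBound_pow_cubicExp k).integrable one_pos
  have hconj (η : ℝ) : f (-η) = (starRingEnd ℂ) (f η) := by
    have e : linePt (-η) = (starRingEnd ℂ) (linePt η) := by
      simp [linePt, Complex.conj_ofNat]
    simp only [hf, cubicExp, e, map_mul, map_pow, map_neg, ← Complex.exp_conj, map_div₀, map_ofNat]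
  have e1 : ∫ η, f η = ((2 * (∫ η in Ioi (0 : ℝ), f η).re : ℝ) : ℂ) := by
    have h2 : ∫ η in Iic (0 : ℝ), f η = (starRingEnd ℂ) (∫ η in Ioi (0 : ℝ), f η) := by
      have := integral_comp_neg_Ioi (0 : ℝ) f
      rw [neg_zero] at this
      rw [← this, ← integral_conj]
      simp only [hconj]
    rw [← intervalIntegral.integral_Iic_add_Ioi hfi.integrableOn hfi.integrableOn (b := 0), h2,
      add_comm, Complex.add_conj]
  have e2 : (∫ η in Ioi (0 : ℝ), f η).re = (∫ r in Ioi (0 : ℝ),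
      (-rayPt 1 r) ^ k * Complex.exp (rayPt 1 r ^ 3 / 3) * rayDir 1).im := by
    have h1 (r : ℝ) : (-rayPt 1 r) ^ k * Complex.exp (rayPt 1 r ^ 3 / 3) * rayDir 1
        = f r * Complex.I := by
      simp [hf, rayPt, rayDir, cubicExp, linePt]
    simp_rw [h1]
    rw [integral_mul_const, Complex.mul_I_im]
  have e3 : (∫ r in Ioi (0 : ℝ),
      (-rayPt 0 r) ^ k * Complex.exp (rayPt 0 r ^ 3 / 3) * rayDir 0)
      = ((∫ r in Ioi (0 : ℝ), r ^ (k : ℝ) * Real.exp (-(1 / 3) * r ^ (3 : ℝ)) : ℝ) : ℂ) *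
        ((-1) ^ k * sixthRoot ^ (k + 1)) := by
    rw [← integral_complex_ofReal, ← integral_mul_const]
    refine integral_congr_ae (Eventually.of_forall fun r => ?_)
    have h3 : ((r : ℂ) * sixthRoot) ^ 3 / 3 = ((-(1 / 3) * r ^ (3 : ℝ) : ℝ) : ℂ) := by
      rw [mul_pow, sixthRoot_pow_three]
      norm_cast
      push_cast
      ring
    simp only [rayPt, rayDir, Complex.ofReal_zero, mul_zero, zero_add, sub_zero, one_mul, zero_mul,
      add_zero, h3]
    rw [Real.rpow_natCast, neg_pow, mul_pow]
    push_cast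
    ring
  rw [airyC]
  simp only [Complex.ofReal_zero, mul_zero, Complex.exp_zero, mul_one]
  rw [e1, e2, im_airy_ray k hk, e3, Complex.im_ofReal_mul]
  have e4 : ((-1) ^ k * sixthRoot ^ (k + 1)).im = (-1) ^ k * (sixthRoot ^ (k + 1)).im := by
    rw [show ((-1 : ℂ)) ^ k = (((-1) ^ k : ℝ) : ℂ) by push_cast; rfl, Complex.im_ofReal_mul]
  rw [e4, ← Complex.ofReal_mul]
  congr 1
  field_simp

lemma gamma_third : Real.Gamma (1 / 3) * Real.Gamma (2 / 3) = Real.pi / (√3 / 2) := by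
  have := Real.Gamma_mul_Gamma_one_sub (1 / 3)
  rw [show (1 : ℝ) - 1 / 3 = 2 / 3 by norm_num, mul_one_div, Real.sin_pi_div_three] at this
  exact this

lemma airyC_zero_zero :
    airyC 0 0 = (((3 : ℝ) ^ (-(2 : ℝ) / 3) / Real.Gamma (2 / 3) : ℝ) : ℂ) := by
  rw [airyC_zero_eq 0 (by norm_num)]
  congr 1
  have h := integral_rpow_mul_exp_neg_mul_rpow (p := 3) (q := 0) (b := 1 / 3) (by norm_num)
    (by norm_num) (by norm_num)
  rw [Nat.cast_zero, h]
  have hg := gamma_third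
  have hg2 : 0 < Real.Gamma (2 / 3) := Real.Gamma_pos_of_pos (by norm_num)
  have e : (1 / 3 : ℝ) ^ (-(0 + 1) / 3 : ℝ) = 3 * 3 ^ (-(2 : ℝ) / 3) := by
    rw [one_div, Real.inv_rpow (by norm_num), ← Real.rpow_neg (by norm_num),
      show (3 : ℝ) * 3 ^ (-(2 : ℝ) / 3) = 3 ^ (1 : ℝ) * 3 ^ (-(2 : ℝ) / 3) by rw [Real.rpow_one],
      ← Real.rpow_add (by norm_num)]
    norm_num
  rw [e]
  simp only [pow_zero, zero_add, pow_one, sixthRoot, one_mul]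
  rw [eq_div_iff hg2.ne', mul_assoc, show (1 : ℝ) / Real.pi * (√3 / 2 * (3 * 3 ^ (-(2 : ℝ) / 3)
    * (1 / 3) * Real.Gamma (1 / 3)) * Real.Gamma (2 / 3)) = 3 ^ (-(2 : ℝ) / 3) * (1 / Real.pi
    * (√3 / 2 * (Real.Gamma (1 / 3) * Real.Gamma (2 / 3)))) by ring, hg]
  have : (√3 : ℝ) ≠ 0 := by positivity
  field_simp

lemma airyC_one_zero :
    airyC 1 0 = ((-((3 : ℝ) ^ (-(1 : ℝ) / 3)) / Real.Gamma (1 / 3) : ℝ) : ℂ) := by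
  rw [airyC_zero_eq 1 le_rfl]
  congr 1
  have h := integral_rpow_mul_exp_neg_mul_rpow (p := 3) (q := 1) (b := 1 / 3) (by norm_num)
    (by norm_num) (by norm_num)
  rw [Nat.cast_one, h]
  have hg := gamma_third
  have hg2 : 0 < Real.Gamma (1 / 3) := Real.Gamma_pos_of_pos (by norm_num)
  have e : (1 / 3 : ℝ) ^ (-(1 + 1) / 3 : ℝ) = 3 * 3 ^ (-(1 : ℝ) / 3) := by
    rw [one_div, Real.inv_rpow (by norm_num), ← Real.rpow_neg (by norm_num),
      show (3 : ℝ) * 3 ^ (-(1 : ℝ) / 3) = 3 ^ (1 : ℝ) * 3 ^ (-(1 : ℝ) / 3) by rw [Real.rpow_one],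
      ← Real.rpow_add (by norm_num)]
    norm_num
  have e2 : (sixthRoot ^ (1 + 1)).im = √3 / 2 := by
    simp [sixthRoot, pow_succ]; ring
  rw [e, e2, pow_one, show ((1 : ℝ) + 1) / 3 = 2 / 3 by norm_num, eq_div_iff hg2.ne',
    show (1 : ℝ) / Real.pi * (-1 * (√3 / 2) * (3 * 3 ^ (-(1 : ℝ) / 3)
    * (1 / 3) * Real.Gamma (2 / 3))) * Real.Gamma (1 / 3) = -3 ^ (-(1 : ℝ) / 3) * (1 / Real.pi
    * (√3 / 2 * (Real.Gamma (1 / 3) * Real.Gamma (2 / 3)))) by ring, hg]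
  have : (√3 : ℝ) ≠ 0 := by positivity
  field_simp

end AiryValues

section AiryIdentification

/-- Uniqueness for the Airy equation. -/
lemma airy_ode_unique {f f' g g' : ℝ → ℂ} (hf : ∀ x, HasDerivAt f (f' x) x)
    (hf' : ∀ x : ℝ, HasDerivAt f' (x * f x) x) (hg : ∀ x, HasDerivAt g (g' x) x)
    (hg' : ∀ x : ℝ, HasDerivAt g' (x * g x) x) {x₀ : ℝ} (h0 : f x₀ = g x₀) (h1 : f' x₀ = g' x₀)
    (x : ℝ) : f x = g x ∧ f' x = g' x := by
  set T : ℝ := max |x| |x₀| + 1 with hT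
  have hx : |x| < T := by have := le_max_left |x| |x₀|; linarith
  have hx₀ : |x₀| < T := by have := le_max_right |x| |x₀|; linarith
  have hT0 : 1 ≤ T := by have := abs_nonneg x; linarith [le_max_left |x| |x₀|]
  let v : ℝ → ℂ × ℂ → ℂ × ℂ := fun t y => (y.2, t * y.1)
  have hv : ∀ t ∈ Ioo (-T) T, LipschitzOnWith T.toNNReal (v t) univ := fun t ht => by
    refine LipschitzOnWith.of_dist_le_mul fun y _ z _ => ?_
    rw [Real.coe_toNNReal _ (by linarith), dist_eq_norm, dist_eq_norm]
    have e : v t y - v t z = ((y - z).2, t * (y - z).1) := by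
      simp [v, mul_sub]
    rw [e, Prod.norm_mk, norm_mul, Complex.norm_real]
    have h2 := norm_fst_le (y - z)
    have h3 := norm_snd_le (y - z)
    have ht' : ‖t‖ ≤ T := (abs_lt.2 ht).le
    refine max_le ?_ ?_
    · nlinarith [norm_nonneg (y - z)]
    · exact mul_le_mul ht' h2 (norm_nonneg _) (by linarith)
  have := ODE_solution_unique_of_mem_Ioo (v := v) (s := fun _ => univ)
    (f := fun t => (f t, f' t)) (g := fun t => (g t, g' t)) hv (abs_lt.1 hx₀)
    (fun t _ => ⟨(hf t).prodMk (hf' t), mem_univ _⟩)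
    (fun t _ => ⟨(hg t).prodMk (hg' t), mem_univ _⟩) (by simp [h0, h1]) (abs_lt.1 hx)
  simpa using this

variable {A A' : ℝ → ℝ}

lemma airy_eq_airyC (hA : IsAiry A A') (x : ℝ) :
    (A x : ℂ) = airyC 0 x ∧ (A' x : ℂ) = airyC 1 x := by
  refine airy_ode_unique (f := fun x => (A x : ℂ)) (f' := fun x => (A' x : ℂ))
    (g := airyC 0) (g' := airyC 1) (x₀ := 0) (fun x => (hA.1 x).ofReal_comp) (fun x => ?_)
    (hasDerivAt_airyC 0) (fun x => ?_) ?_ ?_ x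
  · have := (hA.2.1 x).ofReal_comp
    rwa [Complex.ofReal_mul] at this
  · rw [← airyC_two]; exact hasDerivAt_airyC 1 x
  · rw [hA.2.2.1, airyC_zero_zero]
  · rw [hA.2.2.2, airyC_one_zero]

lemma tendsto_airy (hA : IsAiry A A') :
    Tendsto A atTop (𝓝 0) ∧ Tendsto A' atTop (𝓝 0) := by
  have h (k : ℕ) {g : ℝ → ℝ} (hg : ∀ x, (g x : ℂ) = airyC k x) : Tendsto g atTop (𝓝 0) := by
    have := (expDecay_airyC k).tendsto
    rw [← funext hg] at this
    simpa [Function.comp_def] using (Complex.continuous_re.tendsto 0).comp this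
  exact ⟨h 0 fun x => (airy_eq_airyC hA x).1, h 1 fun x => (airy_eq_airyC hA x).2⟩

lemma hasDerivAt_airy_mul (hA : IsAiry A A') (x : ℝ) :
    HasDerivAt (fun x => A x * A' x) (A' x ^ 2 + x * A x ^ 2) x :=
  ((hA.1 x).mul (hA.2.1 x)).congr_deriv (by ring)

lemma monotoneOn_airy_mul (hA : IsAiry A A') : MonotoneOn (fun x => A x * A' x) (Ici 0) := by
  refine monotoneOn_of_deriv_nonneg (convex_Ici 0)
    (fun x _ => (hasDerivAt_airy_mul hA x).continuousAt.continuousWithinAt)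
    (fun x _ => (hasDerivAt_airy_mul hA x).differentiableAt.differentiableWithinAt) fun x hx => ?_
  rw [interior_Ici] at hx
  rw [(hasDerivAt_airy_mul hA x).deriv]
  have : 0 < x := hx
  positivity

lemma airy_mul_nonpos (hA : IsAiry A A') {x : ℝ} (hx : 0 ≤ x) : A x * A' x ≤ 0 := by
  have h := (tendsto_airy hA).1.mul (tendsto_airy hA).2
  rw [mul_zero] at h
  refine ge_of_tendsto h ((eventually_ge_atTop x).mono fun y hy => ?_)
  exact monotoneOn_airy_mul hA hx (hx.trans hy) hy

lemma abs_airy_antitone (hA : IsAiry A A') {x y : ℝ} (hx : 0 ≤ x) (hxy : x ≤ y) :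
    |A y| ≤ |A x| := by
  rw [← sq_le_sq]
  have hd (x : ℝ) : HasDerivAt (fun x => A x ^ 2) (2 * (A x * A' x)) x :=
    ((hA.1 x).pow 2).congr_deriv (by simp; ring)
  have : AntitoneOn (fun x => A x ^ 2) (Ici 0) := by
    refine antitoneOn_of_deriv_nonpos (convex_Ici 0)
      (fun x _ => (hd x).continuousAt.continuousWithinAt)
      (fun x _ => (hd x).differentiableAt.differentiableWithinAt) fun x hx => ?_
    rw [interior_Ici] at hx
    rw [(hd x).deriv]
    have := airy_mul_nonpos hA (le_of_lt (mem_Ioi.1 hx))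
    linarith
  exact this hx (hx.trans hxy) hxy

lemma airy_ne_zero (hA : IsAiry A A') {x : ℝ} (hx : 0 < x) : A x ≠ 0 := by
  intro h0
  have hz : ∀ y, x ≤ y → A y = 0 := fun y hy => by
    have := abs_airy_antitone hA hx.le hy
    rw [h0, abs_zero] at this
    exact abs_eq_zero.1 (le_antisymm this (abs_nonneg _))
  have hd : A' (x + 1) = 0 := by
    refine (hA.1 (x + 1)).unique ((hasDerivAt_const (x + 1) (0 : ℝ)).congr_of_eventuallyEq ?_)
    filter_upwards [Ioi_mem_nhds (show x < x + 1 by linarith)] with y hy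
    exact hz y (le_of_lt hy)
  have key := airy_ode_unique (f := fun x => (A x : ℂ)) (f' := fun x => (A' x : ℂ))
    (g := fun _ => 0) (g' := fun _ => 0) (x₀ := x + 1) (fun x => (hA.1 x).ofReal_comp)
    (fun x => by
      have := (hA.2.1 x).ofReal_comp
      rwa [Complex.ofReal_mul] at this)
    (fun x => hasDerivAt_const x _) (fun x => by simpa using hasDerivAt_const x (0 : ℂ))
    (by simp [hz (x + 1) (by linarith)]) (by simp [hd]) 0
  have h2 : A 0 = 0 := by exact_mod_cast key.1
  rw [hA.2.2.1] at h2
  have : 0 < Real.Gamma (2 / 3) := Real.Gamma_pos_of_pos (by norm_num)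
  have h3 : (0 : ℝ) < (3 : ℝ) ^ (-(2 : ℝ) / 3) / Real.Gamma (2 / 3) := by positivity
  exact h3.ne' h2

end AiryIdentification

section Hermite

lemma integrable_eval_mul_gauss (p : ℂ[X]) {b : ℝ} (hb : 0 < b) :
    Integrable fun x : ℝ => p.eval (x : ℂ) * ((Real.exp (-b * x ^ 2) : ℝ) : ℂ) := by
  induction p using Polynomial.induction_on' with
  | add p q hp hq => 
    exact (hp.add hq).congr (Eventually.of_forall fun x => by simp [add_mul])
  | monomial n a =>
    have h : Integrable fun x : ℝ => x ^ (n : ℝ) * Real.exp (-b * x ^ 2) :=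
      integrable_rpow_mul_exp_neg_mul_sq hb (by have : (0 : ℝ) ≤ n := n.cast_nonneg
                                                linarith)
    refine (h.ofReal.const_mul a).congr (Eventually.of_forall fun x => ?_)
    simp only [Polynomial.eval_monomial, Real.rpow_natCast]
    change a * ((x ^ n * Real.exp (-b * x ^ 2) : ℝ) : ℂ) = _
    rw [Complex.ofReal_mul, Complex.ofReal_pow]
    ring

lemma integrable_eval_mul_exp (p : ℂ[X]) :
    Integrable fun x : ℝ => p.eval (x : ℂ) * ((Real.exp (-x ^ 2) : ℝ) : ℂ) := by
  simpa using integrable_eval_mul_gauss p one_pos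

lemma hasDerivAt_eval_ofReal (p : ℂ[X]) (x : ℝ) :
    HasDerivAt (fun x : ℝ => p.eval (x : ℂ)) (p.derivative.eval (x : ℂ)) x :=
  (p.hasDerivAt (x : ℂ)).comp_ofReal

lemma hasDerivAt_exp_neg_sq (x : ℝ) :
    HasDerivAt (fun x : ℝ => ((Real.exp (-x ^ 2) : ℝ) : ℂ))
      (-(2 * x) * ((Real.exp (-x ^ 2) : ℝ) : ℂ)) x := by
  have h : HasDerivAt (fun x : ℝ => Real.exp (-x ^ 2)) (Real.exp (-x ^ 2) * -(2 * x)) x := by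
    have := ((hasDerivAt_id x).pow 2).neg.exp
    exact this.congr_deriv (by simp)
  refine h.ofReal_comp.congr_deriv ?_
  push_cast
  ring

lemma hasDerivAt_eval_mul_exp (p : ℂ[X]) (x : ℝ) :
    HasDerivAt (fun x : ℝ => p.eval (x : ℂ) * ((Real.exp (-x ^ 2) : ℝ) : ℂ))
      ((p.derivative - 2 * X * p).eval (x : ℂ) * ((Real.exp (-x ^ 2) : ℝ) : ℂ)) x := by
  refine ((hasDerivAt_eval_ofReal p x).mul (hasDerivAt_exp_neg_sq x)).congr_deriv ?_
  simp
  ring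

/-- Integration of a polynomial against the Gaussian weight. -/
def gaussI (p : ℂ[X]) : ℂ := ∫ x : ℝ, p.eval (x : ℂ) * ((Real.exp (-x ^ 2) : ℝ) : ℂ)

lemma gaussI_add (p q : ℂ[X]) : gaussI (p + q) = gaussI p + gaussI q := by
  rw [gaussI, gaussI, gaussI, ← integral_add (integrable_eval_mul_exp p)
    (integrable_eval_mul_exp q)]
  simp [add_mul]

lemma gaussI_C_mul (c : ℂ) (p : ℂ[X]) : gaussI (C c * p) = c * gaussI p := by
  rw [gaussI, gaussI, ← integral_const_mul]
  simp [mul_assoc]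

lemma gaussI_sub (p q : ℂ[X]) : gaussI (p - q) = gaussI p - gaussI q := by
  have := gaussI_add p (C (-1) * q)
  rw [gaussI_C_mul] at this
  simpa [sub_eq_add_neg] using this

lemma gaussI_parts (p : ℂ[X]) : gaussI p.derivative = gaussI (2 * X * p) := by
  rw [← sub_eq_zero, ← gaussI_sub]
  exact integral_eq_zero_of_hasDerivAt_of_integrable (hasDerivAt_eval_mul_exp p)
    (integrable_eval_mul_exp _) (integrable_eval_mul_exp p)

lemma gaussI_one : gaussI 1 = √Real.pi := by
  have := integral_gaussian 1
  simp only [neg_mul, one_mul, div_one] at this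
  simp only [gaussI, Polynomial.eval_one, one_mul]
  rw [integral_complex_ofReal, this]

/-- The monic Hermite polynomials for the weight `e^{-x²}`. -/
def herm : ℕ → ℂ[X]
  | 0 => 1
  | 1 => X
  | (n + 2) => X * herm (n + 1) - C ((n + 1 : ℂ) / 2) * herm n

lemma herm_succ (n : ℕ) : herm (n + 1) = X * herm n - C ((n : ℂ) / 2) * herm (n - 1) := by
  cases n with
  | zero => simp [herm]
  | succ n => simp [herm]

lemma derivative_herm (n : ℕ) : (herm n).derivative = C (n : ℂ) * herm (n - 1) := by
  induction n using Nat.strong_induction_on with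
  | _ n ih =>
    match n with
    | 0 => simp [herm]
    | 1 => simp [herm]
    | (n + 2) =>
      have h1 := ih (n + 1) (by omega)
      have h0 := ih n (by omega)
      have h2 : herm (n + 1) = _ := herm_succ n
      have e : (2 : ℂ[X]) = C 2 := rfl
      have hc : (C ((n + 1 : ℂ) / 2) * C (n : ℂ)) = C (n + 1 : ℂ) * C ((n : ℂ) / 2) := by
        rw [← C_mul, ← C_mul]; ring_nf
      simp only [herm, derivative_sub, derivative_mul, derivative_X, derivative_C, h1, h0,
        Nat.add_sub_cancel, zero_mul, zero_add, one_mul,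
        show n + 2 - 1 = n + 1 by omega]
      have hc2 : (C ((n + 2 : ℕ) : ℂ) : ℂ[X]) = C (n + 1 : ℂ) + 1 := by
        rw [← C_1, ← C_add]; push_cast; ring_nf
      have hc3 : (C ((n + 1 : ℕ) : ℂ) : ℂ[X]) = C (n + 1 : ℂ) := by push_cast; rfl
      rw [hc2, hc3]
      linear_combination (-C (n + 1 : ℂ)) * h2 - herm (n - 1) * hc

lemma herm_monic_natDegree (n : ℕ) : (herm n).Monic ∧ (herm n).natDegree = n := by
  induction n using Nat.strong_induction_on with
  | _ n ih =>
    match n with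
    | 0 => simp [herm]
    | 1 => simp [herm, monic_X]
    | (n + 2) =>
      obtain ⟨m1, d1⟩ := ih (n + 1) (by omega)
      obtain ⟨m0, d0⟩ := ih n (by omega)
      have hm : (X * herm (n + 1)).Monic := monic_X.mul m1
      have hd : (X * herm (n + 1)).natDegree = n + 2 := by
        rw [monic_X.natDegree_mul m1, natDegree_X, d1]; omega
      have hlt : (C ((n + 1 : ℂ) / 2) * herm n).degree < (X * herm (n + 1)).degree := by
        rw [degree_C_mul (div_ne_zero (by exact_mod_cast n.succ_ne_zero) two_ne_zero),
          degree_eq_natDegree m0.ne_zero, degree_eq_natDegree hm.ne_zero, d0, hd]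
        exact_mod_cast (by omega : n < n + 2)
      refine ⟨hm.sub_of_left hlt, ?_⟩
      rw [herm, natDegree_eq_of_degree_eq (degree_sub_eq_left_of_degree_lt hlt), hd]

lemma herm_monic (n : ℕ) : (herm n).Monic := (herm_monic_natDegree n).1
lemma natDegree_herm (n : ℕ) : (herm n).natDegree = n := (herm_monic_natDegree n).2

lemma gaussI_herm_succ_mul (n : ℕ) (p : ℂ[X]) :
    gaussI (herm (n + 1) * p) = 1 / 2 * gaussI (herm n * p.derivative) := by
  have h1 := gaussI_parts (herm n * p)
  rw [derivative_mul, derivative_herm, gaussI_add] at h1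
  have e1 : herm (n + 1) * p = C (1 / 2) * (2 * X * (herm n * p))
      - C (1 / 2) * (C (n : ℂ) * herm (n - 1) * p) := by
    have h2 : (C (1 / 2 : ℂ)) * 2 = 1 := by
      rw [show (2 : ℂ[X]) = C 2 from rfl, ← C_mul]; norm_num
    have h3 : (C ((n : ℂ) / 2) : ℂ[X]) = C (1 / 2) * C (n : ℂ) := by
      rw [← C_mul]; ring_nf
    rw [herm_succ, h3]
    linear_combination (-X * herm n * p) * h2
  rw [e1, gaussI_sub, gaussI_C_mul, gaussI_C_mul, ← h1]
  ring

lemma gaussI_herm_mul_of_lt {n : ℕ} {p : ℂ[X]} (hp : p.degree < n) : gaussI (herm n * p) = 0 := by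
  induction n generalizing p with
  | zero =>
    have : p = 0 := by
      rw [← degree_eq_bot, ← Nat.WithBot.lt_zero_iff]; exact_mod_cast hp
    simp [this, gaussI]
  | succ n ih =>
    rw [gaussI_herm_succ_mul, ih, mul_zero]
    by_cases h0 : p = 0
    · simp [h0]
    · have h1 := degree_derivative_lt h0
      have h2 : p.degree ≤ n := Order.le_of_lt_succ (by exact_mod_cast hp)
      exact h1.trans_le h2

/-- The squared norm `√π n! / 2ⁿ` of the Hermite polynomials. -/
def hermNormSq (n : ℕ) : ℝ := √Real.pi * n.factorial / 2 ^ n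

lemma hermNormSq_pos (n : ℕ) : 0 < hermNormSq n := by
  unfold hermNormSq; positivity

lemma hermNormSq_succ (n : ℕ) : hermNormSq (n + 1) = (n + 1) / 2 * hermNormSq n := by
  unfold hermNormSq
  rw [Nat.factorial_succ]
  push_cast
  field_simp
  rw [pow_succ]
  ring

lemma gaussI_herm_sq (n : ℕ) : gaussI (herm n * herm n) = hermNormSq n := by
  induction n with
  | zero => simp [herm, gaussI_one, hermNormSq]
  | succ n ih =>
    rw [gaussI_herm_succ_mul, derivative_herm, mul_left_comm, gaussI_C_mul, Nat.add_sub_cancel, ih,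
      hermNormSq_succ]
    push_cast
    ring

lemma gaussI_herm_herm (i j : ℕ) :
    gaussI (herm i * herm j) = if i = j then (hermNormSq i : ℂ) else 0 := by
  split_ifs with h
  · rw [h, gaussI_herm_sq]
  · rcases lt_or_gt_of_ne h with h | h
    · rw [mul_comm]
      refine gaussI_herm_mul_of_lt ?_
      rw [degree_eq_natDegree (herm_monic i).ne_zero, natDegree_herm]
      exact_mod_cast h
    · refine gaussI_herm_mul_of_lt ?_
      rw [degree_eq_natDegree (herm_monic j).ne_zero, natDegree_herm]
      exact_mod_cast h

lemma gaussI_sum {ι : Type*} (s : Finset ι) (f : ι → ℂ[X]) :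
    gaussI (∑ i ∈ s, f i) = ∑ i ∈ s, gaussI (f i) := by
  induction s using Finset.cons_induction with
  | empty => simp [gaussI]
  | cons i s hi ih => rw [Finset.sum_cons, Finset.sum_cons, gaussI_add, ih]

/-- Every polynomial of degree `< n` is a linear combination of the first `n` Hermite
polynomials. -/
lemma exists_herm_sum (n : ℕ) (p : ℂ[X]) (hp : p.degree < n) :
    ∃ c : ℕ → ℂ, p = ∑ j ∈ Finset.range n, C (c j) * herm j := by
  induction n generalizing p with
  | zero =>
    have : p = 0 := by
      rw [← degree_eq_bot, ← Nat.WithBot.lt_zero_iff]; exact_mod_cast hp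
    exact ⟨0, by simp [this]⟩
  | succ n ih =>
    have hd : (p - C (p.coeff n) * herm n).degree < n := by
      rw [degree_lt_iff_coeff_zero] at hp ⊢
      intro m hm
      rw [coeff_sub, coeff_C_mul]
      rcases hm.eq_or_lt with h | h
      · have h1 := (herm_monic n).coeff_natDegree
        rw [natDegree_herm] at h1
        rw [← h, h1]; ring
      · rw [hp m (by omega), coeff_eq_zero_of_natDegree_lt (p := herm n) (by rw [natDegree_herm]; exact h)]
        ring
    obtain ⟨c, hc⟩ := ih _ hd
    refine ⟨fun j => if j = n then p.coeff n else c j, ?_⟩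
    rw [Finset.sum_range_succ]
    dsimp only
    rw [if_pos rfl]
    have : ∑ j ∈ Finset.range n, C (if j = n then p.coeff n else c j) * herm j
        = ∑ j ∈ Finset.range n, C (c j) * herm j :=
      Finset.sum_congr rfl fun j hj => by rw [if_neg (Finset.mem_range.1 hj).ne]
    rw [this, ← hc]
    ring

lemma herm_expansion {n : ℕ} {p : ℂ[X]} (hp : p.degree < n) :
    p = ∑ j ∈ Finset.range n, C (gaussI (herm j * p) / hermNormSq j) * herm j := by
  obtain ⟨c, hc⟩ := exists_herm_sum n p hp
  conv_lhs => rw [hc]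
  refine Finset.sum_congr rfl fun j hj => ?_
  congr 2
  rw [hc, Finset.mul_sum, gaussI_sum, eq_div_iff (by exact_mod_cast (hermNormSq_pos j).ne')]
  rw [Finset.sum_eq_single j]
  · rw [mul_left_comm, gaussI_C_mul, gaussI_herm_sq]
  · intro i _ hij
    rw [mul_left_comm, gaussI_C_mul, gaussI_herm_herm, if_neg hij.symm, mul_zero]
  · exact fun h => absurd hj h

/-- Contour integral representation of the Hermite polynomials. -/
lemma herm_integral (c x : ℝ) (n : ℕ) :
    Integrable (fun y : ℝ => (c + y * Complex.I) ^ n *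
      Complex.exp ((c - x + y * Complex.I) ^ 2)) ∧
    ∫ y : ℝ, (c + y * Complex.I) ^ n * Complex.exp ((c - x + y * Complex.I) ^ 2)
      = √Real.pi * (herm n).eval (x : ℂ) := by
  have hexp (y : ℝ) : Complex.exp ((c - x + y * Complex.I) ^ 2)
      = Complex.exp ((c - x) ^ 2) * Complex.exp (((2 * (c - x) * y : ℝ) : ℂ) * Complex.I)
        * ((Real.exp (-y ^ 2) : ℝ) : ℂ) := by
    push_cast
    rw [← Complex.exp_add, ← Complex.exp_add]
    congr 1
    linear_combination (y : ℂ) ^ 2 * Complex.I_sq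
  have h_int (n : ℕ) : Integrable (fun y : ℝ => (c + y * Complex.I) ^ n *
      Complex.exp ((c - x + y * Complex.I) ^ 2)) := by
    have h := integrable_eval_mul_exp ((C (c : ℂ) + C Complex.I * X) ^ n)
    have h2 := h.bdd_mul (c := 1)
      (f := fun y : ℝ => Complex.exp (((2 * (c - x) * y : ℝ) : ℂ) * Complex.I))
      (by fun_prop) (Eventually.of_forall fun y => by rw [Complex.norm_exp_ofReal_mul_I])
    refine (h2.const_mul (Complex.exp ((c - x) ^ 2))).congr (Eventually.of_forall fun y => ?_)
    simp only [hexp, Polynomial.eval_pow, Polynomial.eval_add, Polynomial.eval_C,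
      Polynomial.eval_mul, Polynomial.eval_X]
    ring
  refine ⟨h_int n, ?_⟩
  have hrec (n : ℕ) : ∫ y : ℝ, (c + y * Complex.I) ^ (n + 1) *
        Complex.exp ((c - x + y * Complex.I) ^ 2)
      = x * (∫ y : ℝ, (c + y * Complex.I) ^ n * Complex.exp ((c - x + y * Complex.I) ^ 2))
      - n / 2 * ∫ y : ℝ, (c + y * Complex.I) ^ (n - 1) *
        Complex.exp ((c - x + y * Complex.I) ^ 2) := by
    have e (y : ℝ) : HasDerivAt (fun y : ℝ => (c + y * Complex.I) ^ n *
        Complex.exp ((c - x + y * Complex.I) ^ 2))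
        (2 * Complex.I * ((c + y * Complex.I) ^ (n + 1) *
          Complex.exp ((c - x + y * Complex.I) ^ 2)
        - x * ((c + y * Complex.I) ^ n * Complex.exp ((c - x + y * Complex.I) ^ 2))
        + n / 2 * ((c + y * Complex.I) ^ (n - 1) *
          Complex.exp ((c - x + y * Complex.I) ^ 2)))) y := by
      have h1 : HasDerivAt (fun y : ℝ => (y : ℂ) * Complex.I) Complex.I y := by
        have := (Complex.ofRealCLM.hasDerivAt (x := y)).mul_const Complex.I
        exact this.congr_deriv (by simp)
      have h2 := ((h1.const_add (c : ℂ)).pow n).mul (((h1.const_add (c - x : ℂ)).pow 2).cexp)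
      refine h2.congr_deriv ?_
      simp only [Pi.pow_apply]
      push_cast
      ring
    have h0 := integral_eq_zero_of_hasDerivAt_of_integrable e
      ((((h_int (n + 1)).sub ((h_int n).const_mul _)).add ((h_int (n - 1)).const_mul _)).const_mul _)
      (h_int n)
    have i1 : Integrable fun y : ℝ => (c + y * Complex.I) ^ (n + 1) *
        Complex.exp ((c - x + y * Complex.I) ^ 2) - x * ((c + y * Complex.I) ^ n *
          Complex.exp ((c - x + y * Complex.I) ^ 2)) := (h_int (n + 1)).sub ((h_int n).const_mul _)
    rw [integral_const_mul, integral_add i1 ((h_int (n - 1)).const_mul _), integral_sub (h_int (n + 1)) ((h_int n).const_mul _),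
      integral_const_mul, integral_const_mul] at h0
    have h3 : (2 * Complex.I : ℂ) ≠ 0 := by simp
    have h4 := (mul_eq_zero.1 h0).resolve_left h3
    linear_combination h4
  have hzero : ∫ y : ℝ, Complex.exp ((c - x + y * Complex.I) ^ 2) = √Real.pi := by
    have := integral_cexp_quadratic (b := -1) (by simp) (2 * (c - x) * Complex.I) ((c - x) ^ 2)
    have e (y : ℝ) : Complex.exp ((c - x + y * Complex.I) ^ 2)
        = Complex.exp (-1 * (y : ℂ) ^ 2 + 2 * (c - x) * Complex.I * y + (c - x) ^ 2) := by
      congr 1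
      linear_combination (y : ℂ) ^ 2 * Complex.I_sq
    simp_rw [e]
    rw [this]
    have e2 : ((c - x : ℂ) ^ 2 - (2 * (c - x) * Complex.I) ^ 2 / (4 * -1)) = 0 := by
      linear_combination (c - x : ℂ) ^ 2 * Complex.I_sq
    rw [e2, Complex.exp_zero, mul_one, neg_neg, div_one, Real.sqrt_eq_rpow,
      Complex.ofReal_cpow Real.pi_pos.le]
    norm_num
  induction n using Nat.strong_induction_on with
  | _ n ih =>
    match n with
    | 0 => simpa [herm] using hzero
    | (n + 1) =>
      rw [hrec, ih n (by omega), ih (n - 1) (by omega), herm_succ]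
      simp
      ring

end Hermite

section Saddle

lemma one_add_le_exp_cubic {a : ℝ} (ha : 0 ≤ a) :
    1 + a ≤ Real.exp (a - a ^ 2 / 2 + a ^ 3 / 3) := by
  rw [← Real.log_le_iff_le_exp (by linarith)]
  have hd (x : ℝ) (hx : x ∈ interior (Ici (0 : ℝ))) :
      HasDerivWithinAt (fun x => x - x ^ 2 / 2 + x ^ 3 / 3 - Real.log (1 + x))
        (x ^ 3 / (1 + x)) (interior (Ici 0)) x := by
    rw [interior_Ici] at hx
    have hx' : 1 + x ≠ 0 := by have : 0 < x := hx; positivity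
    have h1 := (((hasDerivAt_id x).sub (((hasDerivAt_id x).pow 2).div_const 2)).add
      (((hasDerivAt_id x).pow 3).div_const 3)).sub (((hasDerivAt_id x).const_add 1).log hx')
    refine (h1.congr_deriv ?_).hasDerivWithinAt
    simp
    field_simp
    ring
  have hm : MonotoneOn (fun x => x - x ^ 2 / 2 + x ^ 3 / 3 - Real.log (1 + x)) (Ici (0 : ℝ)) := by
    refine monotoneOn_of_hasDerivWithinAt_nonneg (convex_Ici 0) ?_ hd fun x hx => ?_
    · refine ContinuousOn.sub (by fun_prop) (ContinuousOn.log (by fun_prop) fun x hx => ?_)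
      have : (0 : ℝ) ≤ x := hx
      positivity
    · rw [interior_Ici] at hx
      have : 0 < x := hx
      positivity
  have := hm (self_mem_Ici) (show a ∈ Ici (0 : ℝ) from ha) ha
  simp at this
  linarith

lemma norm_one_add_le {u : ℂ} (hu : 0 ≤ u.re) :
    ‖1 + u‖ ≤ Real.exp (u.re - u.re ^ 2 / 2 + u.re ^ 3 / 3 + u.im ^ 2 / (1 + u.re) ^ 2 / 2) := by
  refine (sq_le_sq₀ (norm_nonneg _) (Real.exp_pos _).le).1 ?_
  rw [← Real.exp_nat_mul, ← Complex.normSq_eq_norm_sq, Complex.normSq_apply]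
  simp only [Complex.add_re, Complex.one_re, Complex.add_im, Complex.one_im, zero_add]
  have h1 := one_add_le_exp_cubic hu
  have h2 := Real.add_one_le_exp (u.im ^ 2 / (1 + u.re) ^ 2)
  have h3 : (1 + u.re) * (1 + u.re) + u.im * u.im
      = (1 + u.re) ^ 2 * (u.im ^ 2 / (1 + u.re) ^ 2 + 1) := by
    field_simp
    ring
  rw [h3]
  calc _ ≤ Real.exp (u.re - u.re ^ 2 / 2 + u.re ^ 3 / 3) ^ 2
        * Real.exp (u.im ^ 2 / (1 + u.re) ^ 2) := by gcongr
    _ = _ := by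
        rw [← Real.exp_nat_mul, ← Real.exp_add]
        congr 1
        push_cast
        ring

/-- Interpolation between the cubic exponential and the Hermite integrand. -/
def saddleF (n : ℕ) (v : ℂ) (r : ℝ) : ℂ :=
  (1 + r * v) ^ n * Complex.exp (n * (-(r * v) + (r * v) ^ 2 / 2 + v ^ 3 * (1 - r ^ 3) / 3))

lemma hasDerivAt_saddleF (n : ℕ) (v : ℂ) (r : ℝ) (h : 1 + r * v ≠ 0) :
    HasDerivAt (saddleF n v)
      (saddleF n v r * (n * v * (-(r * v) ^ 3 / (1 + r * v)))) r := by
  have h0 : HasDerivAt (fun r : ℝ => (r : ℂ)) 1 r :=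
    (Complex.ofRealCLM.hasDerivAt (x := r)).congr_deriv (by simp)
  have h1 : HasDerivAt (fun r : ℝ => (r : ℂ) * v) v r :=
    (h0.mul_const v).congr_deriv (one_mul v)
  have h2 := ((h1.const_add 1).pow n).mul ((((h1.neg).add ((h1.pow 2).div_const 2)).add
    ((((h0.pow 3).const_sub 1).const_mul (v ^ 3)).div_const 3)).const_mul (n : ℂ)).cexp
  have h3 : saddleF n v = fun r : ℝ => (1 + r * v) ^ n *
    Complex.exp (n * (-(r * v) + (r * v) ^ 2 / 2 + v ^ 3 * (1 - r ^ 3) / 3)) := rfl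
  rw [h3]
  refine h2.congr_deriv ?_
  simp only [Pi.add_apply, Pi.neg_apply, Pi.pow_apply]
  have h4 : (n : ℂ) * (1 + r * v) ^ (n - 1) = n * (1 + r * v) ^ n / (1 + r * v) := by
    cases n with
    | zero => simp
    | succ n => rw [Nat.add_sub_cancel, pow_succ]; field_simp
  rw [h4]
  field_simp
  push_cast
  ring

lemma norm_saddleF_le {n : ℕ} {ν : ℝ} (hν : 1 ≤ ν) (hn : ν ^ 3 = n) (η : ℝ) {r : ℝ}
    (hr : r ∈ Icc (0 : ℝ) 1) :
    ‖saddleF n (linePt η / ν) r‖ ≤ Real.exp (8 / 3 - 4 / 9 * η ^ 2) := by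
  have hν0 : 0 < ν := by linarith
  obtain ⟨hr0, hr1⟩ := hr
  have hre : ((r : ℂ) * (linePt η / ν)).re = 2 * r / ν := by
    rw [Complex.re_ofReal_mul, Complex.div_ofReal_re, linePt_re]; ring
  have him : ((r : ℂ) * (linePt η / ν)).im = r * η / ν := by
    rw [Complex.im_ofReal_mul, Complex.div_ofReal_im, linePt_im]; ring
  have h1 := norm_one_add_le (u := (r : ℂ) * (linePt η / ν)) (by rw [hre]; positivity)
  rw [hre, him] at h1
  have h2 : ((n : ℂ) * (-(r * (linePt η / ν)) + (r * (linePt η / ν)) ^ 2 / 2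
      + (linePt η / ν) ^ 3 * (1 - r ^ 3) / 3)).re
      = -2 * r * ν ^ 2 + r ^ 2 * (4 - η ^ 2) * ν / 2 + (8 - 6 * η ^ 2) * (1 - r ^ 3) / 3 := by
    have e : (n : ℂ) * (-(r * (linePt η / ν)) + (r * (linePt η / ν)) ^ 2 / 2
      + (linePt η / ν) ^ 3 * (1 - r ^ 3) / 3)
      = ((-r * ν ^ 2 : ℝ) : ℂ) * linePt η + ((r ^ 2 * ν / 2 : ℝ) : ℂ) * linePt η ^ 2
        + (((1 - r ^ 3) / 3 : ℝ) : ℂ) * linePt η ^ 3 := by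
      have : (n : ℂ) = (ν : ℂ) ^ 3 := by exact_mod_cast hn.symm
      have h0 : (ν : ℂ) ≠ 0 := by exact_mod_cast hν0.ne'
      rw [this]
      push_cast
      field_simp
    have e2 : (linePt η ^ 2).re = 4 - η ^ 2 := by
      rw [pow_two, Complex.mul_re, linePt_re, linePt_im]; ring
    have e4 : (linePt η ^ 2).im = 4 * η := by
      rw [pow_two, Complex.mul_im, linePt_re, linePt_im]; ring
    have e3 : (linePt η ^ 3).re = 8 - 6 * η ^ 2 := by
      rw [pow_succ, Complex.mul_re, e2, e4, linePt_re, linePt_im]; ring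
    rw [e, Complex.add_re, Complex.add_re, Complex.re_ofReal_mul, Complex.re_ofReal_mul,
      Complex.re_ofReal_mul, e2, e3, linePt_re]
    ring
  rw [saddleF, norm_mul, norm_pow, Complex.norm_exp, h2]
  have h3 := pow_le_pow_left₀ (norm_nonneg _) h1 n
  rw [← Real.exp_nat_mul, ← hn] at h3
  refine (mul_le_mul_of_nonneg_right h3 (Real.exp_pos _).le).trans ?_
  rw [← Real.exp_add]
  refine Real.exp_le_exp.2 ?_
  set a := 2 * r / ν with ha
  have ha0 : 0 ≤ a := by positivity
  have ha2 : a ≤ 2 := by rw [ha, div_le_iff₀ hν0]; nlinarith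
  have hra : r = a * ν / 2 := by rw [ha]; field_simp
  have key : 4 / 9 ≤ (2 + a) / (1 + a) ^ 2 := by
    rw [le_div_iff₀ (by positivity)]; nlinarith
  have e4 : ν ^ 3 * (a - a ^ 2 / 2 + a ^ 3 / 3 + (r * η / ν) ^ 2 / (1 + a) ^ 2 / 2)
      + (-2 * r * ν ^ 2 + r ^ 2 * (4 - η ^ 2) * ν / 2 + (8 - 6 * η ^ 2) * (1 - r ^ 3) / 3)
      = 8 / 3 - η ^ 2 * (2 * (1 - r ^ 3) + r ^ 3 * ((2 + a) / (1 + a) ^ 2)) := by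
    rw [hra]
    field_simp
    ring
  rw [e4]
  have hr3 : r ^ 3 ≤ 1 := pow_le_one₀ hr0 hr1
  have : 4 / 9 ≤ 2 * (1 - r ^ 3) + r ^ 3 * ((2 + a) / (1 + a) ^ 2) := by
    nlinarith [mul_le_mul_of_nonneg_left key (pow_nonneg hr0 3)]
  nlinarith [mul_le_mul_of_nonneg_left this (sq_nonneg η)]

lemma one_le_norm_one_add {u : ℂ} (hu : 0 ≤ u.re) : 1 ≤ ‖1 + u‖ := by
  refine le_trans ?_ (Complex.re_le_norm _)
  simp [hu]

/-- The amplitude in the integral representation of the Hermite functions. -/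
def hermAmp (n k : ℕ) (ν : ℝ) (η : ℝ) : ℂ :=
  (1 + linePt η / ν) ^ (n - k) * Complex.exp (-(linePt η * ν ^ 2) + linePt η ^ 2 * ν / 2)

lemma hermAmp_sub_cubicExp_le : ∃ C, 0 ≤ C ∧ ∀ (n : ℕ) (ν : ℝ), 1 ≤ ν → ν ^ 3 = n → ∀ k ≤ 1,
    ∀ η, ‖hermAmp n k ν η - cubicExp η‖ ≤ C / ν * Real.exp (-(1 / 3) * η ^ 2) := by
  obtain ⟨D, hD0, hD⟩ := norm_linePt_pow_le 4 (δ := 1 / 9) (by norm_num)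
  refine ⟨2 * Real.exp (8 / 3) * D, by positivity, fun n ν hν hn k hk η => ?_⟩
  have hν0 : 0 < ν := by linarith
  have hνc : (ν : ℂ) ≠ 0 := by exact_mod_cast hν0.ne'
  have hnc : (n : ℂ) = (ν : ℂ) ^ 3 := by exact_mod_cast hn.symm
  set v := linePt η / ν with hv
  have hvre : 0 ≤ v.re := by rw [hv, Complex.div_ofReal_re, linePt_re]; positivity
  have hrre {r : ℝ} (hr : 0 ≤ r) : 0 ≤ ((r : ℂ) * v).re := by
    rw [Complex.re_ofReal_mul]; positivity
  have hvn : ‖v‖ = ‖linePt η‖ / ν := by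
    rw [hv, norm_div, Complex.norm_real, Real.norm_of_nonneg hν0.le]
  have hw1 := one_le_norm_linePt η
  have e0 : saddleF n v 0 = cubicExp η := by
    simp only [saddleF, cubicExp, hnc, hv, Complex.ofReal_zero]
    have : (ν : ℂ) ^ 3 * (-(0 * (linePt η / ν)) + (0 * (linePt η / ν)) ^ 2 / 2
      + (linePt η / ν) ^ 3 * (1 - 0 ^ 3) / 3) = linePt η ^ 3 / 3 := by field_simp; ring
    rw [this]; simp
  have e1 : saddleF n v 1 = hermAmp n 0 ν η := by
    simp only [saddleF, hermAmp, hnc, Complex.ofReal_one, Nat.sub_zero, one_mul]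
    rw [← hv]
    congr 2
    rw [hv]; field_simp; ring
  clear_value v
  have hE : Real.exp (8 / 3 - 4 / 9 * η ^ 2) * ‖linePt η‖ ^ 4
      ≤ Real.exp (8 / 3) * D * Real.exp (-(1 / 3) * η ^ 2) := by
    calc _ ≤ Real.exp (8 / 3 - 4 / 9 * η ^ 2) * (D * Real.exp (1 / 9 * η ^ 2)) :=
          mul_le_mul_of_nonneg_left (hD η) (Real.exp_pos _).le
      _ = D * (Real.exp (8 / 3 - 4 / 9 * η ^ 2) * Real.exp (1 / 9 * η ^ 2)) := by ring
      _ = D * (Real.exp (8 / 3) * Real.exp (-(1 / 3) * η ^ 2)) := by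
          rw [← Real.exp_add, ← Real.exp_add]; ring_nf
      _ = _ := by ring
  have hF : ‖saddleF n v 1 - saddleF n v 0‖
      ≤ Real.exp (8 / 3) * D / ν * Real.exp (-(1 / 3) * η ^ 2) := by
    refine norm_image_sub_le_of_norm_deriv_le_segment_01' (fun r hr => (hasDerivAt_saddleF n v r
      (norm_pos_iff.1 (one_pos.trans_le (one_le_norm_one_add (hrre hr.1))))).hasDerivWithinAt)
      fun r hr => ?_
    have hb := norm_saddleF_le hν hn η (Ico_subset_Icc_self hr)
    rw [← hv] at hb
    have h1 : ‖(n : ℂ) * v * (-(r * v) ^ 3 / (1 + r * v))‖ ≤ ‖linePt η‖ ^ 4 / ν := by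
      rw [norm_mul, norm_mul, norm_div, norm_neg, norm_pow, norm_mul, hnc, norm_pow,
        Complex.norm_real, Complex.norm_real, Real.norm_of_nonneg hν0.le,
        Real.norm_of_nonneg hr.1]
      have h2 : (r * ‖v‖) ^ 3 / ‖1 + r * v‖ ≤ ‖v‖ ^ 3 := by
        refine (div_le_self (by have := hr.1; positivity)
          (one_le_norm_one_add (hrre hr.1))).trans ?_
        have := hr.1
        exact pow_le_pow_left₀ (by positivity)
          (mul_le_of_le_one_left (norm_nonneg _) hr.2.le) 3
      calc _ ≤ ν ^ 3 * ‖v‖ * ‖v‖ ^ 3 := by gcongr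
        _ = _ := by rw [hvn]; field_simp
    rw [norm_mul]
    calc _ ≤ Real.exp (8 / 3 - 4 / 9 * η ^ 2) * (‖linePt η‖ ^ 4 / ν) := by gcongr
      _ = (Real.exp (8 / 3 - 4 / 9 * η ^ 2) * ‖linePt η‖ ^ 4) / ν := by ring
      _ ≤ (Real.exp (8 / 3) * D * Real.exp (-(1 / 3) * η ^ 2)) / ν := by gcongr
      _ = _ := by ring
  have hs : ‖hermAmp n k ν η - hermAmp n 0 ν η‖
      ≤ Real.exp (8 / 3) * D / ν * Real.exp (-(1 / 3) * η ^ 2) := by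
    interval_cases k
    · rw [sub_self, norm_zero]; positivity
    · have h1v : 1 + v ≠ 0 := norm_pos_iff.1 (one_pos.trans_le (one_le_norm_one_add hvre))
      have hn0 : n ≠ 0 := by
        rintro rfl
        simp at hn
        exact hν0.ne' hn
      have : hermAmp n 1 ν η - hermAmp n 0 ν η = -(saddleF n v 1 * (v / (1 + v))) := by
        rw [e1, hermAmp, hermAmp, ← hv]
        obtain ⟨j, rfl⟩ := Nat.exists_eq_succ_of_ne_zero hn0
        simp only [Nat.succ_eq_add_one, Nat.add_sub_cancel, Nat.sub_zero, pow_succ]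
        field_simp
        ring
      rw [this, norm_neg, norm_mul, norm_div]
      have hb := norm_saddleF_le hν hn η (right_mem_Icc.2 zero_le_one)
      rw [← hv] at hb
      calc _ ≤ Real.exp (8 / 3 - 4 / 9 * η ^ 2) * (‖linePt η‖ ^ 4 / ν) := by
            refine mul_le_mul hb ?_ (by positivity) (Real.exp_pos _).le
            refine (div_le_self (norm_nonneg _) (one_le_norm_one_add hvre)).trans ?_
            rw [hvn]
            gcongr
            exact le_self_pow₀ hw1 (by norm_num)
        _ = (Real.exp (8 / 3 - 4 / 9 * η ^ 2) * ‖linePt η‖ ^ 4) / ν := by ring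
        _ ≤ (Real.exp (8 / 3) * D * Real.exp (-(1 / 3) * η ^ 2)) / ν := by gcongr
        _ = _ := by ring
  rw [e1, e0] at hF
  calc _ ≤ ‖hermAmp n k ν η - hermAmp n 0 ν η‖ + ‖hermAmp n 0 ν η - cubicExp η‖ :=
        norm_sub_le_norm_sub_add_norm_sub _ _ _
    _ ≤ _ := add_le_add hs hF
    _ = _ := by ring

end Saddle

section HermiteFunctions

lemma herm_eval_im (n : ℕ) (x : ℝ) : ((herm n).eval (x : ℂ)).im = 0 := by
  induction n using Nat.strong_induction_on with
  | _ n ih =>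
    match n with
    | 0 => simp [herm]
    | 1 => simp [herm]
    | (n + 2) =>
      have e : (herm (n + 2)).eval (x : ℂ) = x * (herm (n + 1)).eval (x : ℂ)
          - (((n + 1) / 2 : ℝ) : ℂ) * (herm n).eval (x : ℂ) := by simp [herm]
      rw [e, Complex.sub_im, Complex.im_ofReal_mul, Complex.im_ofReal_mul, ih _ (by omega),
        ih _ (by omega)]
      simp

lemma herm_eval_ofReal_re (n : ℕ) (x : ℝ) :
    ((((herm n).eval (x : ℂ)).re : ℝ) : ℂ) = (herm n).eval (x : ℂ) :=
  Complex.ext (by simp) (by simp [herm_eval_im])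

/-- The Hermite functions, orthonormal in `L²(ℝ)`. -/
def hermFun (n : ℕ) (x : ℝ) : ℝ :=
  ((herm n).eval (x : ℂ)).re * Real.exp (-x ^ 2 / 2) / √(hermNormSq n)

lemma ofReal_hermFun (n : ℕ) (x : ℝ) : (hermFun n x : ℂ)
    = (herm n).eval (x : ℂ) * (Real.exp (-x ^ 2 / 2) : ℝ) / (√(hermNormSq n) : ℝ) := by
  rw [hermFun, Complex.ofReal_div, Complex.ofReal_mul, herm_eval_ofReal_re]

lemma sqrt_hermNormSq_pos (n : ℕ) : 0 < √(hermNormSq n) := Real.sqrt_pos.2 (hermNormSq_pos n)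

lemma sqrt_hermNormSq_succ (n : ℕ) :
    √(hermNormSq (n + 1)) = √((n + 1) / 2) * √(hermNormSq n) := by
  rw [hermNormSq_succ, Real.sqrt_mul (by positivity)]

lemma hasDerivAt_herm_re (n : ℕ) (x : ℝ) : HasDerivAt (fun x : ℝ => ((herm n).eval (x : ℂ)).re)
    (n * ((herm (n - 1)).eval (x : ℂ)).re) x := by
  have h := (hasDerivAt_eval_ofReal (herm n) x)
  have h2 := Complex.reCLM.hasFDerivAt.comp_hasDerivAt x h
  refine h2.congr_deriv ?_
  rw [derivative_herm]
  simp

lemma herm_re_succ (n : ℕ) (x : ℝ) : ((herm (n + 1)).eval (x : ℂ)).re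
    = x * ((herm n).eval (x : ℂ)).re - n / 2 * ((herm (n - 1)).eval (x : ℂ)).re := by
  have e : (herm (n + 1)).eval (x : ℂ) = x * (herm n).eval (x : ℂ)
      - ((n / 2 : ℝ) : ℂ) * (herm (n - 1)).eval (x : ℂ) := by rw [herm_succ]; simp
  rw [e, Complex.sub_re, Complex.re_ofReal_mul, Complex.re_ofReal_mul]

lemma hasDerivAt_exp_neg_sq_half (x : ℝ) :
    HasDerivAt (fun x : ℝ => Real.exp (-x ^ 2 / 2)) (-x * Real.exp (-x ^ 2 / 2)) x := by
  have := (((hasDerivAt_id x).pow 2).neg.div_const 2).exp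
  refine this.congr_deriv ?_
  simp
  ring

/-- Raising relation. -/
lemma hasDerivAt_hermFun (n : ℕ) (x : ℝ) : HasDerivAt (hermFun n)
    (x * hermFun n x - 2 * √((n + 1) / 2) * hermFun (n + 1) x) x := by
  have h := ((hasDerivAt_herm_re n x).mul (hasDerivAt_exp_neg_sq_half x)).div_const
    (√(hermNormSq n))
  refine h.congr_deriv ?_
  have h1 := (sqrt_hermNormSq_pos n).ne'
  have h2 : √(((n : ℝ) + 1) / 2) ≠ 0 := by positivity
  rw [hermFun, hermFun, sqrt_hermNormSq_succ, herm_re_succ]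
  field_simp
  ring

/-- Lowering relation. -/
lemma hasDerivAt_hermFun_succ (n : ℕ) (x : ℝ) : HasDerivAt (hermFun (n + 1))
    (-x * hermFun (n + 1) x + 2 * √((n + 1) / 2) * hermFun n x) x := by
  have h := ((hasDerivAt_herm_re (n + 1) x).mul (hasDerivAt_exp_neg_sq_half x)).div_const
    (√(hermNormSq (n + 1)))
  refine h.congr_deriv ?_
  have h1 := (sqrt_hermNormSq_pos n).ne'
  have h2 : √(((n : ℝ) + 1) / 2) ≠ 0 := by positivity
  have h3 : √(((n : ℝ) + 1) / 2) ^ 2 = (n + 1) / 2 := Real.sq_sqrt (by positivity)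
  rw [hermFun, hermFun, sqrt_hermNormSq_succ, Nat.add_sub_cancel]
  field_simp
  rw [h3]
  push_cast
  ring

lemma hasDerivAt_deriv_hermFun (n : ℕ) (x : ℝ) :
    HasDerivAt (fun x => x * hermFun n x - 2 * √((n + 1) / 2) * hermFun (n + 1) x)
      ((x ^ 2 - (2 * n + 1)) * hermFun n x) x := by
  have h := ((hasDerivAt_id x).mul (hasDerivAt_hermFun n x)).sub
    ((hasDerivAt_hermFun_succ n x).const_mul (2 * √((n + 1) / 2)))
  refine h.congr_deriv ?_
  have h3 : √(((n : ℝ) + 1) / 2) ^ 2 = (n + 1) / 2 := Real.sq_sqrt (by positivity)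
  simp only [id]
  linear_combination (-4 * hermFun n x) * h3

lemma norm_eval_mul_exp_le (p : ℂ[X]) : ∃ C, 0 ≤ C ∧ ∀ x : ℝ,
    ‖p.eval (x : ℂ)‖ * Real.exp (-x ^ 2 / 2) ≤ C * Real.exp (-x ^ 2 / 4) := by
  induction p using Polynomial.induction_on' with
  | add p q hp hq =>
    obtain ⟨C, hC0, hC⟩ := hp
    obtain ⟨D, hD0, hD⟩ := hq
    refine ⟨C + D, by positivity, fun x => ?_⟩
    rw [eval_add, add_mul]
    calc _ ≤ (‖p.eval (x : ℂ)‖ + ‖q.eval (x : ℂ)‖) * Real.exp (-x ^ 2 / 2) :=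
          mul_le_mul_of_nonneg_right (norm_add_le _ _) (Real.exp_pos _).le
      _ ≤ _ := by rw [add_mul]; exact add_le_add (hC x) (hD x)
  | monomial n a =>
    obtain ⟨D, hD0, hD⟩ := norm_linePt_pow_le n (δ := 1 / 4) (by norm_num)
    refine ⟨‖a‖ * D, by positivity, fun x => ?_⟩
    have h1 : |x| ≤ ‖linePt x‖ := by
      simpa [linePt_im] using Complex.abs_im_le_norm (linePt x)
    rw [eval_monomial, norm_mul, norm_pow, Complex.norm_real, Real.norm_eq_abs]
    calc _ ≤ ‖a‖ * ‖linePt x‖ ^ n * Real.exp (-x ^ 2 / 2) := by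
          refine mul_le_mul_of_nonneg_right ?_ (Real.exp_pos _).le
          gcongr
      _ ≤ ‖a‖ * (D * Real.exp (1 / 4 * x ^ 2)) * Real.exp (-x ^ 2 / 2) := by
          refine mul_le_mul_of_nonneg_right ?_ (Real.exp_pos _).le
          exact mul_le_mul_of_nonneg_left (hD x) (norm_nonneg _)
      _ = ‖a‖ * D * (Real.exp (1 / 4 * x ^ 2) * Real.exp (-x ^ 2 / 2)) := by ring
      _ = _ := by rw [← Real.exp_add]; ring_nf

/-- Polynomials times a Gaussian decay exponentially in any affine variable. -/
lemma expDecay_eval_mul_exp (p : ℂ[X]) (a : ℝ) {σ : ℝ} (hσ : 0 < σ) :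
    ExpDecay fun s : ℝ => p.eval ((a + σ * s : ℝ) : ℂ) *
      ((Real.exp (-(a + σ * s) ^ 2 / 2) : ℝ) : ℂ) := by
  obtain ⟨C, hC0, hC⟩ := norm_eval_mul_exp_le p
  refine ⟨by fun_prop, fun T => ⟨C * Real.exp ((1 / σ) ^ 2 - a / σ), fun s _ => ?_⟩⟩
  rw [norm_mul, Complex.norm_real, Real.norm_of_nonneg (Real.exp_pos _).le]
  refine (hC _).trans ?_
  rw [mul_assoc, ← Real.exp_add]
  refine mul_le_mul_of_nonneg_left (Real.exp_le_exp.2 ?_) hC0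
  have : 0 ≤ ((a + σ * s) / 2 - 1 / σ) ^ 2 := sq_nonneg _
  have e : ((a + σ * s) / 2 - 1 / σ) ^ 2 = (a + σ * s) ^ 2 / 4 - a / σ - s + (1 / σ) ^ 2 := by
    field_simp; ring
  rw [e] at this
  linarith

lemma expDecay_hermFun (n : ℕ) (a : ℝ) {σ : ℝ} (hσ : 0 < σ) :
    ExpDecay fun s : ℝ => (hermFun n (a + σ * s) : ℂ) := by
  refine ((expDecay_eval_mul_exp (herm n) a hσ).const_mul ((√(hermNormSq n) : ℝ) : ℂ)⁻¹).congr
    fun s => ?_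
  rw [ofReal_hermFun]
  ring

/-- Solutions of `f'' = q f` with `q ≥ 4` that vanish at infinity decay like `e^{-2s}`. -/
lemma abs_le_exp_of_ode {f f' q : ℝ → ℝ} {s₀ : ℝ} (h1 : ∀ s, HasDerivAt f (f' s) s)
    (h2 : ∀ s, HasDerivAt f' (q s * f s) s) (hq : ∀ s, s₀ ≤ s → 4 ≤ q s)
    (hf : Tendsto f atTop (𝓝 0)) (hf' : Tendsto f' atTop (𝓝 0)) {s : ℝ} (hs : s₀ ≤ s) :
    |f s| ≤ |f s₀| * Real.exp (-2 * (s - s₀)) := by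
  have h_int {x : ℝ} (hx : x ∈ interior (Ici s₀)) : s₀ ≤ x := by
    rw [interior_Ici] at hx; exact hx.le
  have hd1 (x : ℝ) : HasDerivAt (fun s => f s * f' s) (f' x ^ 2 + q x * f x ^ 2) x :=
    ((h1 x).mul (h2 x)).congr_deriv (by ring)
  have m1 : MonotoneOn (fun s => f s * f' s) (Ici s₀) :=
    monotoneOn_of_hasDerivWithinAt_nonneg (convex_Ici _)
      (fun x _ => (hd1 x).continuousAt.continuousWithinAt) (fun x _ => (hd1 x).hasDerivWithinAt)
      fun x hx => by have := hq x (h_int hx); positivity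
  have n1 (x : ℝ) (hx : s₀ ≤ x) : f x * f' x ≤ 0 := by
    have ht : Tendsto (fun s => f s * f' s) atTop (𝓝 0) := by simpa using hf.mul hf'
    refine ge_of_tendsto ht ?_
    filter_upwards [eventually_ge_atTop x] with y hy
    exact m1 hx (hx.trans hy) hy
  have hd2 (x : ℝ) : HasDerivAt (fun s => f' s ^ 2 - 4 * f s ^ 2)
      (2 * (q x - 4) * (f x * f' x)) x :=
    (((h2 x).pow 2).sub (((h1 x).pow 2).const_mul 4)).congr_deriv (by simp; ring)
  have m2 : AntitoneOn (fun s => f' s ^ 2 - 4 * f s ^ 2) (Ici s₀) :=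
    antitoneOn_of_hasDerivWithinAt_nonpos (convex_Ici _)
      (fun x _ => (hd2 x).continuousAt.continuousWithinAt) (fun x _ => (hd2 x).hasDerivWithinAt)
      fun x hx => mul_nonpos_of_nonneg_of_nonpos (by linarith [hq x (h_int hx)]) (n1 x (h_int hx))
  have n2 (x : ℝ) (hx : s₀ ≤ x) : 4 * f x ^ 2 ≤ f' x ^ 2 := by
    have ht : Tendsto (fun s => f' s ^ 2 - 4 * f s ^ 2) atTop (𝓝 0) := by
      simpa using (hf'.pow 2).sub ((hf.pow 2).const_mul 4)
    have : 0 ≤ f' x ^ 2 - 4 * f x ^ 2 := by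
      refine le_of_tendsto ht ?_
      filter_upwards [eventually_ge_atTop x] with y hy
      exact m2 hx (hx.trans hy) hy
    linarith
  have n3 (x : ℝ) (hx : s₀ ≤ x) : f x * f' x + 2 * f x ^ 2 ≤ 0 := by
    have h3 : 2 * |f x| ≤ |f' x| := by
      have := Real.sqrt_le_sqrt (n2 x hx)
      rwa [Real.sqrt_sq_eq_abs, show 4 * f x ^ 2 = (2 * f x) ^ 2 by ring, Real.sqrt_sq_eq_abs,
        abs_mul, abs_two] at this
    have h4 : |f x| * |f' x| = -(f x * f' x) := by rw [← abs_mul, abs_of_nonpos (n1 x hx)]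
    nlinarith [mul_le_mul_of_nonneg_left h3 (abs_nonneg (f x)), sq_abs (f x)]
  have hd3 (x : ℝ) : HasDerivAt (fun s => f s ^ 2 * Real.exp (4 * s))
      (2 * (f x * f' x + 2 * f x ^ 2) * Real.exp (4 * x)) x := by
    refine (((h1 x).pow 2).mul (((hasDerivAt_id x).const_mul 4).exp)).congr_deriv ?_
    simp
    ring
  have m3 : AntitoneOn (fun s => f s ^ 2 * Real.exp (4 * s)) (Ici s₀) :=
    antitoneOn_of_hasDerivWithinAt_nonpos (convex_Ici _)
      (fun x _ => (hd3 x).continuousAt.continuousWithinAt) (fun x _ => (hd3 x).hasDerivWithinAt)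
      fun x hx => mul_nonpos_of_nonpos_of_nonneg (by linarith [n3 x (h_int hx)])
        (Real.exp_pos _).le
  have h5 : f s ^ 2 * Real.exp (4 * s) ≤ f s₀ ^ 2 * Real.exp (4 * s₀) :=
    m3 (self_mem_Ici) hs hs
  refine abs_le_of_sq_le_sq' ?_ (by positivity) |> abs_le.2
  rw [mul_pow, sq_abs, ← Real.exp_nat_mul]
  have h6 : f s ^ 2 = f s ^ 2 * Real.exp (4 * s) * Real.exp (-(4 * s)) := by
    rw [mul_assoc, ← Real.exp_add]; simp
  rw [h6]
  calc _ ≤ f s₀ ^ 2 * Real.exp (4 * s₀) * Real.exp (-(4 * s)) := by gcongr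
    _ = _ := by rw [mul_assoc, ← Real.exp_add]; push_cast; ring_nf

end HermiteFunctions

section Stirling

lemma stirlingSeq_le {n : ℕ} (hn : n ≠ 0) :
    Stirling.stirlingSeq n ≤ √Real.pi * Real.exp (1 / (12 * n)) := by
  have hpos (k : ℕ) : 0 < Stirling.stirlingSeq (k + 1) := Stirling.stirlingSeq'_pos k
  have hm : Monotone fun k : ℕ =>
      Real.log (Stirling.stirlingSeq (k + 1)) - 1 / (12 * ((k + 1 : ℕ) : ℝ)) := by
    refine monotone_nat_of_le_succ fun k => ?_
    have := Stirling.log_stirlingSeq_sdiff_le (k + 1)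
    have e : (1 : ℝ) / (12 * ((k + 1 : ℕ) : ℝ) * (((k + 1 : ℕ) : ℝ) + 1))
        = 1 / (12 * ((k + 1 : ℕ) : ℝ)) - 1 / (12 * ((k + 1 + 1 : ℕ) : ℝ)) := by
      push_cast
      field_simp
      ring
    rw [e] at this
    linarith
  have ht : Tendsto (fun k : ℕ =>
      Real.log (Stirling.stirlingSeq (k + 1)) - 1 / (12 * ((k + 1 : ℕ) : ℝ))) atTop
      (𝓝 (Real.log √Real.pi - 0)) := by
    refine Tendsto.sub ?_ ?_
    · exact ((Real.continuousAt_log (by positivity)).tendsto.comp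
        Stirling.tendsto_stirlingSeq_sqrt_pi).comp (tendsto_add_atTop_nat 1)
    · have := (tendsto_one_div_atTop_nhds_zero_nat (𝕜 := ℝ)).comp (tendsto_add_atTop_nat 1)
      have h2 := this.const_mul (1 / 12)
      rw [mul_zero] at h2
      refine h2.congr fun k => ?_
      simp only [Function.comp]
      push_cast
      field_simp
  obtain ⟨k, rfl⟩ := Nat.exists_eq_succ_of_ne_zero hn
  have := hm.ge_of_tendsto ht k
  rw [← Real.log_le_log_iff (hpos k) (by positivity), Real.log_mul (by positivity) (by positivity),
    Real.log_exp]
  simp only [Nat.succ_eq_add_one]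
  linarith

end Stirling

section Edge

/-- The scaling parameters at the soft edge. -/
structure EdgeScale (n : ℕ) (ν m σ : ℝ) : Prop where
  one_le : 1 ≤ ν
  cube : ν ^ 3 = n
  m_pos : 0 < m
  m_sq : m ^ 2 = ν ^ 3 / 2
  σ_eq : σ = m / ν ^ 2

namespace EdgeScale

variable {n : ℕ} {ν m σ : ℝ}

lemma pos (h : EdgeScale n ν m σ) : 0 < ν := by linarith [h.one_le]

lemma n_ne_zero (h : EdgeScale n ν m σ) : n ≠ 0 := by
  rintro rfl
  have := h.cube
  have h2 := h.pos
  simp at this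
  exact h2.ne' this

lemma σ_pos (h : EdgeScale n ν m σ) : 0 < σ := by
  rw [h.σ_eq]; exact div_pos h.m_pos (pow_pos h.pos 2)

lemma two_m_σ (h : EdgeScale n ν m σ) : 2 * m * σ = ν := by
  have := h.pos
  rw [h.σ_eq]
  field_simp
  rw [h.m_sq]
  ring

lemma σ_sq (h : EdgeScale n ν m σ) : σ ^ 2 = 1 / (2 * ν) := by
  have := h.pos
  rw [h.σ_eq, div_pow, h.m_sq]
  field_simp

lemma sqrt_hermNormSq (h : EdgeScale n ν m σ) {k : ℕ} (hk : k ≤ 1) :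
    √(hermNormSq (n - k)) = √(hermNormSq n) / m ^ k := by
  have hm := h.m_pos
  interval_cases k
  · simp
  · obtain ⟨j, hj⟩ := Nat.exists_eq_succ_of_ne_zero h.n_ne_zero
    have hmj : √(((j : ℝ) + 1) / 2) = m := by
      rw [← Real.sqrt_sq hm.le, h.m_sq, h.cube, hj]
      push_cast
      rfl
    subst hj
    rw [Nat.succ_eq_add_one, Nat.add_sub_cancel, sqrt_hermNormSq_succ, hmj]
    field_simp

end EdgeScale

/-- The amplitude normalising the edge-scaled Hermite functions. -/
def edgeAmp (ν : ℝ) : ℝ := √√(ν / 2)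

lemma edgeAmp_pos {ν : ℝ} (hν : 0 < ν) : 0 < edgeAmp ν := by unfold edgeAmp; positivity

lemma edgeAmp_sq (ν : ℝ) : edgeAmp ν ^ 2 = √(ν / 2) := Real.sq_sqrt (Real.sqrt_nonneg _)

/-- The Stirling-type prefactor in the integral representation. -/
def stirlingFactor (n : ℕ) (ν m : ℝ) : ℝ :=
  2 * √Real.pi * edgeAmp ν * m ^ (n + 1) * Real.exp (-m ^ 2) / (ν * √(hermNormSq n))

variable {n : ℕ} {ν m σ : ℝ}

lemma stirlingFactor_sq (h : EdgeScale n ν m σ) :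
    stirlingFactor n ν m ^ 2 = √Real.pi / Stirling.stirlingSeq n := by
  have hν := h.pos
  have hm := h.m_pos
  have hnR : (0 : ℝ) < n := by rw [← h.cube]; positivity
  have e1 : √(2 * (n : ℝ)) = 2 * ν * √(ν / 2) := by
    rw [← h.cube, show 2 * ν ^ 3 = (2 * ν) ^ 2 * (ν / 2) by ring, Real.sqrt_mul (by positivity),
      Real.sqrt_sq (by positivity)]
  have e2 : (m ^ (n + 1)) ^ 2 = (n / 2) ^ n * (n / 2) := by
    rw [← pow_mul, mul_comm, pow_mul, h.m_sq, h.cube, pow_succ]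
  have e3 : Real.exp (-m ^ 2) ^ 2 = (Real.exp 1 ^ n)⁻¹ := by
    rw [← Real.exp_nat_mul, ← Real.exp_nat_mul, ← Real.exp_neg, h.m_sq, h.cube]
    congr 1
    push_cast
    ring
  have e4 : √(hermNormSq n) ^ 2 = √Real.pi * n.factorial / 2 ^ n :=
    Real.sq_sqrt (hermNormSq_pos n).le
  have e5 : √(ν / 2) ≠ 0 := by positivity
  have hpi : √Real.pi ≠ 0 := by positivity
  have hpi2 : √Real.pi ^ 2 = √Real.pi * √Real.pi := sq _
  rw [stirlingFactor, Stirling.stirlingSeq, e1, div_pow]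
  simp only [mul_pow]
  rw [edgeAmp_sq, e2, e3, e4, div_pow, div_pow]
  have hn0 := hnR.ne'
  have hk : (n : ℝ) * ν⁻¹ ^ 2 = ν := by rw [← h.cube]; field_simp
  have hS : √(ν / 2) ^ 2 = ν / 2 := Real.sq_sqrt (by positivity)
  have hf : (n.factorial : ℝ) ≠ 0 := by positivity
  field_simp
  exact h.cube.symm

lemma abs_stirlingFactor_sub_one (h : EdgeScale n ν m σ) :
    |stirlingFactor n ν m - 1| ≤ 1 / ν := by
  have hν := h.pos
  have hm := h.m_pos
  have hpos : 0 < stirlingFactor n ν m := by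
    have := edgeAmp_pos hν
    have := sqrt_hermNormSq_pos n
    unfold stirlingFactor
    positivity
  have hnR : (0 : ℝ) < n := by rw [← h.cube]; have := h.pos; positivity
  have hs1 := Stirling.sqrt_pi_le_stirlingSeq h.n_ne_zero
  have hs2 := stirlingSeq_le h.n_ne_zero
  have hp : 0 < √Real.pi := by positivity
  have hs0 : 0 < Stirling.stirlingSeq n := hp.trans_le hs1
  have hsq := stirlingFactor_sq h
  have h1 : stirlingFactor n ν m ^ 2 ≤ 1 := by rw [hsq]; exact (div_le_one hs0).2 hs1
  have h2 : 1 - 1 / (12 * n) ≤ stirlingFactor n ν m ^ 2 := by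
    have := Real.add_one_le_exp (-(1 / (12 * (n : ℝ))))
    rw [hsq, le_div_iff₀ hs0]
    calc _ ≤ Real.exp (-(1 / (12 * (n : ℝ)))) * Stirling.stirlingSeq n := by
          refine mul_le_mul_of_nonneg_right (by linarith) hs0.le
      _ ≤ Real.exp (-(1 / (12 * (n : ℝ)))) * (√Real.pi * Real.exp (1 / (12 * n))) := by gcongr
      _ = √Real.pi * (Real.exp (-(1 / (12 * (n : ℝ)))) * Real.exp (1 / (12 * n))) := by ring
      _ = _ := by rw [← Real.exp_add]; simp
  have h3 : 1 / (12 * (n : ℝ)) ≤ 1 / ν := by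
    rw [← h.cube]
    refine one_div_le_one_div_of_le hν ?_
    have := h.one_le
    nlinarith [pow_le_pow_right₀ this (show 1 ≤ 3 by norm_num)]
  rw [abs_le]
  constructor <;> nlinarith

lemma hermFun_eq_integral (h : EdgeScale n ν m σ) {k : ℕ} (hk : k ≤ 1) (s : ℝ) :
    ((edgeAmp ν * hermFun (n - k) (2 * m + σ * s) : ℝ) : ℂ)
      = ((stirlingFactor n ν m * Real.exp (s ^ 2 / (4 * ν)) : ℝ) : ℂ) *
        ((1 / (2 * Real.pi) : ℝ) * ∫ η, hermAmp n k ν η * Complex.exp (-linePt η * s)) := by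
  have hν := h.pos
  have hm := h.m_pos
  have hνc : (ν : ℂ) ≠ 0 := by exact_mod_cast hν.ne'
  have hmc : (m : ℂ) ≠ 0 := by exact_mod_cast hm.ne'
  set x := 2 * m + σ * s with hx
  have key (η : ℝ) : (((m * (1 + 2 / ν) : ℝ) : ℂ) + ((m / ν * η : ℝ) : ℂ) * Complex.I) ^ (n - k) *
      Complex.exp ((((m * (1 + 2 / ν) : ℝ) : ℂ) - x + ((m / ν * η : ℝ) : ℂ) * Complex.I) ^ 2)
      * ((Real.exp (-x ^ 2 / 2) : ℝ) : ℂ)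
      = ((m ^ (n - k) * Real.exp (-m ^ 2) * Real.exp (s ^ 2 / (4 * ν)) : ℝ) : ℂ) *
        (hermAmp n k ν η * Complex.exp (-linePt η * s)) := by
    have e1 : ((m * (1 + 2 / ν) : ℝ) : ℂ) + ((m / ν * η : ℝ) : ℂ) * Complex.I
        = m * (1 + linePt η / ν) := by
      rw [linePt]; push_cast; field_simp; ring
    have e2 : ((m * (1 + 2 / ν) : ℝ) : ℂ) - x + ((m / ν * η : ℝ) : ℂ) * Complex.I
        = m * (1 + linePt η / ν) - x := by rw [← e1]; ring
    have hm2 : (m : ℂ) ^ 2 = ν ^ 3 / 2 := by exact_mod_cast h.m_sq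
    have hms : 2 * (m : ℂ) * σ = ν := by exact_mod_cast h.two_m_σ
    have hσ2 : (σ : ℂ) ^ 2 = 1 / (2 * ν) := by exact_mod_cast h.σ_sq
    have e3 : ((m : ℂ) * (1 + linePt η / ν) - x) ^ 2 + -(x : ℂ) ^ 2 / 2
        = -m ^ 2 + s ^ 2 / (4 * ν) + (-(linePt η * ν ^ 2) + linePt η ^ 2 * ν / 2)
          + -linePt η * s := by
      have h5 : (x : ℂ) = 2 * m + σ * s := by rw [hx]; push_cast; ring
      have h6 : ((m : ℂ) * (1 + linePt η / ν) - x) ^ 2 + -(x : ℂ) ^ 2 / 2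
          = m ^ 2 * (-1 - 2 * (linePt η / ν) + (linePt η / ν) ^ 2)
            - 2 * m * σ * s * (linePt η / ν) + σ ^ 2 * s ^ 2 / 2 := by
        rw [h5]; ring
      rw [h6, hms, hσ2, hm2]
      field_simp
      ring
    rw [e1, e2, hermAmp, mul_pow]
    push_cast
    have e4 : Complex.exp ((m * (1 + linePt η / ν) - x) ^ 2) * Complex.exp (-(x : ℂ) ^ 2 / 2)
        = Complex.exp (-(m : ℂ) ^ 2) * Complex.exp ((s : ℂ) ^ 2 / (4 * ν))
          * Complex.exp (-(linePt η * ν ^ 2) + linePt η ^ 2 * ν / 2)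
          * Complex.exp (-linePt η * s) := by
      rw [← Complex.exp_add, ← Complex.exp_add, ← Complex.exp_add, ← Complex.exp_add, e3]
    linear_combination (m : ℂ) ^ (n - k) * (1 + linePt η / ν) ^ (n - k) * e4
  have hI := (herm_integral (m * (1 + 2 / ν)) x (n - k)).2
  have hsub := Measure.integral_comp_mul_left (fun y : ℝ =>
    (((m * (1 + 2 / ν) : ℝ) : ℂ) + (y : ℂ) * Complex.I) ^ (n - k) *
      Complex.exp ((((m * (1 + 2 / ν) : ℝ) : ℂ) - x + (y : ℂ) * Complex.I) ^ 2)) (m / ν)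
  rw [hI, abs_of_pos (by positivity), Complex.real_smul] at hsub
  have h7 := integral_congr_ae (μ := volume) (Eventually.of_forall key)
  rw [integral_mul_const, integral_const_mul, hsub] at h7
  have hpi : ((√Real.pi : ℝ) : ℂ) ≠ 0 := by
    exact_mod_cast (Real.sqrt_pos.2 Real.pi_pos).ne'
  have hpi2 : ((√Real.pi : ℝ) : ℂ) ^ 2 = Real.pi := by
    exact_mod_cast Real.sq_sqrt Real.pi_pos.le
  have hN : ((√(hermNormSq n) : ℝ) : ℂ) ≠ 0 := by exact_mod_cast (sqrt_hermNormSq_pos n).ne'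
  have hmk : (m : ℂ) ^ n = m ^ (n - k) * m ^ k := by
    rw [← pow_add, Nat.sub_add_cancel (hk.trans (Nat.one_le_iff_ne_zero.2 h.n_ne_zero))]
  rw [Complex.ofReal_mul, ofReal_hermFun, h.sqrt_hermNormSq hk, stirlingFactor]
  set J := ∫ η, hermAmp n k ν η * Complex.exp (-linePt η * s)
  have h8 : (herm (n - k)).eval (x : ℂ) * ((Real.exp (-x ^ 2 / 2) : ℝ) : ℂ)
      = (m / ν) / (√Real.pi : ℝ) * (m ^ (n - k) * (Real.exp (-m ^ 2) : ℝ)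
        * (Real.exp (s ^ 2 / (4 * ν)) : ℝ)) * J := by
    push_cast at h7 ⊢
    field_simp at h7 ⊢
    linear_combination h7
  rw [h8]
  push_cast
  rw [pow_succ (m : ℂ) n, hmk, ← hpi2]
  field_simp

lemma continuous_hermAmp (n k : ℕ) (ν : ℝ) : Continuous (hermAmp n k ν) := by
  unfold hermAmp; fun_prop

lemma edge_sub_airy_le_of_sq_le : ∃ C, 0 ≤ C ∧ ∀ (n : ℕ) (ν m σ : ℝ), EdgeScale n ν m σ →
    ∀ k ≤ 1, ∀ s : ℝ, s ^ 2 ≤ ν →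
    ‖((edgeAmp ν * hermFun (n - k) (2 * m + σ * s) : ℝ) : ℂ) - airyC 0 s‖
      ≤ C / ν * ((1 + s ^ 2) * Real.exp (-2 * s)) := by
  obtain ⟨D, hD0, hD⟩ := hermAmp_sub_cubicExp_le
  obtain ⟨B, hB⟩ := norm_airyC_le 0
  have hB0 : 0 ≤ B := nonneg_of_mul_nonneg_left ((norm_nonneg _).trans (hB 0)) (Real.exp_pos _)
  set D' := ‖((1 / (2 * Real.pi) : ℝ) : ℂ)‖ * (D * √(Real.pi / (1 / 3))) with hD'
  have hD'0 : 0 ≤ D' := by positivity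
  refine ⟨4 * D' + 2 * B, by positivity, fun n ν m σ h k hk s hs => ?_⟩
  have hν := h.pos
  rw [hermFun_eq_integral h hk]
  set Γ := stirlingFactor n ν m * Real.exp (s ^ 2 / (4 * ν)) with hΓ
  set I := ((1 / (2 * Real.pi) : ℝ) : ℂ) * ∫ η, hermAmp n k ν η * Complex.exp (-linePt η * s)
    with hI
  have hamp : GaussBound (fun η => hermAmp n k ν η - cubicExp η) (1 / 3) :=
    ⟨(continuous_hermAmp n k ν).sub gaussBound_cubicExp.1, _, hD n ν h.one_le h.cube k hk⟩
  have hIB : ‖I - airyC 0 s‖ ≤ D' / ν * Real.exp (-2 * s) := by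
    have i1 := (hamp.mul_exp s).integrable (by norm_num)
    have i2 := (gaussBound_cubicExp.mul_exp s).integrable two_pos
    have e : I - airyC 0 s = ((1 / (2 * Real.pi) : ℝ) : ℂ) *
        ∫ η, (hermAmp n k ν η - cubicExp η) * Complex.exp (-linePt η * s) := by
      have e2 : ∫ η, hermAmp n k ν η * Complex.exp (-linePt η * s)
          = (∫ η, (hermAmp n k ν η - cubicExp η) * Complex.exp (-linePt η * s))
            + ∫ η, cubicExp η * Complex.exp (-linePt η * s) := by
        rw [← integral_add i1 i2]
        congr 1
        funext η
        ring
      rw [hI, e2, airyC]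
      simp only [pow_zero, one_mul]
      ring
    rw [e, norm_mul]
    have := norm_line_integral_le (by norm_num) (hD n ν h.one_le h.cube k hk) s
    calc _ ≤ ‖((1 / (2 * Real.pi) : ℝ) : ℂ)‖ *
          (D / ν * √(Real.pi / (1 / 3)) * Real.exp (-2 * s)) := by gcongr
      _ = _ := by rw [hD']; ring
  have hΓ1 : |Γ - 1| ≤ (2 + s ^ 2) / ν := by
    have h1 := abs_stirlingFactor_sub_one h
    have hq0 : 0 ≤ s ^ 2 / (4 * ν) := by positivity
    have hq1 : s ^ 2 / (4 * ν) ≤ 1 / 4 := by rw [div_le_iff₀ (by positivity)]; linarith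
    have h2 := Real.abs_exp_sub_one_le (x := s ^ 2 / (4 * ν))
      (by rw [abs_of_nonneg hq0]; linarith)
    rw [abs_of_nonneg hq0] at h2
    have h3 : Real.exp (s ^ 2 / (4 * ν)) ≤ 2 := by linarith [(abs_le.1 h2).2]
    have e : Γ - 1 = (stirlingFactor n ν m - 1) * Real.exp (s ^ 2 / (4 * ν))
        + (Real.exp (s ^ 2 / (4 * ν)) - 1) := by rw [hΓ]; ring
    rw [e]
    calc _ ≤ |(stirlingFactor n ν m - 1) * Real.exp (s ^ 2 / (4 * ν))|
          + |Real.exp (s ^ 2 / (4 * ν)) - 1| := abs_add_le _ _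
      _ ≤ 1 / ν * 2 + 2 * (s ^ 2 / (4 * ν)) := by
          rw [abs_mul, abs_of_pos (Real.exp_pos _)]
          gcongr
      _ ≤ (2 + s ^ 2) / ν := by
          have : 0 ≤ s ^ 2 / ν := by positivity
          have e3 : 1 / ν * 2 + 2 * (s ^ 2 / (4 * ν)) = (2 + s ^ 2) / ν - s ^ 2 / ν / 2 := by
            field_simp; ring
          rw [e3]; linarith
  have hΓ4 : |Γ| ≤ 4 := by
    have h1 : (2 + s ^ 2) / ν ≤ 3 := by
      rw [div_le_iff₀ hν]; linarith [h.one_le]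
    have h2 := abs_add_le (Γ - 1) 1
    rw [sub_add_cancel, abs_one] at h2
    linarith
  have e : (Γ : ℂ) * I - airyC 0 s = Γ * (I - airyC 0 s) + ((Γ - 1 : ℝ) : ℂ) * airyC 0 s := by
    push_cast; ring
  rw [e]
  calc _ ≤ ‖(Γ : ℂ) * (I - airyC 0 s)‖ + ‖((Γ - 1 : ℝ) : ℂ) * airyC 0 s‖ := norm_add_le _ _
    _ = |Γ| * ‖I - airyC 0 s‖ + |Γ - 1| * ‖airyC 0 s‖ := by
        rw [norm_mul, norm_mul, Complex.norm_real, Complex.norm_real, Real.norm_eq_abs,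
          Real.norm_eq_abs]
    _ ≤ 4 * (D' / ν * Real.exp (-2 * s)) + (2 + s ^ 2) / ν * (B * Real.exp (-2 * s)) := by
        have := hB s
        gcongr
    _ = (4 * D' + (2 + s ^ 2) * B) * (1 / ν * Real.exp (-2 * s)) := by ring
    _ ≤ ((4 * D' + 2 * B) * (1 + s ^ 2)) * (1 / ν * Real.exp (-2 * s)) := by
        refine mul_le_mul_of_nonneg_right ?_ (by positivity)
        nlinarith [sq_nonneg s, mul_nonneg hD'0 (sq_nonneg s), mul_nonneg hB0 (sq_nonneg s)]
    _ = _ := by ring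

lemma one_add_sq_mul_exp_le {t s : ℝ} (hs : t ≤ s) :
    (1 + s ^ 2) * Real.exp (-2 * s) ≤ (2 + (1 + t ^ 2) * Real.exp (-t)) * Real.exp (-s) := by
  rw [show -2 * s = -s + -s by ring, Real.exp_add, ← mul_assoc]
  refine mul_le_mul_of_nonneg_right ?_ (Real.exp_pos _).le
  have h0 : 0 ≤ (1 + t ^ 2) * Real.exp (-t) := by positivity
  rcases le_or_gt 0 s with h | h
  · have h1 := Real.quadratic_le_exp_of_nonneg h
    have : (1 + s ^ 2) * Real.exp (-s) ≤ 2 := by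
      rw [Real.exp_neg, ← div_eq_mul_inv, div_le_iff₀ (Real.exp_pos _)]
      linarith
    linarith
  · have : (1 + s ^ 2) * Real.exp (-s) ≤ (1 + t ^ 2) * Real.exp (-t) := by
      gcongr ?_ * ?_
      · nlinarith
      · exact Real.exp_le_exp.2 (by linarith)
    linarith

lemma tendsto_hermFun (n : ℕ) (a : ℝ) {σ : ℝ} (hσ : 0 < σ) :
    Tendsto (fun s => hermFun n (a + σ * s)) atTop (𝓝 0) := by
  have := (Complex.continuous_re.tendsto 0).comp (expDecay_hermFun n a hσ).tendsto
  simpa [Function.comp_def] using this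

lemma tendsto_mul_hermFun (n : ℕ) (a : ℝ) {σ : ℝ} (hσ : 0 < σ) :
    Tendsto (fun s => (a + σ * s) * hermFun n (a + σ * s)) atTop (𝓝 0) := by
  have := (Complex.continuous_re.tendsto 0).comp
    (((expDecay_eval_mul_exp (X * herm n) a hσ).const_mul ((√(hermNormSq n) : ℝ) : ℂ)⁻¹).tendsto)
  rw [Complex.zero_re] at this
  refine this.congr fun s => ?_
  rw [← Complex.ofReal_re ((a + σ * s) * hermFun n (a + σ * s))]
  simp only [Function.comp]
  congr 1
  rw [Complex.ofReal_mul, ofReal_hermFun, eval_mul, eval_X]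
  ring

lemma abs_edge_le_exp (h : EdgeScale n ν m σ) {k : ℕ} (hk : k ≤ 1) {s : ℝ} (hs : 5 ≤ s) :
    |edgeAmp ν * hermFun (n - k) (2 * m + σ * s)|
      ≤ |edgeAmp ν * hermFun (n - k) (2 * m + σ * 5)| * Real.exp (-2 * (s - 5)) := by
  have hν := h.pos
  have hσ := h.σ_pos
  have haff (s : ℝ) : HasDerivAt (fun s => 2 * m + σ * s) σ s := by
    simpa using ((hasDerivAt_id s).const_mul σ).const_add (2 * m)
  refine abs_le_exp_of_ode (f := fun s => edgeAmp ν * hermFun (n - k) (2 * m + σ * s))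
    (f' := fun s => edgeAmp ν * (((2 * m + σ * s) * hermFun (n - k) (2 * m + σ * s)
      - 2 * √(((n - k : ℕ) + 1) / 2) * hermFun (n - k + 1) (2 * m + σ * s)) * σ))
    (q := fun s => σ ^ 2 * ((2 * m + σ * s) ^ 2 - (2 * ((n - k : ℕ) : ℝ) + 1)))
    (fun s => ((hasDerivAt_hermFun _ _).comp s (haff s)).const_mul _)
    (fun s => ?_) (fun s hs => ?_) ?_ ?_ hs
  · refine ((((hasDerivAt_deriv_hermFun _ _).comp s (haff s)).mul_const σ).const_mul
      (edgeAmp ν)).congr_deriv ?_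
    ring
  · have e : σ ^ 2 * ((2 * m + σ * s) ^ 2 - (2 * ((n - k : ℕ) : ℝ) + 1))
        = s + s ^ 2 / (4 * ν ^ 2) + (2 * k - 1) / (2 * ν) := by
      have hkn : k ≤ n := hk.trans (Nat.one_le_iff_ne_zero.2 h.n_ne_zero)
      have e1 : (2 * m + σ * s) ^ 2 = 4 * m ^ 2 + 2 * (2 * m * σ) * s + σ ^ 2 * s ^ 2 := by ring
      rw [e1, h.two_m_σ, h.m_sq, h.σ_sq, Nat.cast_sub hkn, ← h.cube]
      field_simp
      ring
    simp only [e]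
    have h1 : 0 ≤ s ^ 2 / (4 * ν ^ 2) := by positivity
    have h2 : -(1 / 2) ≤ (2 * (k : ℝ) - 1) / (2 * ν) := by
      rw [le_div_iff₀ (by positivity)]
      have : (0 : ℝ) ≤ k := k.cast_nonneg
      nlinarith [h.one_le]
    linarith
  · simpa using (tendsto_hermFun (n - k) (2 * m) hσ).const_mul (edgeAmp ν)
  · have := (((tendsto_mul_hermFun (n - k) (2 * m) hσ).sub
      ((tendsto_hermFun (n - k + 1) (2 * m) hσ).const_mul
        (2 * √(((n - k : ℕ) + 1) / 2)))).mul_const σ).const_mul (edgeAmp ν)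
    simpa using this

/-- Plancherel–Rotach asymptotics at the soft edge, uniformly up to `+∞`. -/
theorem edge_sub_airy_le (t : ℝ) : ∃ C ν₀, 0 ≤ C ∧ ∀ (n : ℕ) (ν m σ : ℝ), EdgeScale n ν m σ →
    ν₀ ≤ ν → ∀ k ≤ 1, ∀ s : ℝ, t ≤ s →
    ‖((edgeAmp ν * hermFun (n - k) (2 * m + σ * s) : ℝ) : ℂ) - airyC 0 s‖
      ≤ C / ν * Real.exp (-s) := by
  obtain ⟨C, hC0, hC⟩ := edge_sub_airy_le_of_sq_le
  obtain ⟨B, hB⟩ := norm_airyC_le 0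
  have hB0 : 0 ≤ B := nonneg_of_mul_nonneg_left ((norm_nonneg _).trans (hB 0)) (Real.exp_pos _)
  set K := (B + C * 26) * Real.exp 10 + B with hK
  have hK0 : 0 ≤ K := by positivity
  set M := 2 + (1 + t ^ 2) * Real.exp (-t) with hM
  have hM0 : 0 ≤ M := by positivity
  refine ⟨C * M + 2 * K, t ^ 2 + 25, by positivity, fun n ν m σ h hν0 k hk s hs => ?_⟩
  have hν := h.pos
  rcases le_or_gt (s ^ 2) ν with hsν | hsν
  · refine (hC n ν m σ h k hk s hsν).trans ?_
    calc _ ≤ C / ν * (M * Real.exp (-s)) :=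
          mul_le_mul_of_nonneg_left (one_add_sq_mul_exp_le hs) (by positivity)
      _ = C * M / ν * Real.exp (-s) := by ring
      _ ≤ _ := by gcongr; linarith
  · have hs0 : 0 < s := by
      by_contra hcon
      nlinarith
    have hs5 : 5 ≤ s := by nlinarith [sq_nonneg t]
    have h5 := hC n ν m σ h k hk 5 (by nlinarith [sq_nonneg t])
    have e5 : |edgeAmp ν * hermFun (n - k) (2 * m + σ * 5)| ≤ B + C * 26 := by
      have h6 := norm_le_norm_add_norm_sub'
        (((edgeAmp ν * hermFun (n - k) (2 * m + σ * 5) : ℝ) : ℂ)) (airyC 0 5)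
      rw [Complex.norm_real, Real.norm_eq_abs] at h6
      have h7 : Real.exp (-2 * 5) ≤ 1 := Real.exp_le_one_iff.2 (by norm_num)
      have h8 : B * Real.exp (-2 * 5) ≤ B := mul_le_of_le_one_right hB0 h7
      have h9 : C / ν * ((1 + 5 ^ 2) * Real.exp (-2 * 5)) ≤ C * 26 := by
        have : C / ν ≤ C := div_le_self hC0 h.one_le
        have h10 : (1 + (5 : ℝ) ^ 2) * Real.exp (-2 * 5) ≤ 26 := by linarith
        gcongr
      linarith [hB 5]
    have h11 : ‖((edgeAmp ν * hermFun (n - k) (2 * m + σ * s) : ℝ) : ℂ) - airyC 0 s‖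
        ≤ K * Real.exp (-2 * s) := by
      refine (norm_sub_le _ _).trans ?_
      rw [Complex.norm_real, Real.norm_eq_abs]
      have h12 := abs_edge_le_exp h hk hs5
      calc _ ≤ (B + C * 26) * Real.exp (-2 * (s - 5)) + B * Real.exp (-2 * s) := by
            refine add_le_add (h12.trans ?_) (hB s)
            gcongr
        _ = _ := by
            rw [show -2 * (s - 5) = 10 + -2 * s by ring, Real.exp_add, hK]; ring
    have h13 : Real.exp (-s) ≤ 2 / ν := by
      have h14 := Real.quadratic_le_exp_of_nonneg hs0.le
      rw [Real.exp_neg, inv_le_comm₀ (Real.exp_pos _) (by positivity), inv_div]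
      linarith
    refine h11.trans ?_
    calc _ = K * (Real.exp (-s) * Real.exp (-s)) := by rw [← Real.exp_add]; ring_nf
      _ ≤ K * (2 / ν * Real.exp (-s)) := by gcongr
      _ = 2 * K / ν * Real.exp (-s) := by ring
      _ ≤ _ := by
          gcongr
          linarith [mul_nonneg hC0 hM0]

end Edge

section OrthogonalPolynomials

/-- A moment functional is regular if `p ↦ L (p * conj p)` does not vanish off `p = 0`. -/
def RegularFunctional (L : ℂ[X] →ₗ[ℂ] ℂ) : Prop :=
  ∀ p : ℂ[X], p ≠ 0 → L (p * p.map (starRingEnd ℂ)) ≠ 0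

/-- `p` is monic of degree `n` and orthogonal to lower-degree polynomials. -/
def IsMonicOrth (L : ℂ[X] →ₗ[ℂ] ℂ) (n : ℕ) (p : ℂ[X]) : Prop :=
  p.Monic ∧ p.natDegree = n ∧ ∀ q : ℂ[X], q.degree < n → L (p * q) = 0

variable {L : ℂ[X] →ₗ[ℂ] ℂ}

lemma RegularFunctional.eq_zero (hL : RegularFunctional L) {n : ℕ} {p : ℂ[X]} (hp : p.degree < n)
    (h : ∀ q : ℂ[X], q.degree < n → L (p * q) = 0) : p = 0 := by
  by_contra hp0
  exact hL p hp0 (h _ (by rwa [Polynomial.degree_map]))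

lemma map_mul_eq_zero_of_monomials {n : ℕ} {p : ℂ[X]} (h : ∀ m < n, L (p * X ^ m) = 0)
    {q : ℂ[X]} (hq : q.degree < n) : L (p * q) = 0 := by
  by_cases hq0 : q = 0
  · simp [hq0]
  rw [q.as_sum_range_C_mul_X_pow' ((Polynomial.natDegree_lt_iff_degree_lt hq0).2 hq),
    Finset.mul_sum, map_sum]
  refine Finset.sum_eq_zero fun m hm => ?_
  rw [mul_left_comm, ← Polynomial.smul_eq_C_mul, map_smul, h m (Finset.mem_range.1 hm), smul_zero]

lemma RegularFunctional.det_ne_zero (hL : RegularFunctional L) (n : ℕ) :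
    (Matrix.of fun j k : Fin n => L (X ^ ((j : ℕ) + (k : ℕ)))).det ≠ 0 := by
  intro h0
  obtain ⟨v, hv0, hv⟩ := Matrix.exists_mulVec_eq_zero_iff.2 h0
  set p : ℂ[X] := ∑ k : Fin n, C (v k) * X ^ (k : ℕ) with hp
  have hpd : p.degree < n := by
    refine (Polynomial.degree_sum_le _ _).trans_lt ?_
    rw [Finset.sup_lt_iff (by exact WithBot.bot_lt_coe n)]
    intro k _
    exact (Polynomial.degree_C_mul_X_pow_le _ _).trans_lt (by exact_mod_cast k.2)
  have hp0 : p = 0 := by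
    refine hL.eq_zero hpd fun q hq => map_mul_eq_zero_of_monomials (fun m hm => ?_) hq
    have := congrFun hv ⟨m, hm⟩
    simp only [Matrix.mulVec, dotProduct, Matrix.of_apply, Pi.zero_apply] at this
    rw [hp, Finset.sum_mul, map_sum, ← this]
    refine Finset.sum_congr rfl fun k _ => ?_
    rw [mul_assoc, ← pow_add, ← Polynomial.smul_eq_C_mul, map_smul, smul_eq_mul, mul_comm,
      add_comm]
  refine hv0 (funext fun k => ?_)
  have := congrArg (fun q : ℂ[X] => q.coeff k) hp0
  simp only [hp, Polynomial.finsetSum_coeff, Polynomial.coeff_C_mul, Polynomial.coeff_X_pow,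
    Fin.val_inj, mul_ite, mul_one, mul_zero, Finset.sum_ite_eq, Finset.mem_univ, if_true,
    Polynomial.coeff_zero] at this
  exact this

lemma RegularFunctional.exists_monicOrth (hL : RegularFunctional L) (n : ℕ) :
    ∃ p, IsMonicOrth L n p := by
  let T : Polynomial.degreeLT ℂ n →ₗ[ℂ] (Fin n → ℂ) :=
    LinearMap.pi fun j => L ∘ₗ LinearMap.mulRight ℂ (X ^ (j : ℕ)) ∘ₗ
      (Polynomial.degreeLT ℂ n).subtype
  have hTapp (q : Polynomial.degreeLT ℂ n) (j : Fin n) : T q j = L ((q : ℂ[X]) * X ^ (j : ℕ)) := rfl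
  have hinj : Function.Injective T := by
    rw [← LinearMap.ker_eq_bot, LinearMap.ker_eq_bot']
    intro q hq
    refine Subtype.ext (hL.eq_zero (Polynomial.mem_degreeLT.1 q.2) fun r hr =>
      map_mul_eq_zero_of_monomials (fun m hm => ?_) hr)
    exact congrFun hq ⟨m, hm⟩
  have hfin : Module.finrank ℂ (Polynomial.degreeLT ℂ n) = Module.finrank ℂ (Fin n → ℂ) :=
    (Polynomial.degreeLTEquiv ℂ n).finrank_eq
  have : FiniteDimensional ℂ (Polynomial.degreeLT ℂ n) :=
    Module.Finite.equiv (Polynomial.degreeLTEquiv ℂ n).symm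
  obtain ⟨q, hq⟩ := (LinearMap.injective_iff_surjective_of_finrank_eq_finrank hfin).1 hinj
    (fun j => L (X ^ n * X ^ (j : ℕ)))
  have hqd : (q : ℂ[X]).degree < n := Polynomial.mem_degreeLT.1 q.2
  have hqd' : (q : ℂ[X]).degree < (X ^ n : ℂ[X]).degree := by rwa [Polynomial.degree_X_pow]
  refine ⟨X ^ n - (q : ℂ[X]), (Polynomial.monic_X_pow n).sub_of_left hqd', ?_, fun r hr =>
    map_mul_eq_zero_of_monomials (fun m hm => ?_) hr⟩
  · rw [Polynomial.natDegree_eq_of_degree_eq (Polynomial.degree_sub_eq_left_of_degree_lt hqd'),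
      Polynomial.natDegree_X_pow]
  · rw [sub_mul, map_sub, ← congrFun hq ⟨m, hm⟩, hTapp, sub_self]

lemma IsMonicOrth.degree_eq {n : ℕ} {p : ℂ[X]} (hp : IsMonicOrth L n p) : p.degree = n := by
  rw [Polynomial.degree_eq_natDegree hp.1.ne_zero, hp.2.1]

lemma degree_sub_C_mul_lt {n : ℕ} {p q : ℂ[X]} (hp : p.Monic) (hpn : p.natDegree = n)
    (hq : q.degree < ((n + 1 : ℕ) : WithBot ℕ)) : (q - C (q.coeff n) * p).degree < n := by
  rw [Polynomial.degree_lt_iff_coeff_zero] at hq ⊢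
  intro m hm
  rcases hm.eq_or_lt with rfl | hm
  · have : p.coeff n = 1 := by rw [← hpn]; exact hp
    simp [this]
  · rw [Polynomial.coeff_sub, Polynomial.coeff_C_mul, hq m hm,
      Polynomial.coeff_eq_zero_of_natDegree_lt (show p.natDegree < m by omega)]
    simp

/-- Pairing `p_n` with a polynomial of degree at most `n` reads off the top coefficient. -/
lemma IsMonicOrth.map_mul {n : ℕ} {p q : ℂ[X]} (hp : IsMonicOrth L n p)
    (hq : q.degree < ((n + 1 : ℕ) : WithBot ℕ)) : L (p * q) = q.coeff n * L (p * p) := by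
  have h := hp.2.2 _ (degree_sub_C_mul_lt hp.1 hp.2.1 hq)
  rw [mul_sub, map_sub, mul_left_comm, ← Polynomial.smul_eq_C_mul, map_smul, smul_eq_mul,
    sub_eq_zero] at h
  exact h

lemma IsMonicOrth.norm_ne_zero (hL : RegularFunctional L) {n : ℕ} {p : ℂ[X]}
    (hp : IsMonicOrth L n p) : L (p * p) ≠ 0 := by
  intro h
  refine hp.1.ne_zero (hL.eq_zero (n := n + 1) ?_ fun q hq => ?_)
  · rw [hp.degree_eq]; exact_mod_cast n.lt_succ_self
  · rw [hp.map_mul hq, h, mul_zero]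

lemma IsMonicOrth.coeff_self {n : ℕ} {p : ℂ[X]} (hp : IsMonicOrth L n p) : p.coeff n = 1 := by
  have := hp.1
  rwa [Polynomial.Monic, Polynomial.leadingCoeff, hp.2.1] at this

lemma degree_X_mul_lt {q : ℂ[X]} {n : ℕ} (hq : q.degree < n) : (X * q).degree < ((n + 1 : ℕ) : WithBot ℕ) := by
  rw [Polynomial.degree_lt_iff_coeff_zero] at hq ⊢
  intro m hm
  obtain ⟨k, rfl⟩ : ∃ k, m = k + 1 := ⟨m - 1, by omega⟩
  rw [Polynomial.coeff_X_mul]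
  exact hq k (by omega)

/-- The three-term recurrence. -/
lemma RegularFunctional.recurrence (hL : RegularFunctional L) {n : ℕ} {pm pn pp : ℂ[X]}
    (hm : IsMonicOrth L n pm) (hn : IsMonicOrth L (n + 1) pn) (hp : IsMonicOrth L (n + 2) pp) :
    ∃ Q : ℂ, X * pn = pp + C Q * pn + C (L (pn * pn) / L (pm * pm)) * pm := by
  set r := X * pn - pp with hr
  have hrd : r.degree < ((n + 1 + 1 : ℕ) : WithBot ℕ) := by
    have h1 : (X * pn).degree < ((n + 1 + 1 + 1 : ℕ) : WithBot ℕ) := degree_X_mul_lt (by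
      rw [hn.degree_eq]; exact_mod_cast Nat.lt_succ_self _)
    have h2 := degree_sub_C_mul_lt hp.1 hp.2.1 h1
    rwa [Polynomial.coeff_X_mul, hn.coeff_self, C_1, one_mul] at h2
  set Q := r.coeff (n + 1)
  have h1 := degree_sub_C_mul_lt hn.1 hn.2.1 hrd
  set s := r - C Q * pn with hs
  set R := s.coeff n
  have h2 := degree_sub_C_mul_lt hm.1 hm.2.1 h1
  have hd : s - C R * pm = 0 := by
    refine hL.eq_zero h2 fun q hq => ?_
    have hq1 : q.degree < ((n + 1 : ℕ) : WithBot ℕ) := hq.trans (by exact_mod_cast Nat.lt_succ_self _)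
    have hq2 : q.degree < ((n + 2 : ℕ) : WithBot ℕ) := hq1.trans (by exact_mod_cast Nat.lt_succ_self _)
    have e : (s - C R * pm) * q
        = pn * (X * q) - pp * q - Q • (pn * q) - R • (pm * q) := by
      simp only [hs, hr, Polynomial.smul_eq_C_mul]; ring
    rw [e]
    simp only [map_sub, map_smul]
    rw [hn.2.2 _ (degree_X_mul_lt hq), hp.2.2 _ hq2, hn.2.2 _ hq1, hm.2.2 _ hq]
    simp
  have hrec : X * pn = pp + C Q * pn + C R * pm := by
    linear_combination hd
  have hpm1 : pm.degree < ((n + 1 : ℕ) : WithBot ℕ) := by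
    rw [hm.degree_eq]; exact_mod_cast Nat.lt_succ_self _
  have hR : L (pn * pn) = R * L (pm * pm) := by
    have h := hn.map_mul (degree_X_mul_lt hpm1)
    rw [Polynomial.coeff_X_mul, hm.coeff_self, one_mul] at h
    have e : pn * (X * pm) = pp * pm + Q • (pn * pm) + R • (pm * pm) := by
      simp only [Polynomial.smul_eq_C_mul]
      linear_combination pm * hrec
    rw [e] at h
    simp only [map_add, map_smul] at h
    rw [hp.2.2 _ (hpm1.trans (by exact_mod_cast Nat.lt_succ_self _)), hn.2.2 _ hpm1] at h
    rw [← h]; simp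
  refine ⟨Q, ?_⟩
  rw [hR, mul_div_cancel_right₀ _ (hm.norm_ne_zero hL)]
  exact hrec

lemma recurrence_unique {n : ℕ} {pm pn pp : ℂ[X]}
    (hm : IsMonicOrth L n pm) (hn : IsMonicOrth L (n + 1) pn) {Q R Q' R' : ℂ}
    (h : X * pn = pp + C Q * pn + C R * pm) (h' : X * pn = pp + C Q' * pn + C R' * pm) :
    Q' = Q ∧ R' = R := by
  have e : C (Q' - Q) * pn + C (R' - R) * pm = 0 := by
    simp only [map_sub]
    linear_combination h - h'
  have hQ : Q' - Q = 0 := by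
    have := congrArg (fun p : ℂ[X] => p.coeff (n + 1)) e
    have h0 : pm.coeff (n + 1) = 0 :=
      Polynomial.coeff_eq_zero_of_natDegree_lt (by rw [hm.2.1]; omega)
    simpa [hn.coeff_self, h0, -map_sub] using this
  have hR : R' - R = 0 := by
    have := congrArg (fun p : ℂ[X] => p.coeff n) e
    simpa [hQ, hm.coeff_self, -map_sub] using this
  exact ⟨sub_eq_zero.1 hQ, sub_eq_zero.1 hR⟩

/-- The integration-by-parts identity behind the string equation. -/
lemma IsMonicOrth.map_parts {n : ℕ} {pm pn : ℂ[X]}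
    (hm : IsMonicOrth L n pm) (hn : IsMonicOrth L (n + 1) pn) :
    L ((pn * pm).derivative - 2 * X * (pn * pm))
      = ((n + 1 : ℕ) : ℂ) * L (pm * pm) - 2 * L (pn * pn) := by
  have hpm1 : pm.degree < ((n + 1 : ℕ) : WithBot ℕ) := by
    rw [hm.degree_eq]; exact_mod_cast Nat.lt_succ_self _
  have e : (pn * pm).derivative - 2 * X * (pn * pm)
      = pm * pn.derivative + pn * pm.derivative - (2 : ℂ) • (pn * (X * pm)) := by
    rw [Polynomial.derivative_mul, Polynomial.smul_eq_C_mul]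
    simp only [map_ofNat]
    ring
  have h1 : pn.derivative.degree < ((n + 1 : ℕ) : WithBot ℕ) := by
    have := Polynomial.degree_derivative_lt hn.1.ne_zero
    rwa [hn.degree_eq] at this
  have h2 : pm.derivative.degree < ((n + 1 : ℕ) : WithBot ℕ) :=
    (Polynomial.degree_derivative_lt hm.1.ne_zero).trans hpm1
  rw [e, map_sub, map_add, map_smul, hm.map_mul h1, hn.2.2 _ h2, hn.map_mul (degree_X_mul_lt hpm1),
    Polynomial.coeff_X_mul, hm.coeff_self, Polynomial.coeff_derivative, hn.coeff_self]
  push_cast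
  simp

end OrthogonalPolynomials

section JumpWeight

variable (l : ℝ) (β : ℂ)

lemma integrable_eval_mul_w (p : ℂ[X]) : Integrable fun x : ℝ => p.eval (x : ℂ) * w l β x := by
  have h : ∀ c : ℂ, Integrable fun x : ℝ => p.eval (x : ℂ) * ((Real.exp (-x ^ 2) : ℝ) : ℂ) * c :=
    fun c => (integrable_eval_mul_exp p).mul_const c
  refine (Integrable.piecewise (s := Iio l) measurableSet_Iio
    (h (Complex.exp (Real.pi * Complex.I * β))).integrableOn
    (h (Complex.exp (-(Real.pi * Complex.I * β)))).integrableOn).congr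
    (Eventually.of_forall fun x => ?_)
  by_cases hx : x < l
  · simp [Set.piecewise, hx, w, mul_assoc]
  · simp [Set.piecewise, hx, w, mul_assoc]

/-- The moment functional of the weight `w(·; l, β)`. -/
def jumpFunctional : ℂ[X] →ₗ[ℂ] ℂ where
  toFun p := ∫ x : ℝ, p.eval (x : ℂ) * w l β x
  map_add' p q := by
    rw [← integral_add (integrable_eval_mul_w l β p) (integrable_eval_mul_w l β q)]
    simp [add_mul]
  map_smul' c p := by
    rw [RingHom.id_apply, smul_eq_mul, ← integral_const_mul]
    simp [mul_assoc]

lemma jumpFunctional_apply (p : ℂ[X]) :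
    jumpFunctional l β p = ∫ x : ℝ, p.eval (x : ℂ) * w l β x := rfl

lemma eval_map_conj (p : ℂ[X]) (x : ℝ) :
    (p.map (starRingEnd ℂ)).eval (x : ℂ) = (starRingEnd ℂ) (p.eval (x : ℂ)) := by
  have := Polynomial.hom_eval₂ p (RingHom.id ℂ) (starRingEnd ℂ) (x : ℂ)
  rw [Polynomial.eval_map]
  rw [Polynomial.eval, this, Complex.conj_ofReal]
  rfl

variable {β}

lemma exp_jump_re_pos (hβ : |β.re| < 1 / 2) :
    0 < (Complex.exp (Real.pi * Complex.I * β)).re ∧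
      0 < (Complex.exp (-(Real.pi * Complex.I * β))).re := by
  have hc : 0 < Real.cos (Real.pi * β.re) := by
    have h := abs_lt.1 hβ
    refine Real.cos_pos_of_mem_Ioo ⟨?_, ?_⟩ <;> nlinarith [Real.pi_pos]
  constructor <;> rw [Complex.exp_re]
  · refine mul_pos (Real.exp_pos _) ?_
    simpa using hc
  · refine mul_pos (Real.exp_pos _) ?_
    simpa using hc

lemma w_re_pos (hβ : |β.re| < 1 / 2) (x : ℝ) : 0 < (w l β x).re := by
  rw [w, Complex.re_ofReal_mul]
  refine mul_pos (Real.exp_pos _) ?_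
  split_ifs
  · exact (exp_jump_re_pos hβ).1
  · exact (exp_jump_re_pos hβ).2

lemma regular_jumpFunctional (hβ : |β.re| < 1 / 2) : RegularFunctional (jumpFunctional l β) := by
  intro p hp h0
  have hi := integrable_eval_mul_w l β (p * p.map (starRingEnd ℂ))
  have he : ∀ x : ℝ, ((p * p.map (starRingEnd ℂ)).eval (x : ℂ) * w l β x).re
      = Complex.normSq (p.eval (x : ℂ)) * (w l β x).re := by
    intro x
    rw [Polynomial.eval_mul, eval_map_conj, Complex.mul_conj, Complex.re_ofReal_mul]
  have hre : ∫ x : ℝ, Complex.normSq (p.eval (x : ℂ)) * (w l β x).re = 0 := by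
    have := congrArg Complex.re h0
    rw [jumpFunctional_apply, ← RCLike.re_eq_complex_re, ← integral_re hi] at this
    simp only [RCLike.re_eq_complex_re, he] at this
    simpa using this
  have hi' : Integrable fun x : ℝ => Complex.normSq (p.eval (x : ℂ)) * (w l β x).re := by
    refine hi.re.congr (Eventually.of_forall fun x => ?_)
    simp only [RCLike.re_eq_complex_re, he]
  rw [integral_eq_zero_iff_of_nonneg
    (fun x => mul_nonneg (Complex.normSq_nonneg _) (w_re_pos l hβ x).le) hi'] at hre
  have hz : (fun x : ℝ => p.eval (x : ℂ)) = fun _ => 0 := by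
    refine (Continuous.ae_eq_iff_eq (μ := volume) (by fun_prop) (by fun_prop)).1 ?_
    filter_upwards [hre] with x hx
    have := (mul_eq_zero.1 hx).resolve_right (w_re_pos l hβ x).ne'
    exact Complex.normSq_eq_zero.1 this
  refine hp (Polynomial.eq_zero_of_infinite_isRoot p ?_)
  refine (Set.infinite_range_of_injective Complex.ofReal_injective).mono ?_
  rintro _ ⟨x, rfl⟩
  exact congrFun hz x

variable (β)

/-- The part of the Gaussian integral above the jump. -/
def tailI (p : ℂ[X]) : ℂ :=
  ∫ x in Ioi l, p.eval (x : ℂ) * ((Real.exp (-x ^ 2) : ℝ) : ℂ)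

lemma jumpFunctional_split (p : ℂ[X]) :
    jumpFunctional l β p = Complex.exp (Real.pi * Complex.I * β) *
        (∫ x in Iic l, p.eval (x : ℂ) * ((Real.exp (-x ^ 2) : ℝ) : ℂ))
      + Complex.exp (-(Real.pi * Complex.I * β)) * tailI l p := by
  have hi := integrable_eval_mul_w l β p
  rw [jumpFunctional_apply, ← intervalIntegral.integral_Iic_add_Ioi hi.integrableOn hi.integrableOn
    (b := l), tailI, ← integral_const_mul, ← integral_const_mul,
    integral_Iic_eq_integral_Iio, integral_Iic_eq_integral_Iio]
  congr 1
  · refine setIntegral_congr_fun measurableSet_Iio fun x hx => ?_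
    simp only [w, if_pos (mem_Iio.1 hx)]
    ring
  · refine setIntegral_congr_fun measurableSet_Ioi fun x hx => ?_
    simp only [w, if_neg (not_lt.2 (mem_Ioi.1 hx).le)]
    ring

lemma jumpFunctional_eq (p : ℂ[X]) :
    jumpFunctional l β p = Complex.exp (Real.pi * Complex.I * β) *
      (gaussI p - (1 - Complex.exp (-(2 * Real.pi * Complex.I * β))) * tailI l p) := by
  have hi := integrable_eval_mul_exp p
  have e : Complex.exp (Real.pi * Complex.I * β) * Complex.exp (-(2 * Real.pi * Complex.I * β))
      = Complex.exp (-(Real.pi * Complex.I * β)) := by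
    rw [← Complex.exp_add]; ring_nf
  rw [jumpFunctional_split, gaussI, ← intervalIntegral.integral_Iic_add_Ioi hi.integrableOn
    hi.integrableOn (b := l), ← tailI]
  linear_combination -tailI l p * e

lemma jumpFunctional_parts (p : ℂ[X]) :
    jumpFunctional l β (p.derivative - 2 * X * p)
      = (Complex.exp (Real.pi * Complex.I * β) - Complex.exp (-(Real.pi * Complex.I * β)))
        * (p.eval (l : ℂ) * ((Real.exp (-l ^ 2) : ℝ) : ℂ)) := by
  have hg := integrable_eval_mul_exp (p.derivative - 2 * X * p)
  have hp := integrable_eval_mul_exp p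
  have hd := hasDerivAt_eval_mul_exp p
  have ht := tendsto_zero_of_hasDerivAt_of_integrableOn_Ioi (a := l) (fun x _ => hd x)
    hg.integrableOn hp.integrableOn
  have hb := tendsto_zero_of_hasDerivAt_of_integrableOn_Iic (a := l) (fun x _ => hd x)
    hg.integrableOn hp.integrableOn
  rw [jumpFunctional_split, tailI,
    integral_Ioi_of_hasDerivAt_of_tendsto' (fun x _ => hd x) hg.integrableOn ht,
    integral_Iic_of_hasDerivAt_of_tendsto' (fun x _ => hd x) hg.integrableOn hb]
  ring

variable {l β}

lemma isMonicOrth_iff {n : ℕ} {p : ℂ[X]} :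
    IsMonicOrth (jumpFunctional l β) n p ↔ MonicOrthPoly n l β p := by
  have e : ∀ m : ℕ, jumpFunctional l β (p * X ^ m)
      = ∫ x : ℝ, p.eval (x : ℂ) * (x : ℂ) ^ m * w l β x := fun m => by
    rw [jumpFunctional_apply]; simp
  refine and_congr_right fun _ => and_congr_right fun _ => ⟨fun h m hm => ?_, fun h q hq => ?_⟩
  · rw [← e]
    exact h _ (by rw [Polynomial.degree_X_pow]; exact_mod_cast hm)
  · exact map_mul_eq_zero_of_monomials (fun m hm => by rw [e]; exact h m hm) hq

lemma hankel_ne_zero (hβ : |β.re| < 1 / 2) (n : ℕ) : H n l β ≠ 0 := by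
  have := (regular_jumpFunctional l hβ).det_ne_zero n
  simpa [H, jumpFunctional_apply] using this

end JumpWeight

section FiniteRank

/-- Hermite functions in the variable `s` with `x = a + σ s`. -/
def hermScaled (a σ : ℝ) (j : ℕ) (s : ℝ) : ℂ := (hermFun j (a + σ * s) : ℂ)

/-- Polynomials times the square root of the Gaussian, in the variable `s` with `x = a + σ s`. -/
def polyScaled (a σ : ℝ) (p : ℂ[X]) (s : ℝ) : ℂ :=
  p.eval ((a + σ * s : ℝ) : ℂ) * ((Real.exp (-(a + σ * s) ^ 2 / 2) : ℝ) : ℂ)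

/-- The Christoffel–Darboux operator of the Hermite functions on a half line. -/
def hermOp (a σ : ℝ) (n : ℕ) (t : ℝ) : HalfL2 →L[ℂ] HalfL2 :=
  (σ : ℂ) • ∑ j ∈ Finset.range n,
    rankOne pairing (translate (hermScaled a σ j) t) (translate (hermScaled a σ j) t)

/-- The boundary row of the Christoffel–Darboux kernel. -/
def hermRow (a σ : ℝ) (n : ℕ) (t : ℝ) : HalfL2 :=
  (σ : ℂ) • ∑ j ∈ Finset.range n, hermScaled a σ j t • translate (hermScaled a σ j) t

variable {a σ : ℝ}

lemma expDecay_hermScaled (hσ : 0 < σ) (j : ℕ) : ExpDecay (hermScaled a σ j) :=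
  expDecay_hermFun j a hσ

lemma expDecay_polyScaled (hσ : 0 < σ) (p : ℂ[X]) : ExpDecay (polyScaled a σ p) :=
  expDecay_eval_mul_exp p a hσ

lemma polyScaled_herm (j : ℕ) (s : ℝ) :
    polyScaled a σ (herm j) s = (√(hermNormSq j) : ℝ) * hermScaled a σ j s := by
  have h : ((√(hermNormSq j) : ℝ) : ℂ) ≠ 0 := by exact_mod_cast (sqrt_hermNormSq_pos j).ne'
  rw [polyScaled, hermScaled, ofReal_hermFun]
  field_simp

lemma polyScaled_sub (p q : ℂ[X]) (s : ℝ) :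
    polyScaled a σ (p - q) s = polyScaled a σ p s - polyScaled a σ q s := by
  simp only [polyScaled, Polynomial.eval_sub, sub_mul]

lemma polyScaled_C_mul (c : ℂ) (p : ℂ[X]) (s : ℝ) :
    polyScaled a σ (C c * p) s = c * polyScaled a σ p s := by
  simp only [polyScaled, Polynomial.eval_mul, Polynomial.eval_C, mul_assoc]

lemma polyScaled_expansion {n : ℕ} {q : ℂ[X]} (hq : q.degree < n) (s : ℝ) :
    polyScaled a σ q s = ∑ j ∈ Finset.range n,
      gaussI (herm j * q) / (√(hermNormSq j) : ℝ) * hermScaled a σ j s := by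
  conv_lhs => rw [herm_expansion hq, polyScaled, Polynomial.eval_finsetSum, Finset.sum_mul]
  refine Finset.sum_congr rfl fun j _ => ?_
  have h : ((√(hermNormSq j) : ℝ) : ℂ) ≠ 0 := by exact_mod_cast (sqrt_hermNormSq_pos j).ne'
  have h2 : (hermNormSq j : ℂ) = ((√(hermNormSq j) : ℝ) : ℂ) * ((√(hermNormSq j) : ℝ) : ℂ) := by
    rw [← Complex.ofReal_mul, Real.mul_self_sqrt (hermNormSq_pos j).le]
  have := polyScaled_C_mul (a := a) (σ := σ) (gaussI (herm j * q) / hermNormSq j) (herm j) s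
  rw [polyScaled] at this
  rw [this, polyScaled_herm, h2]
  field_simp

lemma tailI_eq_pairing (hσ : 0 < σ) (t : ℝ) (p q : ℂ[X]) :
    tailI (a + σ * t) (p * q)
      = σ * pairing (translate (polyScaled a σ p) t) (translate (polyScaled a σ q) t) := by
  rw [pairing_translate (expDecay_polyScaled hσ p) (expDecay_polyScaled hσ q), tailI]
  set l := a + σ * t with hl
  set G : ℝ → ℂ := fun x => (p * q).eval (x : ℂ) * ((Real.exp (-x ^ 2) : ℝ) : ℂ) with hG
  have h1 : ∫ x in Ioi l, G x = ∫ u in Ioi (0 : ℝ), G (l + u) := by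
    rw [← (measurePreserving_add_left volume l).setIntegral_preimage_emb
      (measurableEmbedding_addLeft l) G (Ioi l)]
    simp
  have h2 := integral_comp_mul_left_Ioi (fun u => G (l + u)) 0 hσ
  rw [mul_zero] at h2
  rw [h1]
  have h3 : ∀ x : ℝ, polyScaled a σ p (x + t) * polyScaled a σ q (x + t) = G (l + σ * x) := by
    intro x
    have e : a + σ * (x + t) = l + σ * x := by rw [hl]; ring
    have e2 : Real.exp (-(l + σ * x) ^ 2)
        = Real.exp (-(l + σ * x) ^ 2 / 2) * Real.exp (-(l + σ * x) ^ 2 / 2) := by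
      rw [← Real.exp_add]; ring_nf
    simp only [polyScaled, hG, e, e2, Polynomial.eval_mul]
    push_cast
    ring
  simp only [h3, h2]
  have : (σ : ℂ) ≠ 0 := by exact_mod_cast hσ.ne'
  rw [Complex.real_smul]
  push_cast
  field_simp

lemma translate_polyScaled_herm (hσ : 0 < σ) (j : ℕ) (t : ℝ) :
    translate (polyScaled a σ (herm j)) t
      = ((√(hermNormSq j) : ℝ) : ℂ) • translate (hermScaled a σ j) t := by
  rw [← translate_const_mul (expDecay_hermScaled hσ j)]
  congr 1
  funext s
  exact polyScaled_herm j s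

lemma translate_sum {ι : Type*} (S : Finset ι) (c : ι → ℂ) {f : ι → ℝ → ℂ}
    (hf : ∀ i, ExpDecay (f i)) (t : ℝ) :
    ExpDecay (fun s => ∑ i ∈ S, c i * f i s) ∧
      translate (fun s => ∑ i ∈ S, c i * f i s) t = ∑ i ∈ S, c i • translate (f i) t := by
  classical
  induction S using Finset.induction_on with
  | empty =>
    have h0 : ExpDecay (fun _ : ℝ => (0 : ℂ)) :=
      ⟨continuous_const, fun T => ⟨0, fun x _ => by simp⟩⟩
    refine ⟨by simpa using h0, ?_⟩
    have := translate_const_mul h0 0 t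
    simpa using this
  | insert i S hi ih =>
    simp only [Finset.sum_insert hi]
    refine ⟨((hf i).const_mul (c i)).add ih.1, ?_⟩
    rw [translate_add ((hf i).const_mul (c i)) ih.1, translate_const_mul (hf i), ih.2]

/-- Polynomials whose Hermite coefficients are multiples of tail integrals solve the
finite-rank integral equation. -/
lemma hermOp_equation (hσ : 0 < σ) {n k : ℕ} {t : ℝ} {γ c : ℂ} {p : ℂ[X]}
    (hd : (p - C c * herm k).degree < n)
    (hcoef : ∀ j < n, gaussI (herm j * (p - C c * herm k))
      = γ * tailI (a + σ * t) (herm j * p)) :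
    translate (polyScaled a σ p) t - γ • hermOp a σ n t (translate (polyScaled a σ p) t)
        = (c * (√(hermNormSq k) : ℝ)) • translate (hermScaled a σ k) t ∧
      polyScaled a σ p t = c * (√(hermNormSq k) : ℝ) * hermScaled a σ k t
        + γ * pairing (hermRow a σ n t) (translate (polyScaled a σ p) t) := by
  set f := translate (polyScaled a σ p) t with hf
  have hexp : ∀ s, polyScaled a σ p s = c * (√(hermNormSq k) : ℝ) * hermScaled a σ k s
      + ∑ j ∈ Finset.range n, γ * σ * pairing (translate (hermScaled a σ j) t) f
        * hermScaled a σ j s := by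
    intro s
    have h1 := polyScaled_expansion (a := a) (σ := σ) hd s
    rw [polyScaled_sub, polyScaled_C_mul, polyScaled_herm] at h1
    rw [sub_eq_iff_eq_add] at h1
    rw [h1, add_comm, ← mul_assoc]
    congr 1
    refine Finset.sum_congr rfl fun j hj => ?_
    have h : ((√(hermNormSq j) : ℝ) : ℂ) ≠ 0 := by exact_mod_cast (sqrt_hermNormSq_pos j).ne'
    rw [hcoef j (Finset.mem_range.1 hj), tailI_eq_pairing hσ, translate_polyScaled_herm hσ,
      map_smul, smul_apply, smul_eq_mul, ← hf]
    field_simp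
  constructor
  · have h2 := translate_sum (Finset.range n)
      (fun j => γ * σ * pairing (translate (hermScaled a σ j) t) f)
      (fun j => expDecay_hermScaled (a := a) hσ j) t
    have h3 : f = (c * (√(hermNormSq k) : ℝ)) • translate (hermScaled a σ k) t
        + ∑ j ∈ Finset.range n, (γ * σ * pairing (translate (hermScaled a σ j) t) f)
          • translate (hermScaled a σ j) t := by
      conv_lhs => rw [hf, funext hexp,
        translate_add ((expDecay_hermScaled hσ k).const_mul _) h2.1, h2.2,
        translate_const_mul (expDecay_hermScaled hσ k)]
    rw [sub_eq_iff_eq_add]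
    conv_lhs => rw [h3]
    congr 1
    rw [hermOp, smul_apply, sum_apply, smul_smul,
      Finset.smul_sum]
    refine Finset.sum_congr rfl fun j _ => ?_
    rw [rankOne_apply, smul_smul]
  · rw [hexp t, hermRow]
    congr 1
    rw [map_smul, map_sum, smul_apply, sum_apply,
      smul_eq_mul, ← mul_assoc, Finset.mul_sum]
    refine Finset.sum_congr rfl fun j _ => ?_
    rw [map_smul, smul_apply, smul_eq_mul]
    ring

/-- The recurrence coefficient in terms of the finite-rank resolvent. -/
lemma recurrence_coeff_eq {β : ℂ} (hβ : |β.re| < 1 / 2) (hσ : 0 < σ) {n : ℕ} {t : ℝ}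
    {pm pn : ℂ[X]} (hm : IsMonicOrth (jumpFunctional (a + σ * t) β) n pm)
    (hn : IsMonicOrth (jumpFunctional (a + σ * t) β) (n + 1) pn) {γ : ℂ}
    (hγ : γ = 1 - Complex.exp (-(2 * Real.pi * Complex.I * β))) :
    ∃ f g : HalfL2,
      f - γ • hermOp a σ (n + 1) t f = translate (hermScaled a σ (n + 1)) t ∧
      g - γ • hermOp a σ (n + 1) t g = translate (hermScaled a σ n) t ∧
      jumpFunctional (a + σ * t) β (pn * pn) / jumpFunctional (a + σ * t) β (pm * pm)
        = ((n + 1 : ℕ) : ℂ) / 2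
          - γ / 2 * ((√(hermNormSq (n + 1)) / √(hermNormSq n) : ℝ) : ℂ)
            * (hermScaled a σ (n + 1) t + γ * pairing (hermRow a σ (n + 1) t) f)
            * (hermScaled a σ n t + γ * pairing (hermRow a σ (n + 1) t) g) := by
  set L := jumpFunctional (a + σ * t) β with hL
  set E := Complex.exp (Real.pi * Complex.I * β) with hE
  have hE0 : E ≠ 0 := Complex.exp_ne_zero _
  have hreg : RegularFunctional L := regular_jumpFunctional _ hβ
  have hh0 := hm.norm_ne_zero hreg
  set h := L (pm * pm) with hh
  have hN0 : ((√(hermNormSq n) : ℝ) : ℂ) ≠ 0 := by exact_mod_cast (sqrt_hermNormSq_pos n).ne'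
  have hN1 : ((√(hermNormSq (n + 1)) : ℝ) : ℂ) ≠ 0 := by
    exact_mod_cast (sqrt_hermNormSq_pos (n + 1)).ne'
  have hNsq : (hermNormSq n : ℂ) = ((√(hermNormSq n) : ℝ) : ℂ) * ((√(hermNormSq n) : ℝ) : ℂ) := by
    rw [← Complex.ofReal_mul, Real.mul_self_sqrt (hermNormSq_pos n).le]
  have hgauss : ∀ p : ℂ[X], gaussI p = E⁻¹ * L p + γ * tailI (a + σ * t) p := by
    intro p
    have := jumpFunctional_eq (a + σ * t) β p
    rw [← hL, ← hγ, ← hE] at this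
    rw [this]
    field_simp
    ring
  have hsub : ∀ (j : ℕ) (p : ℂ[X]) (c : ℂ) (k : ℕ), gaussI (herm j * (p - C c * herm k))
      = gaussI (herm j * p) - c * gaussI (herm j * herm k) := by
    intro j p c k
    rw [mul_sub, gaussI_sub, mul_left_comm, gaussI_C_mul]
  have hherm_lt : ∀ j k : ℕ, j < k → (herm j).degree < (k : WithBot ℕ) := by
    intro j k hjk
    rw [Polynomial.degree_eq_natDegree (herm_monic j).ne_zero, natDegree_herm]
    exact_mod_cast hjk
  obtain ⟨hn1, hn2⟩ := hermOp_equation (a := a) hσ (n := n + 1) (k := n + 1) (t := t) (γ := γ)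
    (c := 1) (p := pn) (by
      have := degree_sub_C_mul_lt (q := pn) (herm_monic (n + 1)) (natDegree_herm (n + 1))
        (by rw [hn.degree_eq]; exact_mod_cast Nat.lt_succ_self _)
      rwa [hn.coeff_self] at this) (by
      intro j hj
      rw [hsub, gaussI_herm_herm, if_neg hj.ne, hgauss, mul_comm (herm j) pn,
        hn.2.2 _ (hherm_lt j _ hj)]
      ring)
  obtain ⟨hm1, hm2⟩ := hermOp_equation (a := a) hσ (n := n + 1) (k := n) (t := t) (γ := γ)
    (c := E⁻¹ * h / hermNormSq n) (p := pm) (by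
      refine (Polynomial.degree_sub_le _ _).trans_lt (max_lt ?_ ?_)
      · rw [hm.degree_eq]; exact_mod_cast Nat.lt_succ_self _
      · refine (Polynomial.degree_mul_le _ _).trans_lt ?_
        refine (add_le_add_left Polynomial.degree_C_le _).trans_lt ?_
        rw [zero_add]
        exact hherm_lt n _ n.lt_succ_self) (by
      intro j hj
      rw [hsub, gaussI_herm_herm, hgauss, mul_comm (herm j) pm]
      rcases (Nat.lt_succ_iff.1 hj).eq_or_lt with rfl | hj
      · rw [if_pos rfl, hm.map_mul (hherm_lt _ _ hj), ← hh]
        have : (herm j).coeff j = 1 := by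
          have := herm_monic j
          rwa [Polynomial.Monic, Polynomial.leadingCoeff, natDegree_herm] at this
        have h0 : (hermNormSq j : ℂ) ≠ 0 := by exact_mod_cast (hermNormSq_pos j).ne'
        rw [this]
        field_simp
        ring
      · rw [if_neg hj.ne, hm.2.2 _ (hherm_lt j _ hj)]
        ring)
  set cn := ((√(hermNormSq (n + 1)) : ℝ) : ℂ) with hcn
  set cm := E⁻¹ * h / hermNormSq n * ((√(hermNormSq n) : ℝ) : ℂ) with hcm
  have hcm0 : cm ≠ 0 := by
    rw [hcm, hNsq]
    positivity
  refine ⟨cn⁻¹ • translate (polyScaled a σ pn) t, cm⁻¹ • translate (polyScaled a σ pm) t,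
    ?_, ?_, ?_⟩
  · rw [one_mul] at hn1
    rw [map_smul, smul_comm γ, ← smul_sub, hn1, smul_smul, inv_mul_cancel₀ hN1, one_smul]
  · rw [map_smul, smul_comm γ, ← smul_sub, hm1, smul_smul, inv_mul_cancel₀ hcm0, one_smul]
  · have hF : hermScaled a σ (n + 1) t + γ * pairing (hermRow a σ (n + 1) t)
        (cn⁻¹ • translate (polyScaled a σ pn) t) = cn⁻¹ * polyScaled a σ pn t := by
      rw [hn2, map_smul, smul_eq_mul]; field_simp
    have hG : hermScaled a σ n t + γ * pairing (hermRow a σ (n + 1) t)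
        (cm⁻¹ • translate (polyScaled a σ pm) t) = cm⁻¹ * polyScaled a σ pm t := by
      rw [hm2, map_smul, smul_eq_mul]; field_simp
    rw [hF, hG]
    have hstr := jumpFunctional_parts (a + σ * t) β (pn * pm)
    rw [← hL, hm.map_parts hn, ← hh, ← hE] at hstr
    have hEE : E - Complex.exp (-(Real.pi * Complex.I * β)) = E * γ := by
      rw [hγ, hE, mul_sub, mul_one, ← Complex.exp_add]
      ring_nf
    have hPP : (pn * pm).eval ((a + σ * t : ℝ) : ℂ) * ((Real.exp (-(a + σ * t) ^ 2) : ℝ) : ℂ)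
        = polyScaled a σ pn t * polyScaled a σ pm t := by
      have e2 : Real.exp (-(a + σ * t) ^ 2)
          = Real.exp (-(a + σ * t) ^ 2 / 2) * Real.exp (-(a + σ * t) ^ 2 / 2) := by
        rw [← Real.exp_add]; ring_nf
      rw [e2, Polynomial.eval_mul, polyScaled, polyScaled]
      push_cast
      ring
    rw [hEE, hPP] at hstr
    rw [div_eq_iff hh0, hcm, hNsq, Complex.ofReal_div, ← hcn]
    field_simp
    linear_combination -hstr

end FiniteRank

section ChristoffelDarboux

lemma hermFun_one (x : ℝ) : √(1 / 2) * hermFun 1 x = x * hermFun 0 x := by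
  have h1 : herm 1 = X := by rw [herm_succ]; simp [herm]
  have h0 : herm 0 = 1 := rfl
  have hN := sqrt_hermNormSq_succ 0
  have hN0 := (sqrt_hermNormSq_pos 0).ne'
  have hs : √(1 / 2 : ℝ) ≠ 0 := by positivity
  simp only [Nat.cast_zero, zero_add] at hN
  rw [hermFun, hermFun, h1, h0, hN]
  simp only [Polynomial.eval_X, Polynomial.eval_one, Complex.ofReal_re, Complex.one_re]
  field_simp

/-- The ladder form of the derivative of the Hermite functions. -/
lemma hasDerivAt_hermFun_ladder (j : ℕ) (x : ℝ) : HasDerivAt (hermFun j)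
    (√((j : ℝ) / 2) * hermFun (j - 1) x - √(((j + 1 : ℕ) : ℝ) / 2) * hermFun (j + 1) x) x := by
  cases j with
  | zero =>
    refine (hasDerivAt_hermFun 0 x).congr_deriv ?_
    have := hermFun_one x
    simp only [CharP.cast_eq_zero, zero_add, zero_div, Real.sqrt_zero, zero_mul, zero_sub,
      Nat.cast_one]
    linarith
  | succ k =>
    have h1 := hasDerivAt_hermFun (k + 1) x
    have h2 := hasDerivAt_hermFun_succ k x
    refine h1.congr_deriv ?_
    have := h1.unique h2
    simp only [Nat.add_sub_cancel]
    push_cast at this ⊢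
    linarith

variable {a σ : ℝ}

/-- The derivative of `hermScaled`. -/
def hermScaledDeriv (a σ : ℝ) (j : ℕ) (s : ℝ) : ℂ :=
  ((σ * √((j : ℝ) / 2) : ℝ) : ℂ) * hermScaled a σ (j - 1) s
    - ((σ * √(((j + 1 : ℕ) : ℝ) / 2) : ℝ) : ℂ) * hermScaled a σ (j + 1) s

lemma hasDerivAt_hermScaled (j : ℕ) (s : ℝ) :
    HasDerivAt (hermScaled a σ j) (hermScaledDeriv a σ j s) s := by
  have h1 : HasDerivAt (fun s : ℝ => a + σ * s) σ s := by
    simpa using ((hasDerivAt_id s).const_mul σ).const_add a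
  have h2 := ((hasDerivAt_hermFun_ladder j (a + σ * s)).comp s h1).ofReal_comp
  refine h2.congr_deriv ?_
  simp only [hermScaledDeriv, hermScaled]
  push_cast
  ring

lemma expDecay_hermScaledDeriv (hσ : 0 < σ) (j : ℕ) : ExpDecay (hermScaledDeriv a σ j) :=
  ((expDecay_hermScaled hσ _).const_mul _).sub ((expDecay_hermScaled hσ _).const_mul _)

lemma hasDerivAt_translate_hermScaled (hσ : 0 < σ) (j : ℕ) (z : ℝ) :
    HasDerivAt (translate (hermScaled a σ j))
      (((σ * √((j : ℝ) / 2) : ℝ) : ℂ) • translate (hermScaled a σ (j - 1)) z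
        - ((σ * √(((j + 1 : ℕ) : ℝ) / 2) : ℝ) : ℂ) • translate (hermScaled a σ (j + 1)) z) z := by
  have h := hasDerivAt_translate (expDecay_hermScaled hσ j) (expDecay_hermScaledDeriv hσ j)
    (((expDecay_hermScaledDeriv (a := a) hσ (j - 1)).const_mul ((σ * √((j : ℝ) / 2) : ℝ) : ℂ)).sub
      ((expDecay_hermScaledDeriv (a := a) hσ (j + 1)).const_mul
        ((σ * √(((j + 1 : ℕ) : ℝ) / 2) : ℝ) : ℂ)))
    (hasDerivAt_hermScaled j)
    (fun x => ((hasDerivAt_hermScaled (j - 1) x).const_mul _).sub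
      ((hasDerivAt_hermScaled (j + 1) x).const_mul _)) z
  refine h.congr_deriv ?_
  rw [← translate_const_mul (expDecay_hermScaled hσ _), ← translate_const_mul
    (expDecay_hermScaled hσ _), ← translate_sub ((expDecay_hermScaled hσ _).const_mul _)
    ((expDecay_hermScaled hσ _).const_mul _)]
  rfl

lemma expDecay_translate_hermScaled (hσ : 0 < σ) (j : ℕ) :
    ExpDecay (translate (hermScaled a σ j)) :=
  expDecay_translate (expDecay_hermScaled hσ j)
    (continuous_iff_continuousAt.2 fun z =>
      (hasDerivAt_translate_hermScaled hσ j z).continuousAt)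

variable {V W U : Type*} [NormedAddCommGroup V] [NormedSpace ℂ V]
  [NormedAddCommGroup W] [NormedSpace ℂ W] [NormedAddCommGroup U] [NormedSpace ℂ U]

lemma ladder_telescope (b : V →L[ℂ] W →L[ℂ] U) (c : ℕ → ℂ) (hc : c 0 = 0) (F : ℕ → V) (G : ℕ → W)
    (n : ℕ) :
    ∑ j ∈ Finset.range n, (b (c j • F (j - 1) - c (j + 1) • F (j + 1)) (G j)
      + b (F j) (c j • G (j - 1) - c (j + 1) • G (j + 1)))
      = -(c n • (b (F n) (G (n - 1)) + b (F (n - 1)) (G n))) := by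
  induction n with
  | zero => simp [hc]
  | succ k ih =>
    rw [Finset.sum_range_succ, ih]
    simp only [map_sub, map_smul, sub_apply, smul_apply, smul_add, Nat.add_sub_cancel]
    abel

variable [CompleteSpace U]

lemma sum_ladder_eq_integral (b : V →L[ℂ] W →L[ℂ] U) {c : ℕ → ℂ} (hc : c 0 = 0)
    {F : ℕ → ℝ → V} {G : ℕ → ℝ → W} (hF : ∀ j, ExpDecay (F j)) (hG : ∀ j, ExpDecay (G j))
    (dF : ∀ j z, HasDerivAt (F j) (c j • F (j - 1) z - c (j + 1) • F (j + 1) z) z)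
    (dG : ∀ j z, HasDerivAt (G j) (c j • G (j - 1) z - c (j + 1) • G (j + 1) z) z)
    (n : ℕ) (t : ℝ) :
    ∑ j ∈ Finset.range n, b (F j t) (G j t)
      = c n • ∫ z in Ioi t, (b (F n z) (G (n - 1) z) + b (F (n - 1) z) (G n z)) := by
  have hS : ExpDecay fun z => ∑ j ∈ Finset.range n, b (F j z) (G j z) := by
    have : ∀ S : Finset ℕ, ExpDecay fun z => ∑ j ∈ S, b (F j z) (G j z) := by
      classical
      intro S
      induction S using Finset.induction_on with
      | empty => exact ⟨by simpa using continuous_const, fun T => ⟨0, fun x _ => by simp⟩⟩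
      | insert i S hi ih =>
        simp only [Finset.sum_insert hi]
        exact ((hF i).bilin (hG i) b).vadd ih
    exact this _
  have hS' : ExpDecay fun z => -(c n • (b (F n z) (G (n - 1) z) + b (F (n - 1) z) (G n z))) := by
    have := (((hF n).bilin (hG (n - 1)) b).vadd ((hF (n - 1)).bilin (hG n) b)).clm
      (-c n • ContinuousLinearMap.id ℂ U)
    refine this.congr fun z => ?_
    simp
  have hd : ∀ z, HasDerivAt (fun z => ∑ j ∈ Finset.range n, b (F j z) (G j z))
      (-(c n • (b (F n z) (G (n - 1) z) + b (F (n - 1) z) (G n z)))) z := by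
    intro z
    rw [← ladder_telescope b c hc (fun j => F j z) (fun j => G j z) n]
    refine HasDerivAt.fun_sum fun j _ => ?_
    have h := ((b.restrictScalars ℝ).hasFDerivAt.comp_hasDerivAt z (dF j z))
    have hb := (ContinuousLinearMap.restrictScalarsL ℂ W U ℝ ℝ).hasFDerivAt.comp_hasDerivAt z h
    have := hb.clm_apply (dG j z)
    refine this.congr_deriv ?_
    simp
  have := hS.integral_Ioi_deriv hS' hd t
  rw [integral_neg, neg_inj, integral_smul] at this
  exact this.symm

end ChristoffelDarboux

section KernelLimit

variable {V W U : Type*} [NormedAddCommGroup V] [NormedSpace ℂ V]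
  [NormedAddCommGroup W] [NormedSpace ℂ W] [NormedAddCommGroup U] [NormedSpace ℂ U]

lemma integral_exp_neg_two_mul_Ioi (t : ℝ) :
    IntegrableOn (fun z : ℝ => Real.exp (-2 * z)) (Ioi t) ∧
      ∫ z in Ioi t, Real.exp (-2 * z) = Real.exp (-2 * t) / 2 := by
  refine ⟨integrableOn_exp_mul_Ioi (by norm_num) t, ?_⟩
  rw [integral_exp_mul_Ioi (by norm_num)]
  ring

lemma norm_integral_bilin_sub_le (b : V →L[ℂ] W →L[ℂ] U) {F F0 : ℝ → V} {G G0 : ℝ → W}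
    (hF : ExpDecay F) (hF0 : ExpDecay F0) (hG : ExpDecay G) (hG0 : ExpDecay G0) {t ε M : ℝ}
    (hε0 : 0 ≤ ε) (hε1 : ε ≤ 1) (hM : 0 ≤ M)
    (h1 : ∀ z, t ≤ z → ‖F z - F0 z‖ ≤ ε * Real.exp (-z))
    (h2 : ∀ z, t ≤ z → ‖G z - G0 z‖ ≤ ε * Real.exp (-z))
    (h3 : ∀ z, t ≤ z → ‖F0 z‖ ≤ M * Real.exp (-z))
    (h4 : ∀ z, t ≤ z → ‖G0 z‖ ≤ M * Real.exp (-z)) :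
    ‖(∫ z in Ioi t, b (F z) (G z)) - ∫ z in Ioi t, b (F0 z) (G0 z)‖
      ≤ ‖b‖ * (2 * M + 1) * (Real.exp (-2 * t) / 2) * ε := by
  rw [← integral_sub ((hF.bilin hG b).integrableOn t) ((hF0.bilin hG0 b).integrableOn t)]
  obtain ⟨hi, he⟩ := integral_exp_neg_two_mul_Ioi t
  have hb := norm_integral_le_of_norm_le (μ := volume.restrict (Ioi t))
    (f := fun z => b (F z) (G z) - b (F0 z) (G0 z))
    (g := fun z => ‖b‖ * (2 * M + 1) * ε * Real.exp (-2 * z)) (hi.const_mul _) ?_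
  · refine hb.trans (le_of_eq ?_)
    rw [integral_const_mul, he]
    ring
  refine (ae_restrict_iff' measurableSet_Ioi).2 (Eventually.of_forall fun z hz => ?_)
  have hz : t ≤ z := (mem_Ioi.1 hz).le
  have e : b (F z) (G z) - b (F0 z) (G0 z)
      = b (F z - F0 z) (G z) + b (F0 z) (G z - G0 z) := by
    simp only [map_sub, sub_apply]
    abel
  have hGz : ‖G z‖ ≤ (M + 1) * Real.exp (-z) := by
    have := norm_add_le (G0 z) (G z - G0 z)
    rw [add_sub_cancel] at this
    have h5 := h2 z hz
    have h6 := h4 z hz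
    have : ε * Real.exp (-z) ≤ 1 * Real.exp (-z) :=
      mul_le_mul_of_nonneg_right hε1 (Real.exp_pos _).le
    linarith
  have hexp : Real.exp (-2 * z) = Real.exp (-z) * Real.exp (-z) := by
    rw [← Real.exp_add]; ring_nf
  rw [e, hexp]
  have a1 : ‖b (F z - F0 z) (G z)‖ ≤ ‖b‖ * (ε * Real.exp (-z)) * ((M + 1) * Real.exp (-z)) :=
    (b.le_opNorm₂ _ _).trans (mul_le_mul
      (mul_le_mul_of_nonneg_left (h1 z hz) (norm_nonneg b)) hGz (norm_nonneg _) (by positivity))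
  have a2 : ‖b (F0 z) (G z - G0 z)‖ ≤ ‖b‖ * (M * Real.exp (-z)) * (ε * Real.exp (-z)) :=
    (b.le_opNorm₂ _ _).trans (mul_le_mul
      (mul_le_mul_of_nonneg_left (h3 z hz) (norm_nonneg b)) (h2 z hz) (norm_nonneg _)
      (by positivity))
  refine (norm_add_le _ _).trans ((add_le_add a1 a2).trans (le_of_eq ?_))
  ring

lemma exists_norm_integral_bilin_sub_le (b : V →L[ℂ] W →L[ℂ] U) (t : ℝ) {M : ℝ} (hM : 0 ≤ M) :
    ∃ K, 0 ≤ K ∧ ∀ (F F0 : ℝ → V) (G G0 : ℝ → W) (ε : ℝ), ExpDecay F → ExpDecay F0 → ExpDecay G →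
      ExpDecay G0 → 0 ≤ ε → ε ≤ 1 →
      (∀ z, t ≤ z → ‖F z - F0 z‖ ≤ ε * Real.exp (-z)) →
      (∀ z, t ≤ z → ‖G z - G0 z‖ ≤ ε * Real.exp (-z)) →
      (∀ z, t ≤ z → ‖F0 z‖ ≤ M * Real.exp (-z)) →
      (∀ z, t ≤ z → ‖G0 z‖ ≤ M * Real.exp (-z)) →
      ‖(∫ z in Ioi t, b (F z) (G z)) - ∫ z in Ioi t, b (F0 z) (G0 z)‖ ≤ K * ε :=
  ⟨‖b‖ * (2 * M + 1) * (Real.exp (-2 * t) / 2), by positivity,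
    fun _ _ _ _ _ hF hF0 hG hG0 hε0 hε1 h1 h2 h3 h4 =>
      norm_integral_bilin_sub_le b hF hF0 hG hG0 hε0 hε1 hM h1 h2 h3 h4⟩

variable {n : ℕ} {ν m σ : ℝ}

lemma EdgeScale.sqrt_half (h : EdgeScale n ν m σ) : √((n : ℝ) / 2) = m := by
  rw [← h.cube, ← h.m_sq, Real.sqrt_sq h.m_pos.le]

lemma EdgeScale.sq_mul (h : EdgeScale n ν m σ) : 2 * (σ * (σ * m)) = edgeAmp ν * edgeAmp ν := by
  have hν := h.pos
  have e : edgeAmp ν * edgeAmp ν = m / ν := by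
    rw [← sq, edgeAmp_sq, Real.sqrt_eq_iff_mul_self_eq (by positivity)
      (div_nonneg h.m_pos.le hν.le)]
    have := h.m_sq
    field_simp
    linarith
  have := h.σ_sq
  rw [e]
  have : σ * (σ * m) = σ ^ 2 * m := by ring
  rw [this, h.σ_sq]
  field_simp

/-- The edge-rescaled Hermite functions. -/
def edgeFun (n : ℕ) (ν m σ : ℝ) (k : ℕ) (s : ℝ) : ℂ :=
  (edgeAmp ν : ℂ) * hermScaled (2 * m) σ (n - k) s

lemma EdgeScale.expDecay_edgeFun (h : EdgeScale n ν m σ) (k : ℕ) :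
    ExpDecay (edgeFun n ν m σ k) := (expDecay_hermScaled h.σ_pos _).const_mul _

lemma EdgeScale.translate_edgeFun (h : EdgeScale n ν m σ) (k : ℕ) (z : ℝ) :
    translate (edgeFun n ν m σ k) z
      = (edgeAmp ν : ℂ) • translate (hermScaled (2 * m) σ (n - k)) z :=
  translate_const_mul (expDecay_hermScaled h.σ_pos _) _ _

lemma EdgeScale.expDecay_translate_edgeFun (h : EdgeScale n ν m σ) (k : ℕ) :
    ExpDecay (translate (edgeFun n ν m σ k)) := by
  refine ((expDecay_translate_hermScaled (a := 2 * m) h.σ_pos (n - k)).clm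
    ((edgeAmp ν : ℂ) • ContinuousLinearMap.id ℂ _)).congr fun z => ?_
  rw [h.translate_edgeFun]
  rfl

lemma EdgeScale.sum_eq_integral [CompleteSpace U] (h : EdgeScale n ν m σ)
    (b : V →L[ℂ] W →L[ℂ] U) {F : ℕ → ℝ → V} {G : ℕ → ℝ → W}
    (hF : ∀ j, ExpDecay (F j)) (hG : ∀ j, ExpDecay (G j))
    (dF : ∀ j z, HasDerivAt (F j) (((σ * √((j : ℝ) / 2) : ℝ) : ℂ) • F (j - 1) z
      - ((σ * √(((j + 1 : ℕ) : ℝ) / 2) : ℝ) : ℂ) • F (j + 1) z) z)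
    (dG : ∀ j z, HasDerivAt (G j) (((σ * √((j : ℝ) / 2) : ℝ) : ℂ) • G (j - 1) z
      - ((σ * √(((j + 1 : ℕ) : ℝ) / 2) : ℝ) : ℂ) • G (j + 1) z) z) (t : ℝ) :
    (σ : ℂ) • ∑ j ∈ Finset.range n, b (F j t) (G j t)
      = (1 / 2 : ℂ) • ((∫ z in Ioi t, b ((edgeAmp ν : ℂ) • F n z) ((edgeAmp ν : ℂ) • G (n - 1) z))
        + ∫ z in Ioi t, b ((edgeAmp ν : ℂ) • F (n - 1) z) ((edgeAmp ν : ℂ) • G n z)) := by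
  rw [sum_ladder_eq_integral b (c := fun j => ((σ * √((j : ℝ) / 2) : ℝ) : ℂ)) (by simp) hF hG dF dG,
    integral_add (((hF n).bilin (hG (n - 1)) b).integrableOn t)
      (((hF (n - 1)).bilin (hG n) b).integrableOn t), h.sqrt_half]
  simp only [map_smul, smul_apply, integral_smul, smul_smul]
  rw [← smul_add, smul_smul]
  congr 1
  have := congrArg (fun x : ℝ => (x : ℂ)) h.sq_mul
  simp only [Complex.ofReal_mul, Complex.ofReal_ofNat] at this
  rw [Complex.ofReal_mul, ← this]
  ring

lemma EdgeScale.hermOp_eq (h : EdgeScale n ν m σ) (t : ℝ) :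
    hermOp (2 * m) σ n t = (1 / 2 : ℂ) •
      ((∫ z in Ioi t, rankOne pairing (translate (edgeFun n ν m σ 0) z)
          (translate (edgeFun n ν m σ 1) z))
        + ∫ z in Ioi t, rankOne pairing (translate (edgeFun n ν m σ 1) z)
          (translate (edgeFun n ν m σ 0) z)) := by
  have hF := fun j => expDecay_translate_hermScaled (a := 2 * m) h.σ_pos j
  have dF := fun j z => hasDerivAt_translate_hermScaled (a := 2 * m) h.σ_pos j z
  have := h.sum_eq_integral (rankOne pairing) hF hF dF dF t
  simp only [h.translate_edgeFun, Nat.sub_zero]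
  exact this

lemma EdgeScale.hermRow_eq (h : EdgeScale n ν m σ) (t : ℝ) :
    hermRow (2 * m) σ n t = (1 / 2 : ℂ) •
      ((∫ z in Ioi t, edgeFun n ν m σ 0 z • translate (edgeFun n ν m σ 1) z)
        + ∫ z in Ioi t, edgeFun n ν m σ 1 z • translate (edgeFun n ν m σ 0) z) := by
  have hF := fun j => expDecay_hermScaled (a := 2 * m) h.σ_pos j
  have dF := fun j z => hasDerivAt_hermScaled (a := 2 * m) (σ := σ) j z
  have hG := fun j => expDecay_translate_hermScaled (a := 2 * m) h.σ_pos j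
  have dG := fun j z => hasDerivAt_translate_hermScaled (a := 2 * m) h.σ_pos j z
  have := h.sum_eq_integral (ContinuousLinearMap.lsmul ℂ ℂ) hF hG dF dG t
  simp only [h.translate_edgeFun]
  exact this

/-- Convergence of the rescaled Christoffel–Darboux data to the Airy data. -/
theorem edge_kernel_le (t : ℝ) : ∃ C ν₀, 0 ≤ C ∧ ∀ n ν m σ, EdgeScale n ν m σ → ν₀ ≤ ν →
    ‖hermOp (2 * m) σ n t - airyOp pairing (translate (airyC 0)) t‖ ≤ C / ν ∧
    ‖hermRow (2 * m) σ n t - airyRow (airyC 0) (translate (airyC 0)) t‖ ≤ C / ν ∧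
    ∀ k ≤ 1, ‖edgeFun n ν m σ k t - airyC 0 t‖ ≤ C / ν ∧
      ‖translate (edgeFun n ν m σ k) t - translate (airyC 0) t‖ ≤ C / ν := by
  obtain ⟨C, ν₀, hC0, hC⟩ := edge_sub_airy_le t
  obtain ⟨M1, hM1⟩ := (expDecay_airyC 0).2 t
  obtain ⟨M2, hM2⟩ := (expDecay_translate_airyC 0).2 t
  set M := max 0 (max M1 M2) with hM
  have hM0 : 0 ≤ M := le_max_left _ _
  have hM1' : ∀ z, t ≤ z → ‖airyC 0 z‖ ≤ M * Real.exp (-z) := fun z hz =>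
    (hM1 z hz).trans (mul_le_mul_of_nonneg_right
      ((le_max_left _ _).trans (le_max_right _ _)) (Real.exp_pos _).le)
  have hM2' : ∀ z, t ≤ z → ‖translate (airyC 0) z‖ ≤ M * Real.exp (-z) := fun z hz =>
    (hM2 z hz).trans (mul_le_mul_of_nonneg_right
      ((le_max_right _ _).trans (le_max_right _ _)) (Real.exp_pos _).le)
  obtain ⟨K1, hK10, hK1⟩ := exists_norm_integral_bilin_sub_le (rankOne pairing) t hM0
  obtain ⟨K2, hK20, hK2⟩ := exists_norm_integral_bilin_sub_le
    (ContinuousLinearMap.lsmul (E := HalfL2) ℂ ℂ) t hM0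
  refine ⟨C * (K1 + K2 + Real.exp (-t)), max ν₀ C, by positivity, fun n ν m σ h hν => ?_⟩
  have hν0 := h.pos
  have hε0 : 0 ≤ C / ν := by positivity
  have hε1 : C / ν ≤ 1 := (div_le_one hν0).2 ((le_max_right _ _).trans hν)
  have h1 : ∀ k ≤ 1, ∀ z, t ≤ z → ‖edgeFun n ν m σ k z - airyC 0 z‖ ≤ C / ν * Real.exp (-z) := by
    intro k hk z hz
    have := hC n ν m σ h ((le_max_left _ _).trans hν) k hk z hz
    rwa [Complex.ofReal_mul] at this
  have h2 : ∀ k ≤ 1, ∀ z, t ≤ z → ‖translate (edgeFun n ν m σ k) z - translate (airyC 0) z‖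
      ≤ C / ν * Real.exp (-z) := by
    intro k hk z hz
    rw [← translate_sub (h.expDecay_edgeFun k) (expDecay_airyC 0)]
    exact norm_translate_le ((h.expDecay_edgeFun k).sub (expDecay_airyC 0))
      fun x hx => h1 k hk x (hz.trans hx)
  have half : ∀ {E : Type} [NormedAddCommGroup E] [NormedSpace ℂ E] (x y z : E) (r : ℝ),
      ‖x - z‖ ≤ r → ‖y - z‖ ≤ r → ‖(1 / 2 : ℂ) • (x + y) - z‖ ≤ r := by
    intro E _ _ x y z r hx hy
    have e : (1 / 2 : ℂ) • (x + y) - z = (1 / 2 : ℂ) • ((x - z) + (y - z)) := by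
      have : z = (1 / 2 : ℂ) • (z + z) := by rw [← two_smul ℂ z, smul_smul]; norm_num
      conv_lhs => rw [this]
      rw [← smul_sub]
      congr 1
      abel
    rw [e, norm_smul]
    have := norm_add_le (x - z) (y - z)
    norm_num
    linarith
  have hle : ∀ K, 0 ≤ K → K ≤ K1 + K2 + Real.exp (-t) →
      K * (C / ν) ≤ C * (K1 + K2 + Real.exp (-t)) / ν := by
    intro K _ hK
    have := mul_le_mul_of_nonneg_right hK hε0
    refine this.trans (le_of_eq (by ring))
  have hdA := expDecay_airyC 0
  have hdTA := expDecay_translate_airyC 0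
  have hE := (Real.exp_pos (-t)).le
  refine ⟨?_, ?_, fun k hk => ⟨?_, ?_⟩⟩
  · rw [h.hermOp_eq, airyOp]
    refine (half _ _ _ (K1 * (C / ν)) ?_ ?_).trans (hle K1 hK10 (by linarith))
    · exact hK1 _ _ _ _ _ (h.expDecay_translate_edgeFun 0) hdTA
        (h.expDecay_translate_edgeFun 1) hdTA hε0 hε1 (h2 0 zero_le_one) (h2 1 le_rfl) hM2' hM2'
    · exact hK1 _ _ _ _ _ (h.expDecay_translate_edgeFun 1) hdTA
        (h.expDecay_translate_edgeFun 0) hdTA hε0 hε1 (h2 1 le_rfl) (h2 0 zero_le_one) hM2' hM2'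
  · rw [h.hermRow_eq, airyRow]
    refine (half _ _ _ (K2 * (C / ν)) ?_ ?_).trans (hle K2 hK20 (by linarith))
    · exact hK2 _ _ _ _ _ (h.expDecay_edgeFun 0) hdA
        (h.expDecay_translate_edgeFun 1) hdTA hε0 hε1 (h1 0 zero_le_one) (h2 1 le_rfl) hM1' hM2'
    · exact hK2 _ _ _ _ _ (h.expDecay_edgeFun 1) hdA
        (h.expDecay_translate_edgeFun 0) hdTA hε0 hε1 (h1 1 le_rfl) (h2 0 zero_le_one) hM1' hM2'
  · refine (h1 k hk t le_rfl).trans ?_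
    rw [mul_comm]
    exact hle _ hE (by linarith)
  · refine (h2 k hk t le_rfl).trans ?_
    rw [mul_comm]
    exact hle _ hE (by linarith)

end KernelLimit

section Bessel

lemma herm_map_conj (j : ℕ) : (herm j).map (starRingEnd ℂ) = herm j := by
  induction j using Nat.strong_induction_on with
  | _ j ih =>
    cases j with
    | zero => simp [herm]
    | succ k =>
      rw [herm_succ, Polynomial.map_sub, Polynomial.map_mul, Polynomial.map_mul, Polynomial.map_X,
        Polynomial.map_C, ih k k.lt_succ_self, ih (k - 1) (by omega), map_div₀, map_natCast, Complex.conj_ofNat]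

lemma gaussI_conj_mul_self (n : ℕ) (d : ℕ → ℂ) :
    gaussI ((∑ j ∈ Finset.range n, C (d j) * herm j).map (starRingEnd ℂ)
      * ∑ j ∈ Finset.range n, C (d j) * herm j)
      = ((∑ j ∈ Finset.range n, Complex.normSq (d j) * hermNormSq j : ℝ) : ℂ) := by
  rw [Polynomial.map_sum, Finset.sum_mul, gaussI_sum]
  push_cast
  refine Finset.sum_congr rfl fun i hi => ?_
  rw [Finset.mul_sum, gaussI_sum, Finset.sum_eq_single_of_mem i hi]
  · have e : (C (d i) * herm i).map (starRingEnd ℂ) * (C (d i) * herm i)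
        = C ((starRingEnd ℂ) (d i) * d i) * (herm i * herm i) := by
      rw [Polynomial.map_mul, Polynomial.map_C, herm_map_conj, C_mul]
      ring
    rw [e, gaussI_C_mul, gaussI_herm_sq, Complex.normSq_eq_conj_mul_self]
  · intro j _ hj
    have e : (C (d i) * herm i).map (starRingEnd ℂ) * (C (d j) * herm j)
        = C ((starRingEnd ℂ) (d i) * d j) * (herm i * herm j) := by
      rw [Polynomial.map_mul, Polynomial.map_C, herm_map_conj, C_mul]
      ring
    rw [e, gaussI_C_mul, gaussI_herm_herm, if_neg hj.symm, mul_zero]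

lemma tailI_conj_mul_self_le (l : ℝ) (p : ℂ[X]) :
    (tailI l (p.map (starRingEnd ℂ) * p)).re ≤ (gaussI (p.map (starRingEnd ℂ) * p)).re := by
  have hi := integrable_eval_mul_exp (p.map (starRingEnd ℂ) * p)
  have he : ∀ x : ℝ, ((p.map (starRingEnd ℂ) * p).eval (x : ℂ) * ((Real.exp (-x ^ 2) : ℝ) : ℂ)).re
      = Complex.normSq (p.eval (x : ℂ)) * Real.exp (-x ^ 2) := by
    intro x
    rw [Polynomial.eval_mul, eval_map_conj, ← Complex.normSq_eq_conj_mul_self,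
      ← Complex.ofReal_mul, Complex.ofReal_re]
  rw [tailI, gaussI, ← RCLike.re_eq_complex_re, ← integral_re hi, ← integral_re hi.integrableOn]
  refine setIntegral_le_integral hi.re (Eventually.of_forall fun x => ?_)
  simp only [RCLike.re_eq_complex_re, he, Pi.zero_apply]
  exact mul_nonneg (Complex.normSq_nonneg _) (Real.exp_pos _).le

lemma inner_translate {g g' : ℝ → ℂ} (hg : ExpDecay g) (hg' : ExpDecay g')
    (h : ∀ x, g' x = (starRingEnd ℂ) (g x)) (t : ℝ) (f : HalfL2) :
    inner ℂ (translate g t) f = pairing (translate g' t) f := by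
  rw [L2.inner_def, pairing_eq]
  refine integral_congr_ae ?_
  filter_upwards [translate_coeFn hg t, translate_coeFn hg' t] with x h1 h2
  rw [h1, h2, h, RCLike.inner_apply, mul_comm]

variable {a σ : ℝ}

lemma inner_hermScaled (hσ : 0 < σ) (j : ℕ) (t : ℝ) (f : HalfL2) :
    inner ℂ (translate (hermScaled a σ j) t) f = pairing (translate (hermScaled a σ j) t) f :=
  inner_translate (expDecay_hermScaled hσ j) (expDecay_hermScaled hσ j)
    (fun x => by rw [hermScaled, Complex.conj_ofReal]) t f

lemma norm_sq_translate_polyScaled_le (hσ : 0 < σ) (p : ℂ[X]) (t : ℝ) :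
    ‖translate (polyScaled a σ p) t‖ ^ 2 ≤ σ⁻¹ * (gaussI (p.map (starRingEnd ℂ) * p)).re := by
  have h1 : inner ℂ (translate (polyScaled a σ p) t) (translate (polyScaled a σ p) t)
      = pairing (translate (polyScaled a σ (p.map (starRingEnd ℂ))) t)
        (translate (polyScaled a σ p) t) := by
    refine inner_translate (expDecay_polyScaled hσ p) (expDecay_polyScaled hσ _) (fun x => ?_) _ _
    rw [polyScaled, polyScaled, eval_map_conj, map_mul, Complex.conj_ofReal]
  have h2 := tailI_eq_pairing (a := a) hσ t (p.map (starRingEnd ℂ)) p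
  rw [← h1, inner_self_eq_norm_sq_to_K] at h2
  have h3 := tailI_conj_mul_self_le (a + σ * t) p
  have h4 : (tailI (a + σ * t) (p.map (starRingEnd ℂ) * p)).re
      = σ * ‖translate (polyScaled a σ p) t‖ ^ 2 := by
    rw [h2, Complex.re_ofReal_mul]
    congr 1
    norm_cast
  rw [inv_mul_eq_div, le_div_iff₀ hσ, mul_comm, ← h4]
  exact h3

/-- The numerical range of the Christoffel–Darboux operator is contained in `[0, 1]`. -/
lemma inner_hermOp (hσ : 0 < σ) (n : ℕ) (t : ℝ) (f : HalfL2) :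
    ∃ θ : ℝ, 0 ≤ θ ∧ θ ≤ ‖f‖ ^ 2 ∧ inner ℂ (hermOp a σ n t f) f = (θ : ℂ) := by
  set c : ℕ → ℂ := fun j => pairing (translate (hermScaled a σ j) t) f with hc
  set S : ℝ := σ * ∑ j ∈ Finset.range n, Complex.normSq (c j) with hS
  have hS0 : 0 ≤ S := mul_nonneg hσ.le (Finset.sum_nonneg fun j _ => Complex.normSq_nonneg _)
  have hin : inner ℂ (hermOp a σ n t f) f = (S : ℂ) := by
    rw [hermOp, smul_apply, sum_apply, inner_smul_left, sum_inner, Complex.conj_ofReal, hS]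
    push_cast
    congr 1
    refine Finset.sum_congr rfl fun j _ => ?_
    rw [rankOne_apply, inner_smul_left, inner_hermScaled hσ, ← Complex.normSq_eq_conj_mul_self]
  set d : ℕ → ℂ := fun j => σ * c j / (√(hermNormSq j) : ℝ) with hd
  set p : ℂ[X] := ∑ j ∈ Finset.range n, C (d j) * herm j with hp
  have hG : hermOp a σ n t f = translate (polyScaled a σ p) t := by
    have e : polyScaled a σ p = fun s => ∑ j ∈ Finset.range n, σ * c j * hermScaled a σ j s := by
      funext s
      rw [polyScaled, hp, Polynomial.eval_finsetSum, Finset.sum_mul]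
      refine Finset.sum_congr rfl fun j _ => ?_
      have h : ((√(hermNormSq j) : ℝ) : ℂ) ≠ 0 := by exact_mod_cast (sqrt_hermNormSq_pos j).ne'
      have := polyScaled_C_mul (a := a) (σ := σ) (d j) (herm j) s
      rw [polyScaled] at this
      rw [this, polyScaled_herm, hd]
      field_simp
    rw [e, (translate_sum _ _ (fun j => expDecay_hermScaled (a := a) hσ j) t).2, hermOp, smul_apply,
      sum_apply, Finset.smul_sum]
    refine Finset.sum_congr rfl fun j _ => ?_
    rw [rankOne_apply, smul_smul]
  have hnorm : ‖hermOp a σ n t f‖ ^ 2 ≤ S := by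
    rw [hG]
    refine (norm_sq_translate_polyScaled_le hσ p t).trans (le_of_eq ?_)
    rw [hp, gaussI_conj_mul_self, Complex.ofReal_re, hS, Finset.mul_sum, Finset.mul_sum]
    refine Finset.sum_congr rfl fun j _ => ?_
    have h := sqrt_hermNormSq_pos j
    have h2 : hermNormSq j = √(hermNormSq j) * √(hermNormSq j) :=
      (Real.mul_self_sqrt (hermNormSq_pos j).le).symm
    have hN := hermNormSq_pos j
    rw [hd]
    simp only [map_div₀, map_mul, Complex.normSq_ofReal]
    rw [← h2]
    field_simp
  refine ⟨S, hS0, ?_, hin⟩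
  have hcs : S ≤ ‖hermOp a σ n t f‖ * ‖f‖ := by
    have := norm_inner_le_norm (𝕜 := ℂ) (hermOp a σ n t f) f
    rwa [hin, Complex.norm_real, Real.norm_of_nonneg hS0] at this
  have hsq : S ^ 2 ≤ S * ‖f‖ ^ 2 :=
    calc S ^ 2 ≤ (‖hermOp a σ n t f‖ * ‖f‖) ^ 2 := by gcongr
      _ = ‖hermOp a σ n t f‖ ^ 2 * ‖f‖ ^ 2 := by ring
      _ ≤ S * ‖f‖ ^ 2 := by gcongr
  rcases hS0.eq_or_lt with h0 | h0
  · rw [← h0]; positivity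
  · rw [sq] at hsq
    exact le_of_mul_le_mul_left hsq h0

variable {β : ℂ}

lemma exists_jump_lower_bound (hβ : |β.re| < 1 / 2) : ∃ δ : ℝ, 0 < δ ∧ ∀ x θ : ℝ, 0 ≤ θ → θ ≤ x →
    x * δ ≤ ‖(x : ℂ) - (1 - Complex.exp (-(2 * Real.pi * Complex.I * β))) * θ‖ := by
  obtain ⟨h1, h2⟩ := exp_jump_re_pos hβ
  set s := Complex.exp (-(Real.pi * Complex.I * β)) with hs
  set r := Complex.exp (Real.pi * Complex.I * β) with hr
  have hsr : s * r = 1 := by rw [hs, hr, ← Complex.exp_add]; simp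
  have hss : Complex.exp (-(2 * Real.pi * Complex.I * β)) = s * s := by
    rw [hs, ← Complex.exp_add]; ring_nf
  have hs0 : 0 < ‖s‖ := norm_pos_iff.2 (Complex.exp_ne_zero _)
  refine ⟨‖s‖ * min r.re s.re, mul_pos hs0 (lt_min h1 h2), fun x θ h0 hθ => ?_⟩
  have e : (x : ℂ) - (1 - Complex.exp (-(2 * Real.pi * Complex.I * β))) * θ
      = s * (((x - θ : ℝ) : ℂ) * r + (θ : ℂ) * s) := by
    rw [hss]
    push_cast
    linear_combination -(x - θ : ℂ) * hsr
  rw [e, norm_mul, mul_left_comm]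
  refine mul_le_mul_of_nonneg_left ?_ hs0.le
  refine le_trans ?_ (Complex.re_le_norm _)
  rw [Complex.add_re, Complex.re_ofReal_mul, Complex.re_ofReal_mul]
  have a1 := mul_le_mul_of_nonneg_left (min_le_left r.re s.re) (sub_nonneg.2 hθ)
  have a2 := mul_le_mul_of_nonneg_left (min_le_right r.re s.re) h0
  nlinarith

/-- The edge scale attached to `n`. -/
lemma edgeScale_rpow {n : ℕ} (hn : 1 ≤ n) :
    EdgeScale n ((n : ℝ) ^ ((1 : ℝ) / 3)) (√((n : ℝ) / 2))
      (√((n : ℝ) / 2) / ((n : ℝ) ^ ((1 : ℝ) / 3)) ^ 2) := by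
  have hn' : (1 : ℝ) ≤ n := by exact_mod_cast hn
  have hc : ((n : ℝ) ^ ((1 : ℝ) / 3)) ^ 3 = n := by
    rw [← Real.rpow_natCast, ← Real.rpow_mul (by positivity)]
    norm_num
  refine ⟨Real.one_le_rpow hn' (by norm_num), hc, by positivity, ?_, rfl⟩
  rw [hc, Real.sq_sqrt (by positivity)]

lemma exists_edgeScale (x : ℝ) : ∃ n ν m σ, EdgeScale n ν m σ ∧ x ≤ ν := by
  obtain ⟨k, hk⟩ := exists_nat_ge (max x 1)
  have hk1 : (1 : ℝ) ≤ k := (le_max_right _ _).trans hk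
  have h := edgeScale_rpow (n := k ^ 3) (Nat.one_le_pow _ _ (by exact_mod_cast hk1))
  refine ⟨_, _, _, _, h, (le_max_left _ _).trans (hk.trans (le_of_eq ?_))⟩
  push_cast
  rw [← Real.rpow_natCast, ← Real.rpow_mul (by positivity)]
  norm_num

/-- Uniform coercivity of `1 - γ K` for the Christoffel–Darboux and Airy operators. -/
lemma exists_coercive (hβ : |β.re| < 1 / 2) {γ : ℂ}
    (hγ : γ = 1 - Complex.exp (-(2 * Real.pi * Complex.I * β))) : ∃ δ : ℝ, 0 < δ ∧
    (∀ (a σ : ℝ) (n : ℕ) (t : ℝ) (f : HalfL2), 0 < σ →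
      ‖f‖ ^ 2 * δ ≤ ‖inner ℂ (f - γ • hermOp a σ n t f) f‖) ∧
    ∀ (t : ℝ) (f : HalfL2),
      ‖f‖ ^ 2 * δ ≤ ‖inner ℂ (f - γ • airyOp pairing (translate (airyC 0)) t f) f‖ := by
  obtain ⟨δ0, hδ0, hlow⟩ := exists_jump_lower_bound (β := (starRingEnd ℂ) (-β)) (by simpa using hβ)
  have hγ' : (starRingEnd ℂ) γ
      = 1 - Complex.exp (-(2 * Real.pi * Complex.I * (starRingEnd ℂ) (-β))) := by
    rw [hγ, map_sub, map_one, ← Complex.exp_conj]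
    congr 2
    simp [Complex.conj_ofNat]
  have hH : ∀ (a σ : ℝ) (n : ℕ) (t : ℝ) (f : HalfL2), 0 < σ →
      ‖f‖ ^ 2 * δ0 ≤ ‖inner ℂ (f - γ • hermOp a σ n t f) f‖ := by
    intro a σ n t f hσ
    obtain ⟨θ, h0, h1, h2⟩ := inner_hermOp (a := a) hσ n t f
    have := hlow (‖f‖ ^ 2) θ h0 h1
    rw [inner_sub_left, inner_smul_left, h2, inner_self_eq_norm_sq_to_K, hγ']
    simpa using this
  refine ⟨δ0 / 2, by positivity, fun a σ n t f hσ => le_trans ?_ (hH a σ n t f hσ), fun t f => ?_⟩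
  · have : δ0 / 2 ≤ δ0 := by linarith
    gcongr
  · obtain ⟨C, ν₀, hC0, hC⟩ := edge_kernel_le t
    obtain ⟨n, ν, m, σ, h, hν⟩ := exists_edgeScale (max ν₀ (2 * ‖γ‖ * C / δ0))
    have hK := (hC n ν m σ h ((le_max_left _ _).trans hν)).1
    have hν2 := (le_max_right _ _).trans hν
    have hν0 := h.pos
    set K := hermOp (2 * m) σ n t
    set A := airyOp pairing (translate (airyC 0)) t
    have hf := hH (2 * m) σ n t f h.σ_pos
    have e : inner ℂ (f - γ • K f) f
        = inner ℂ (f - γ • A f) f - inner ℂ (γ • (K - A) f) f := by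
      rw [← inner_sub_left]
      congr 1
      simp only [sub_apply, smul_sub]
      abel
    have h1 : ‖inner ℂ (γ • (K - A) f) f‖ ≤ ‖γ‖ * (C / ν * ‖f‖) * ‖f‖ := by
      refine (norm_inner_le_norm _ _).trans ?_
      rw [norm_smul]
      have := ((K - A).le_opNorm f).trans (mul_le_mul_of_nonneg_right hK (norm_nonneg f))
      gcongr
    have h2 : ‖γ‖ * (C / ν) ≤ δ0 / 2 := by
      rw [div_le_iff₀ hδ0] at hν2
      rw [mul_div_assoc', div_le_iff₀ hν0]
      linarith
    have h3 : ‖γ‖ * (C / ν * ‖f‖) * ‖f‖ ≤ δ0 / 2 * ‖f‖ ^ 2 := by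
      have := mul_le_mul_of_nonneg_right h2 (sq_nonneg ‖f‖)
      linarith
    have h4 := norm_sub_le (inner ℂ (f - γ • A f) f) (inner ℂ (γ • (K - A) f) f)
    rw [← e] at h4
    linarith

lemma norm_le_of_coercive {T : HalfL2 →L[ℂ] HalfL2} {δ : ℝ} (hδ : 0 < δ)
    (h : ∀ f, ‖f‖ ^ 2 * δ ≤ ‖inner ℂ (T f) f‖) (f : HalfL2) : ‖f‖ ≤ δ⁻¹ * ‖T f‖ := by
  have h1 := (h f).trans (norm_inner_le_norm _ _)
  rw [inv_mul_eq_div, le_div_iff₀ hδ]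
  rcases (norm_nonneg f).eq_or_lt with h0 | h0
  · rw [← h0, zero_mul]; positivity
  · refine le_of_mul_le_mul_right ?_ h0
    linarith

lemma isUnit_of_coercive {T : HalfL2 →L[ℂ] HalfL2} {δ : ℝ} (hδ : 0 < δ)
    (h : ∀ f, ‖f‖ ^ 2 * δ ≤ ‖inner ℂ (T f) f‖) : IsUnit T :=
  ContinuousLinearMap.isUnit_of_forall_le_norm_inner_map T (c := ⟨δ, hδ.le⟩) hδ h

end Bessel

section Assembly

/-- Stability of `c + γ B(r, (1 - γ K)⁻¹ a)` under perturbation of all its ingredients. -/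
lemma norm_bracket_sub_le {E : Type*} [NormedAddCommGroup E] [NormedSpace ℂ E]
    (B : E →L[ℂ] E →L[ℂ] ℂ) {K K' : E →L[ℂ] E} {γ c c' : ℂ} {a a' r r' f f' : E} {D ε ε₀ : ℝ}
    (hD : 0 ≤ D) (hε : 0 ≤ ε) (hε₀ : ε ≤ ε₀) (hinv : ∀ f, ‖f‖ ≤ D * ‖f - γ • K' f‖)
    (hf : f - γ • K f = a) (hf' : f' - γ • K' f' = a') (hK : ‖K' - K‖ ≤ ε) (ha : ‖a' - a‖ ≤ ε)
    (hr : ‖r' - r‖ ≤ ε) (hc : ‖c' - c‖ ≤ ε) :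
    ‖c' + γ * B r' f' - (c + γ * B r f)‖
      ≤ (1 + ‖γ‖ * (‖B‖ * (ε₀ * (D * (1 + ‖γ‖ * ‖f‖)) + ‖f‖ + ‖r‖ * (D * (1 + ‖γ‖ * ‖f‖))))) * ε := by
  set P := D * (1 + ‖γ‖ * ‖f‖) with hP
  have hP0 : 0 ≤ P := by positivity
  have hB : ∀ x y, ‖B x y‖ ≤ ‖B‖ * (‖x‖ * ‖y‖) := fun x y => by
    rw [← mul_assoc]; exact B.le_opNorm₂ x y
  have h1 : ‖f' - f‖ ≤ P * ε := by
    have e : f' - f - γ • K' (f' - f) = (a' - a) + γ • (K' - K) f := by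
      rw [← hf, ← hf', map_sub, sub_apply, smul_sub, smul_sub]
      abel
    have h2 : ‖γ • (K' - K) f‖ ≤ ‖γ‖ * (ε * ‖f‖) := by
      rw [norm_smul]
      exact mul_le_mul_of_nonneg_left (((K' - K).le_opNorm f).trans
        (mul_le_mul_of_nonneg_right hK (norm_nonneg f))) (norm_nonneg γ)
    calc ‖f' - f‖ ≤ D * ‖(a' - a) + γ • (K' - K) f‖ := e ▸ hinv _
      _ ≤ D * (ε + ‖γ‖ * (ε * ‖f‖)) :=
          mul_le_mul_of_nonneg_left ((norm_add_le _ _).trans (add_le_add ha h2)) hD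
      _ = P * ε := by rw [hP]; ring
  have e : c' + γ * B r' f' - (c + γ * B r f)
      = (c' - c) + γ * (B (r' - r) (f' - f) + B (r' - r) f + B r (f' - f)) := by
    simp only [map_sub, sub_apply]
    ring
  have h2 : ‖B (r' - r) (f' - f)‖ ≤ ‖B‖ * (ε₀ * (P * ε)) := (hB _ _).trans <| by
    have := hr.trans hε₀
    have := hε.trans hε₀
    gcongr
  have h3 : ‖B (r' - r) f‖ ≤ ‖B‖ * (ε * ‖f‖) := (hB _ _).trans <| by gcongr
  have h4 : ‖B r (f' - f)‖ ≤ ‖B‖ * (‖r‖ * (P * ε)) := (hB _ _).trans <| by gcongr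
  rw [e]
  calc _ ≤ ‖c' - c‖ + ‖γ‖ * (‖B (r' - r) (f' - f)‖ + ‖B (r' - r) f‖ + ‖B r (f' - f)‖) := by
          refine (norm_add_le _ _).trans ?_
          rw [norm_mul]
          gcongr
          exact norm_add₃_le
    _ ≤ ε + ‖γ‖ * (‖B‖ * (ε₀ * (P * ε)) + ‖B‖ * (ε * ‖f‖) + ‖B‖ * (‖r‖ * (P * ε))) := by gcongr
    _ = _ := by ring

variable {γ : ℂ}

lemma isAblowitzSegur_painleveQ {A A' : ℝ → ℝ} (hA : IsAiry A A') {κ : ℂ} (hκ : κ ^ 2 = γ)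
    {δ : ℝ} (hδ : 0 < δ) (hco : ∀ (t : ℝ) (f : HalfL2),
      ‖f‖ ^ 2 * δ ≤ ‖inner ℂ (f - γ • airyOp pairing (translate (airyC 0)) t f) f‖)
    (hu : ∀ t, IsUnit (1 - γ • airyOp pairing (translate (airyC 0)) t)) :
    IsAblowitzSegur A κ
      (fun t => κ * painleveQ pairing (airyC 0) (translate (airyC 0)) γ t) := by
  set q := painleveQ pairing (airyC 0) (translate (airyC 0)) γ with hq
  set q1 := fun t => painleveP pairing (airyC 0) (airyC 1) (translate (airyC 0))
    (translate (airyC 1)) γ t - γ * pairing (translate (airyC 0) t)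
      (AirySystem.res pairing (translate (airyC 0)) γ t (translate (airyC 0) t)) * q t with hq1
  have h1 : ∀ t, HasDerivAt (fun t => κ * q t) (κ * q1 t) t := fun t =>
    (airySystem.hasDerivAt_painleveQ hu t).const_mul κ
  have hd : deriv (fun t => κ * q t) = fun t => κ * q1 t := funext fun t => (h1 t).deriv
  have h2 : ∀ t : ℝ, HasDerivAt (fun t => κ * q1 t) (κ * (t * q t + 2 * γ * q t ^ 3)) t := fun t =>
    (airySystem.painleve_ode hu t).const_mul κ
  refine ⟨fun t => (h1 t).differentiableAt, ?_, fun t => ?_, ?_⟩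
  · rw [hd]
    exact fun t => (h2 t).differentiableAt
  · rw [hd, (h2 t).deriv, ← hκ]
    ring
  obtain ⟨M, hM⟩ := (expDecay_translate_airyC 0).2 0
  set a := translate (airyC 0) with ha
  have hM0 : 0 ≤ M := by
    have := (norm_nonneg _).trans (hM 0 le_rfl)
    simpa using this
  set D := ‖γ‖ * (‖pairing‖ * M * (δ⁻¹ * M)) with hD
  have hbound : ∀ t : ℝ, 0 < t → ‖q t / A t - 1‖ ≤ D * Real.exp (-t) := by
    intro t ht
    set f := AirySystem.res pairing a γ t (a t) with hf
    have hA0 : (A t : ℂ) ≠ 0 := by exact_mod_cast airy_ne_zero hA ht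
    have hAt : 0 < |A t| := abs_pos.2 (airy_ne_zero hA ht)
    have hfn : ‖f‖ ≤ δ⁻¹ * M := by
      have h3 := norm_le_of_coercive (T := 1 - γ • airyOp pairing a t) hδ (hco t) f
      have h4 : (1 - γ • airyOp pairing a t) f = a t := AirySystem.res_right hu t (a t)
      rw [h4] at h3
      refine h3.trans (mul_le_mul_of_nonneg_left ((hM t ht.le).trans ?_) (by positivity))
      exact mul_le_of_le_one_right hM0 (Real.exp_le_one_iff.2 (by linarith))
    have hrow : ‖pairing (airyRow (airyC 0) a t) f‖
        ≤ |A t| * (‖pairing‖ * M * (δ⁻¹ * M)) * Real.exp (-t) := by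
      rw [airySystem.airyRow_apply]
      have h_int : IntegrableOn (fun z : ℝ => |A t| * (‖pairing‖ * M * (δ⁻¹ * M)) * Real.exp (-z))
          (Ioi t) := (integrableOn_exp_neg_Ioi t).const_mul _
      refine (norm_integral_le_of_norm_le h_int ?_).trans (le_of_eq ?_)
      · refine (ae_restrict_mem measurableSet_Ioi).mono fun z hz => ?_
        have hz' : t < z := hz
        rw [norm_mul, ← (airy_eq_airyC hA z).1, Complex.norm_real, Real.norm_eq_abs]
        have h5 := abs_airy_antitone hA ht.le hz'.le
        have h6 : ‖pairing (a z) f‖ ≤ ‖pairing‖ * (M * Real.exp (-z)) * (δ⁻¹ * M) :=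
          (pairing.le_opNorm₂ _ _).trans <| by
            have := hM z (ht.trans hz').le
            gcongr
        calc |A z| * ‖pairing (a z) f‖
            ≤ |A t| * (‖pairing‖ * (M * Real.exp (-z)) * (δ⁻¹ * M)) :=
              mul_le_mul h5 h6 (norm_nonneg _) (abs_nonneg _)
          _ = _ := by ring
      · rw [integral_const_mul, integral_exp_neg_Ioi]
    have e : q t / A t - 1 = γ * pairing (airyRow (airyC 0) a t) f / A t := by
      rw [hq, painleveQ, ← (airy_eq_airyC hA t).1]
      field_simp
      ring
    rw [e, norm_div, norm_mul, Complex.norm_real, Real.norm_eq_abs, div_le_iff₀ hAt]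
    refine (mul_le_mul_of_nonneg_left hrow (norm_nonneg γ)).trans (le_of_eq ?_)
    rw [hD]
    ring
  have hlim : Tendsto (fun t : ℝ => q t / A t) atTop (𝓝 1) := by
    refine tendsto_iff_norm_sub_tendsto_zero.2 ?_
    refine squeeze_zero' (Eventually.of_forall fun _ => norm_nonneg _)
      ((eventually_gt_atTop 0).mono hbound) ?_
    simpa using (Real.tendsto_exp_neg_atTop_nhds_zero).const_mul D
  simpa [mul_div_assoc] using hlim.const_mul κ

lemma lam0_eq {n : ℕ} (hn : 1 ≤ n) (t : ℝ) :
    lam0 t n = 2 * √((n : ℝ) / 2) + √((n : ℝ) / 2) / ((n : ℝ) ^ ((1 : ℝ) / 3)) ^ 2 * t := by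
  have h1 : √(2 * (n : ℝ)) = 2 * √((n : ℝ) / 2) := by
    rw [show 2 * (n : ℝ) = 2 ^ 2 * (n / 2) by ring, Real.sqrt_mul (by norm_num),
      Real.sqrt_sq (by norm_num)]
  have h2 : (n : ℝ) ^ (-(2 : ℝ) / 3) = (((n : ℝ) ^ ((1 : ℝ) / 3)) ^ 2)⁻¹ := by
    rw [← Real.rpow_natCast, ← Real.rpow_mul (by positivity), ← Real.rpow_neg (by positivity)]
    norm_num
  rw [lam0, h1, h2]
  ring

/-- The recurrence coefficient is `n / 2 - γ q(t)² ν / 2` up to a bounded error. -/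
lemma exists_norm_recurrence_coeff_sub_le {β : ℂ} (hβ : |β.re| < 1 / 2)
    (hγ : γ = 1 - Complex.exp (-(2 * Real.pi * Complex.I * β))) {δ : ℝ} (hδ : 0 < δ)
    (hco : ∀ (a σ : ℝ) (n : ℕ) (t : ℝ) (f : HalfL2), 0 < σ →
      ‖f‖ ^ 2 * δ ≤ ‖inner ℂ (f - γ • hermOp a σ n t f) f‖)
    (hu : ∀ t, IsUnit (1 - γ • airyOp pairing (translate (airyC 0)) t)) (t : ℝ) :
    ∃ C ν₀ : ℝ, ∀ (n : ℕ) (ν m σ : ℝ), EdgeScale (n + 1) ν m σ → ν₀ ≤ ν → ∀ pm pn : ℂ[X],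
      IsMonicOrth (jumpFunctional (2 * m + σ * t) β) n pm →
      IsMonicOrth (jumpFunctional (2 * m + σ * t) β) (n + 1) pn →
      ‖jumpFunctional (2 * m + σ * t) β (pn * pn) / jumpFunctional (2 * m + σ * t) β (pm * pm)
        - ((n + 1 : ℕ) : ℂ) / 2
        + (1 / 2) * (γ * painleveQ pairing (airyC 0) (translate (airyC 0)) γ t ^ 2) * (ν : ℂ)‖
        ≤ C := by
  obtain ⟨C, ν₀, hC0, hC⟩ := edge_kernel_le t
  set a := translate (airyC 0) with ha
  set q := painleveQ pairing (airyC 0) a γ t with hq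
  set F := AirySystem.res pairing a γ t (a t) with hF
  set r := airyRow (airyC 0) a t with hr
  set M := 1 + ‖γ‖ * (‖pairing‖ * (C * (δ⁻¹ * (1 + ‖γ‖ * ‖F‖)) + ‖F‖
    + ‖r‖ * (δ⁻¹ * (1 + ‖γ‖ * ‖F‖)))) with hM
  have hM0 : 0 ≤ M := by positivity
  refine ⟨‖γ‖ / 2 * (M * C * (M * C + 2 * ‖q‖)), ν₀, fun n ν m σ h hν pm pn hpm hpn => ?_⟩
  obtain ⟨hK, hrow, hfun⟩ := hC _ ν m σ h hν
  obtain ⟨f, g, hf, hg, heq⟩ := recurrence_coeff_eq hβ h.σ_pos hpm hpn hγ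
  have hν0 := h.pos
  have hε : 0 ≤ C / ν := by positivity
  have hε₀ : C / ν ≤ C := div_le_self hC0 h.one_le
  set K' := hermOp (2 * m) σ (n + 1) t
  set r' := hermRow (2 * m) σ (n + 1) t
  have hinv : ∀ f, ‖f‖ ≤ δ⁻¹ * ‖f - γ • K' f‖ := fun f =>
    norm_le_of_coercive (T := 1 - γ • K') hδ (fun f => hco _ _ _ _ f h.σ_pos) f
  have key : ∀ k ≤ 1, ∀ f : HalfL2,
      f - γ • K' f = translate (hermScaled (2 * m) σ (n + 1 - k)) t →
      ‖(edgeAmp ν : ℂ) * (hermScaled (2 * m) σ (n + 1 - k) t + γ * pairing r' f) - q‖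
        ≤ M * (C / ν) := by
    intro k hk f hf
    have h1 := norm_bracket_sub_le pairing (K := airyOp pairing a t) (K' := K') (γ := γ)
      (c := airyC 0 t) (c' := edgeFun (n + 1) ν m σ k t) (a := a t)
      (a' := translate (edgeFun (n + 1) ν m σ k) t) (r := r) (r' := r') (f := F)
      (f' := (edgeAmp ν : ℂ) • f) (inv_nonneg.2 hδ.le) hε hε₀ hinv
      (AirySystem.res_right hu t (a t))
      (by rw [h.translate_edgeFun, ← hf, map_smul, smul_sub, smul_comm γ]) hK (hfun k hk).2
      hrow (hfun k hk).1
    refine le_trans (le_of_eq ?_) h1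
    rw [hq, painleveQ, edgeFun, map_smul, smul_eq_mul]
    congr 1
    ring
  set Φ := (edgeAmp ν : ℂ) * (hermScaled (2 * m) σ (n + 1) t + γ * pairing r' f)
  set Ψ := (edgeAmp ν : ℂ) * (hermScaled (2 * m) σ n t + γ * pairing r' g)
  have hΦ : ‖Φ - q‖ ≤ M * (C / ν) := key 0 (by norm_num) f hf
  have hΨ : ‖Ψ - q‖ ≤ M * (C / ν) := key 1 le_rfl g hg
  have hmν : m = ν * (edgeAmp ν * edgeAmp ν) := by
    have h1 := h.sq_mul
    have h2 := h.σ_sq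
    rw [← h1, show 2 * (σ * (σ * m)) = 2 * σ ^ 2 * m by ring, h2]
    field_simp
  have hratio : √(hermNormSq (n + 1)) / √(hermNormSq n) = m := by
    have h1 := h.sqrt_hermNormSq le_rfl
    have h2 : 0 < √(hermNormSq (n + 1)) := Real.sqrt_pos.2 (hermNormSq_pos _)
    have h3 := h.m_pos
    rw [Nat.add_sub_cancel, pow_one] at h1
    rw [h1]
    field_simp
  have e : jumpFunctional (2 * m + σ * t) β (pn * pn) / jumpFunctional (2 * m + σ * t) β (pm * pm)
        - ((n + 1 : ℕ) : ℂ) / 2 + (1 / 2) * (γ * q ^ 2) * (ν : ℂ)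
      = -(γ / 2 * ν * ((Φ - q) * (Ψ - q) + q * (Φ - q) + q * (Ψ - q))) := by
    rw [heq, hratio]
    have : (m : ℂ) = ν * (edgeAmp ν * edgeAmp ν) := by exact_mod_cast hmν
    rw [this]
    ring
  rw [e, norm_neg, norm_mul, norm_mul, norm_div, Complex.norm_ofNat, Complex.norm_real,
    Real.norm_of_nonneg hν0.le]
  have h3 : ‖(Φ - q) * (Ψ - q) + q * (Φ - q) + q * (Ψ - q)‖
      ≤ M * C * (M * (C / ν)) + ‖q‖ * (M * (C / ν)) + ‖q‖ * (M * (C / ν)) := by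
    refine norm_add₃_le.trans ?_
    rw [norm_mul, norm_mul, norm_mul]
    have := hΦ.trans (mul_le_mul_of_nonneg_left hε₀ hM0)
    gcongr
  refine (mul_le_mul_of_nonneg_left h3 (by positivity)).trans (le_of_eq ?_)
  field_simp
  ring

end Assembly

end EdgeAsymptotics

/-- Asymptotics of the recurrence coefficient `R_n`:
`R_n = n/2 - (1/2)·u(t)²·n^(1/3) + O(1)` in the critical edge scaling. -/
theorem recurrence_coefficient_R_asymptotics
    (β κ : ℂ) (hβ : |β.re| < 1 / 2)
    (hκ : κ ^ 2 = 1 - Complex.exp (-(2 * Real.pi * Complex.I * β)))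
    (t : ℝ) (A A' : ℝ → ℝ) (hA : IsAiry A A') :
    ∃ (u : ℝ → ℂ) (C : ℝ) (N : ℕ), IsAblowitzSegur A κ u ∧ 0 < C ∧
      ∀ n : ℕ, N ≤ n →
        H (n - 1) (lam0 t n) β ≠ 0 ∧ H n (lam0 t n) β ≠ 0 ∧ H (n + 1) (lam0 t n) β ≠ 0 ∧
        ∃ pm pn pp : Polynomial ℂ,
          MonicOrthPoly (n - 1) (lam0 t n) β pm ∧
          MonicOrthPoly n (lam0 t n) β pn ∧
          MonicOrthPoly (n + 1) (lam0 t n) β pp ∧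
          ∃ Q R : ℂ,
            (Polynomial.X * pn = pp + Polynomial.C Q * pn + Polynomial.C R * pm) ∧
            (∀ Q' R' : ℂ,
              Polynomial.X * pn = pp + Polynomial.C Q' * pn + Polynomial.C R' * pm →
              Q' = Q ∧ R' = R) ∧
            ‖R - (n : ℂ) / 2 + (1 / 2) * u t ^ 2 * (((n : ℝ) ^ ((1 : ℝ) / 3) : ℝ) : ℂ)‖ ≤ C := by
  open EdgeAsymptotics in
  obtain ⟨δ, hδ, hco, hco'⟩ := exists_coercive hβ hκ
  have hu : ∀ t, IsUnit (1 - κ ^ 2 • airyOp pairing (translate (airyC 0)) t) := fun t =>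
    isUnit_of_coercive hδ (hco' t)
  obtain ⟨C, ν₀, hC⟩ := exists_norm_recurrence_coeff_sub_le hβ hκ hδ hco hu t
  obtain ⟨N, hN⟩ := eventually_atTop.1 (((tendsto_rpow_atTop (y := (1 : ℝ) / 3)
    (by norm_num)).comp tendsto_natCast_atTop_atTop).eventually_ge_atTop ν₀)
  refine ⟨_, max C 1, max N 1, isAblowitzSegur_painleveQ hA rfl hδ hco' hu, by positivity,
    fun n hn => ⟨hankel_ne_zero hβ _, hankel_ne_zero hβ _, hankel_ne_zero hβ _, ?_⟩⟩
  have hn1 : 1 ≤ n := (le_max_right _ _).trans hn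
  have hν := hN n ((le_max_left _ _).trans hn)
  obtain ⟨k, rfl⟩ : ∃ k, n = k + 1 := ⟨n - 1, by omega⟩
  have hE := edgeScale_rpow hn1
  rw [lam0_eq hn1, Nat.add_sub_cancel]
  have hreg := regular_jumpFunctional (2 * √(((k + 1 : ℕ) : ℝ) / 2)
    + √(((k + 1 : ℕ) : ℝ) / 2) / (((k + 1 : ℕ) : ℝ) ^ ((1 : ℝ) / 3)) ^ 2 * t) hβ
  obtain ⟨pm, hpm⟩ := hreg.exists_monicOrth k
  obtain ⟨pn, hpn⟩ := hreg.exists_monicOrth (k + 1)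
  obtain ⟨pp, hpp⟩ := hreg.exists_monicOrth (k + 2)
  obtain ⟨Q, hQ⟩ := hreg.recurrence hpm hpn hpp
  refine ⟨pm, pn, pp, isMonicOrth_iff.1 hpm, isMonicOrth_iff.1 hpn, isMonicOrth_iff.1 hpp, Q, _,
    hQ, fun Q' R' h => recurrence_unique hpm hpn hQ h, ?_⟩
  have := hC k _ _ _ hE hν pm pn hpm hpn
  rw [mul_pow]
  exact this.trans (le_max_left _ _)
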